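/- arXiv:1607.06938 — 17 statements merged into one kernel-verified Lean document; each statement's English description precedes it below -/
import Mathlib

section
/- Let X be a real normed space and let ang : X_o × X_o → [0,π] be an angle function satisfying the five structural axioms. Then ang also satisfies the three positional properties: (6) parallelism: ang(x,y) = π if and only if y = αx for some α < 0; (7) supplementarity: ang(x,y) + ang(y,−x) = π for all x,y ∈ X_o; and (8) opposite invariance: ang(x,y) = ang(−x,−y) for all x,y ∈ X_o. -/
open Real

theorem angle_structural_implies_positional
    {X : Type*} [NormedAddCommGroup X] [NormedSpace ℝ X]
    (ang : X → X → ℝ)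
    (hrange : ∀ x y : X, x ≠ 0 → y ≠ 0 → ang x y ∈ Set.Icc 0 Real.pi)
    (hcont : ∀ x : X, x ≠ 0 →
      ContinuousOn (fun y => ang x y) {y : X | y ≠ 0} ∧
      ContinuousOn (fun y => ang y x) {y : X | y ≠ 0} ∧
      (fun y => ang x y) '' {y : X | y ≠ 0} = Set.Icc 0 Real.pi ∧
      (fun y => ang y x) '' {y : X | y ≠ 0} = Set.Icc 0 Real.pi)
    (hsymm : ∀ x y : X, x ≠ 0 → y ≠ 0 → ang x y = ang y x)
    (hhomog : ∀ x y : X, x ≠ 0 → y ≠ 0 → ∀ α β : ℝ, 0 < α → 0 < β →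
      ang (α • x) (β • y) = ang x y)
    (hadd : ∀ x y : X, x ≠ 0 → y ≠ 0 → ∀ α β : ℝ, 0 < α → 0 < β →
      ang x (α • x + β • y) + ang (α • x + β • y) y = ang x y)
    (hnd : ∀ x y : X, x ≠ 0 → y ≠ 0 → (ang x y = 0 ↔ ∃ α : ℝ, 0 < α ∧ x = α • y)) :
    (∀ x y : X, x ≠ 0 → y ≠ 0 → (ang x y = Real.pi ↔ ∃ α : ℝ, α < 0 ∧ y = α • x)) ∧
    (∀ x y : X, x ≠ 0 → y ≠ 0 → ang x y + ang y (-x) = Real.pi) ∧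
    (∀ x y : X, x ≠ 0 → y ≠ 0 → ang x y = ang (-x) (-y)) := by
  have neg_of_pi : ∀ x z : X, x ≠ 0 → z ≠ 0 → ang x z = π → ∃ α : ℝ, α < 0 ∧ z = α • x := by
    intro x z hx hz h
    have not_pos : ∀ c : ℝ, 0 < c → z ≠ c • x := by
      intro c hc hzc
      have h0 : ang z x = 0 := (hnd z x hz hx).2 ⟨c, hc, hzc⟩
      rw [hsymm z x hz hx, h] at h0
      exact pi_ne_zero h0
    have hy : z - x ≠ 0 := fun h0 => not_pos 1 one_pos (by rw [one_smul]; exact sub_eq_zero.1 h0)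
    have hsum := hadd x (z - x) hx hy 1 1 one_pos one_pos
    rw [one_smul, one_smul, add_sub_cancel, h] at hsum
    have hle := (hrange x (z - x) hx hy).2
    have hge := (hrange z (z - x) hz hy).1
    obtain ⟨a, ha, hza⟩ := (hnd z (z - x) hz hy).1 (by linarith)
    have key : (a - 1) • z = a • x := by
      rw [sub_smul, one_smul, sub_eq_iff_eq_add, ← sub_eq_iff_eq_add', ← smul_sub]
      exact hza.symm
    have ha1 : a - 1 ≠ 0 := by
      intro h1
      rw [h1, zero_smul] at key
      exact (smul_ne_zero ha.ne' hx) key.symm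
    have hz' : z = (a / (a - 1)) • x := by
      rw [div_eq_inv_mul, mul_smul, ← key, inv_smul_smul₀ ha1]
    refine ⟨a / (a - 1), ?_, hz'⟩
    rcases lt_or_gt_of_ne ha1 with h1 | h1
    · exact div_neg_of_pos_of_neg ha h1
    · exact absurd hz' (not_pos _ (div_pos ha h1))
  have neg_smul_right : ∀ x : X, x ≠ 0 → ∀ α : ℝ, α < 0 → ang x (α • x) = ang x (-x) := by
    intro x hx α hα
    have := hhomog x (-x) hx (neg_ne_zero.2 hx) 1 (-α) one_pos (neg_pos.2 hα)
    rwa [one_smul, neg_smul_neg] at this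
  have opposite : ∀ x : X, x ≠ 0 → ang x (-x) = π := by
    intro x hx
    have hmem : π ∈ (fun y => ang x y) '' {y : X | y ≠ 0} := by
      rw [(hcont x hx).2.2.1]
      exact ⟨pi_pos.le, le_rfl⟩
    obtain ⟨z, hz, h⟩ := hmem
    obtain ⟨α, hα, rfl⟩ := neg_of_pi x z hx hz h
    rw [← neg_smul_right x hx α hα]
    exact h
  have supplementary : ∀ x y : X, x ≠ 0 → y ≠ 0 → ang x y + ang y (-x) = π := by
    intro x y hx hy
    have hnx : -x ≠ 0 := neg_ne_zero.2 hx
    have hw : Filter.Tendsto (fun ε : ℝ => -x + ε • y) (nhdsWithin 0 (Set.Ioi 0)) (nhds (-x)) := by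
      have hc : Continuous (fun ε : ℝ => -x + ε • y) := by fun_prop
      have := hc.tendsto 0
      rw [zero_smul, add_zero] at this
      exact this.mono_left nhdsWithin_le_nhds
    have hlim : ∀ u : X, u ≠ 0 → Filter.Tendsto (fun ε : ℝ => ang u (-x + ε • y))
        (nhdsWithin 0 (Set.Ioi 0)) (nhds (ang u (-x))) := fun u hu =>
      ((hcont u hu).1.continuousAt (isOpen_ne.mem_nhds hnx)).tendsto.comp hw
    have heq : ∀ᶠ ε : ℝ in nhdsWithin 0 (Set.Ioi 0),
        ang x (-x + ε • y) = ang x y + ang y (-x + ε • y) := by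
      filter_upwards [self_mem_nhdsWithin, hw.eventually (isOpen_ne.mem_nhds hnx)] with ε hε hne
      have hε : 0 < ε := hε
      have hsum := hadd x (-x + ε • y) hx hne ε⁻¹ ε⁻¹ (inv_pos.2 hε) (inv_pos.2 hε)
      rw [← smul_add, add_neg_cancel_left, inv_smul_smul₀ hε.ne'] at hsum
      exact hsum.symm
    have := tendsto_nhds_unique ((hlim x hx).congr' heq) ((hlim y hy).const_add (ang x y))
    rw [← this, opposite x hx]
  refine ⟨fun x y hx hy => ⟨neg_of_pi x y hx hy, ?_⟩, supplementary, fun x y hx hy => ?_⟩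
  · rintro ⟨α, hα, rfl⟩
    rw [neg_smul_right x hx α hα, opposite x hx]
  · have h₁ := supplementary x y hx hy
    have h₂ := supplementary y (-x) hy (neg_ne_zero.2 hx)
    linarith
end

section
/- Let X be a real normed space and let ang : X_o × X_o → [0,π] be an angle function satisfying the five structural axioms. Then the congruence property (9) holds for ang if and only if the congruence property (10) holds for ang. -/
/-- The structural axioms of an angle function on a real normed space. -/
structure IsAngleFunction {X : Type*} [NormedAddCommGroup X] [NormedSpace ℝ X]
    (ang : X → X → ℝ) : Prop where
  nonneg : ∀ x y : X, x ≠ 0 → y ≠ 0 → 0 ≤ ang x y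
  le_pi : ∀ x y : X, x ≠ 0 → y ≠ 0 → ang x y ≤ Real.pi
  continuousOn : ∀ x : X, x ≠ 0 → ContinuousOn (fun y => ang x y) {y : X | y ≠ 0}
  exists_eq_pi : ∀ x : X, x ≠ 0 → ∃ y, y ≠ 0 ∧ ang x y = Real.pi
  symm : ∀ x y : X, x ≠ 0 → y ≠ 0 → ang x y = ang y x
  smul_smul : ∀ x y : X, x ≠ 0 → y ≠ 0 → ∀ α β : ℝ, 0 < α → 0 < β →
    ang (α • x) (β • y) = ang x y
  add : ∀ x y : X, x ≠ 0 → y ≠ 0 → ∀ α β : ℝ, 0 < α → 0 < β →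
    ang x (α • x + β • y) + ang (α • x + β • y) y = ang x y
  eq_zero_iff : ∀ x y : X, x ≠ 0 → y ≠ 0 → (ang x y = 0 ↔ SameRay ℝ x y)

/-- Two sides and the included angle of a triangle determine another angle. -/
def AngleCongruence {X : Type*} [NormedAddCommGroup X] (ang : X → X → ℝ) : Prop :=
  ∀ x y v w : X, x ≠ 0 → y ≠ 0 → v ≠ 0 → w ≠ 0 →
    ‖x‖ = ‖v‖ → ‖y‖ = ‖w‖ → ang x y = ang v w → x ≠ y →
    v ≠ w ∧ ang (x - y) (-y) = ang (v - w) (-w)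

/-- Two sides and the included angle of a triangle determine the third side. -/
def SideCongruence {X : Type*} [NormedAddCommGroup X] (ang : X → X → ℝ) : Prop :=
  ∀ x y v w : X, x ≠ 0 → y ≠ 0 → v ≠ 0 → w ≠ 0 →
    ‖x‖ = ‖v‖ → ‖y‖ = ‖w‖ → ang x y = ang v w → x ≠ y →
    v ≠ w ∧ ‖x - y‖ = ‖v - w‖

section

variable {X : Type*} [NormedAddCommGroup X] [NormedSpace ℝ X] {ang : X → X → ℝ}

theorem not_sameRay_of_linearIndependent {a b : X} (h : LinearIndependent ℝ ![a, b])
    {p q r s : ℝ} (hdet : p * s - q * r ≠ 0) :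
    ¬ SameRay ℝ (p • a + q • b) (r • a + s • b) := by
  intro hs
  have key := LinearIndependent.pair_iff.1 h
  have h2 : ¬ LinearIndependent ℝ ![p • a + q • b, r • a + s • b] :=
    sameRay_or_sameRay_neg_iff_not_linearIndependent.1 (Or.inl hs)
  apply h2
  rw [LinearIndependent.pair_iff]
  intro c d hcd
  obtain ⟨h3, h4⟩ := key (c * p + d * r) (c * q + d * s) (by rw [← hcd]; module)
  constructor
  · have : c * (p * s - q * r) = 0 := by linear_combination s * h3 - r * h4
    exact (mul_eq_zero.1 this).resolve_right hdet
  · have : d * (p * s - q * r) = 0 := by linear_combination p * h4 - q * h3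
    exact (mul_eq_zero.1 this).resolve_right hdet

namespace IsAngleFunction

theorem sameRay_neg_of_eq_pi (h : IsAngleFunction ang) {x y : X} (hx : x ≠ 0) (hy : y ≠ 0)
    (hxy : ang x y = Real.pi) : SameRay ℝ x (-y) := by
  have hns : ¬ SameRay ℝ x y := fun hs =>
    Real.pi_pos.ne' (hxy.symm.trans ((h.eq_zero_iff x y hx hy).2 hs))
  have hz : y - x ≠ 0 := fun h0 => hns (by rw [sub_eq_zero.1 h0])
  have h1 := h.add x (y - x) hx hz 1 1 one_pos one_pos
  have e : (1 : ℝ) • x + (1 : ℝ) • (y - x) = y := by module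
  rw [e, hxy] at h1
  have h0 : ang y (y - x) = 0 :=
    le_antisymm (by linarith [h.le_pi x (y - x) hx hz]) (h.nonneg y _ hy hz)
  obtain ⟨s, hs, hsy⟩ := (exists_pos_left_iff_sameRay hy hz).2 ((h.eq_zero_iff y _ hy hz).1 h0)
  have hx' : x = (1 - s) • y := by
    have : x = y - s • y := by rw [hsy]; abel
    rw [this]; module
  rcases le_or_gt s 1 with hs1 | hs1
  · exact absurd (hx' ▸ SameRay.sameRay_nonneg_smul_left y (sub_nonneg.2 hs1)) hns
  · have : x = (s - 1) • (-y) := by rw [hx']; module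
    rw [this]
    exact SameRay.sameRay_nonneg_smul_left _ (sub_nonneg.2 hs1.le)

theorem eq_of_sameRay_right (h : IsAngleFunction ang) {x y z : X} (hx : x ≠ 0) (hy : y ≠ 0)
    (hz : z ≠ 0) (hyz : SameRay ℝ y z) : ang x y = ang x z := by
  obtain ⟨s, hs, rfl⟩ := (exists_pos_left_iff_sameRay hy hz).2 hyz
  simpa using (h.smul_smul x y hx hy 1 s one_pos hs).symm

theorem eq_pi_iff (h : IsAngleFunction ang) {x y : X} (hx : x ≠ 0) (hy : y ≠ 0) :
    ang x y = Real.pi ↔ SameRay ℝ x (-y) := by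
  refine ⟨h.sameRay_neg_of_eq_pi hx hy, fun hs => ?_⟩
  obtain ⟨z, hz, hxz⟩ := h.exists_eq_pi x hx
  rw [← hxz]
  have hs' := h.sameRay_neg_of_eq_pi hx hz hxz
  refine h.eq_of_sameRay_right hx hy hz (sameRay_neg_iff.1 (hs.symm.trans hs' ?_))
  intro h0
  exact absurd h0 hx

theorem norm_sub_le_of_angleCongruence (h : IsAngleFunction ang) (h9 : AngleCongruence ang)
    {x y v w : X} (hx : x ≠ 0) (hy : y ≠ 0) (hv : v ≠ 0) (hw : w ≠ 0)
    (hxv : ‖x‖ = ‖v‖) (hyw : ‖y‖ = ‖w‖) (hang : ang x y = ang v w) (hxy : x ≠ y) :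
    ‖v - w‖ ≤ ‖x - y‖ := by
  by_cases hli : LinearIndependent ℝ ![v, w]
  · by_contra! hlt
    obtain ⟨hvw, h1⟩ := h9 x y v w hx hy hv hw hxv hyw hang hxy
    have hxy0 : 0 < ‖x - y‖ := norm_pos_iff.2 (sub_ne_zero.2 hxy)
    have hvw0 : 0 < ‖v - w‖ := norm_pos_iff.2 (sub_ne_zero.2 hvw)
    obtain ⟨s, hs⟩ : ∃ s, s = ‖x - y‖ / ‖v - w‖ := ⟨_, rfl⟩
    have hs0 : 0 < s := hs ▸ div_pos hxy0 hvw0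
    have hs1 : s < 1 := hs ▸ (div_lt_one hvw0).2 hlt
    have h2 := (h9 (x - y) (-y) (s • (v - w)) (-w) (sub_ne_zero.2 hxy) (neg_ne_zero.2 hy)
      (smul_ne_zero hs0.ne' (sub_ne_zero.2 hvw)) (neg_ne_zero.2 hw)
      (by rw [norm_smul, Real.norm_of_nonneg hs0.le, hs]; field_simp)
      (by simpa using hyw)
      (by
        rw [h1]
        simpa using (h.smul_smul (v - w) (-w) (sub_ne_zero.2 hvw) (neg_ne_zero.2 hw)
          s 1 hs0 one_pos).symm)
      (by
        intro h0
        apply hx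
        calc x = (x - y) - -y := by abel
          _ = 0 := sub_eq_zero.2 h0)).2
    have e1 : x - y - -y = x := by abel
    have e2 : s • (v - w) - -w = s • v + (1 - s) • w := by module
    rw [e1, e2, neg_neg, neg_neg, hang] at h2
    have h3 := h.add v w hv hw s (1 - s) hs0 (sub_pos.2 hs1)
    have hu : s • v + (1 - s) • w ≠ 0 := fun h0 =>
      hs0.ne' (LinearIndependent.pair_iff.1 hli _ _ h0).1
    have h4 : SameRay ℝ v (s • v + (1 - s) • w) :=
      (h.eq_zero_iff v _ hv hu).1 (by linarith)
    have h5 := not_sameRay_of_linearIndependent hli (p := 1) (q := 0) (r := s) (s := 1 - s)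
      (by simpa using (sub_pos.2 hs1).ne')
    simp only [one_smul, zero_smul, add_zero] at h5
    exact h5 h4
  · rcases sameRay_or_sameRay_neg_iff_not_linearIndependent.2 hli with hs | hs
    · have h1 := (h.eq_zero_iff x y hx hy).1 (hang.trans ((h.eq_zero_iff v w hv hw).2 hs))
      rw [hs.norm_sub, h1.norm_sub, hxv, hyw]
    · have h1 := (h.eq_pi_iff hx hy).1 (hang.trans ((h.eq_pi_iff hv hw).2 hs))
      have h2 := hs.norm_add
      have h3 := h1.norm_add
      rw [norm_neg, ← sub_eq_add_neg] at h2 h3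
      rw [h2, h3, hxv, hyw]

theorem sideCongruence_of_angleCongruence (h : IsAngleFunction ang) (h9 : AngleCongruence ang) :
    SideCongruence ang := by
  intro x y v w hx hy hv hw hxv hyw hang hxy
  have hvw := (h9 x y v w hx hy hv hw hxv hyw hang hxy).1
  exact ⟨hvw, le_antisymm
    (h.norm_sub_le_of_angleCongruence h9 hv hw hx hy hxv.symm hyw.symm hang.symm hvw)
    (h.norm_sub_le_of_angleCongruence h9 hx hy hv hw hxv hyw hang hxy)⟩

theorem norm_smul_sub_smul_comm (h : IsAngleFunction ang) (h10 : SideCongruence ang)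
    {x y : X} (hxy : ‖x‖ = ‖y‖) {a b : ℝ} (ha : 0 < a) (hb : 0 < b) :
    ‖a • x - b • y‖ = ‖b • x - a • y‖ := by
  rcases eq_or_ne x 0 with rfl | hx
  · have : y = 0 := norm_eq_zero.1 (by simpa using hxy.symm)
    simp [this]
  have hy : y ≠ 0 := norm_ne_zero_iff.1 (hxy ▸ norm_ne_zero_iff.2 hx)
  have hang : ang (a • x) (b • y) = ang (a • y) (b • x) := by
    rw [h.smul_smul x y hx hy a b ha hb, h.smul_smul y x hy hx a b ha hb, h.symm x y hx hy]
  have hn : ∀ c : ℝ, ‖c • x‖ = ‖c • y‖ := fun c => by rw [norm_smul, norm_smul, hxy]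
  rw [norm_sub_rev (b • x)]
  by_cases hne : a • x = b • y
  · by_cases hne' : a • y = b • x
    · rw [hne, hne', sub_self, sub_self]
    · exact absurd hne (h10 (a • y) (b • x) (a • x) (b • y) (smul_ne_zero ha.ne' hy)
        (smul_ne_zero hb.ne' hx) (smul_ne_zero ha.ne' hx) (smul_ne_zero hb.ne' hy)
        (hn a).symm (hn b) hang.symm hne').1
  · exact (h10 (a • x) (b • y) (a • y) (b • x) (smul_ne_zero ha.ne' hx)
      (smul_ne_zero hb.ne' hy) (smul_ne_zero ha.ne' hy) (smul_ne_zero hb.ne' hx)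
      (hn a) (hn b).symm hang hne).2

/-- The Ficken condition on vectors of equal norm. -/
theorem norm_smul_add_smul_comm (h : IsAngleFunction ang) (h10 : SideCongruence ang)
    {x y : X} (hxy : ‖x‖ = ‖y‖) (a b : ℝ) : ‖a • x + b • y‖ = ‖b • x + a • y‖ := by
  have hneg : ‖x‖ = ‖-y‖ := by rw [norm_neg, hxy]
  rcases lt_trichotomy a 0 with ha | rfl | ha
  · rcases lt_trichotomy b 0 with hb | rfl | hb
    · have := h.norm_smul_sub_smul_comm h10 hneg (neg_pos.2 ha) (neg_pos.2 hb)
      rw [← norm_neg (a • x + b • y), ← norm_neg (b • x + a • y)]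
      convert this using 2 <;> first | rfl | module
    · simp [norm_smul, hxy]
    · have := h.norm_smul_sub_smul_comm h10 hxy (neg_pos.2 ha) hb
      rw [← norm_neg (a • x + b • y)]
      convert this using 2 <;> first | rfl | module
  · simp [norm_smul, hxy]
  · rcases lt_trichotomy b 0 with hb | rfl | hb
    · have := h.norm_smul_sub_smul_comm h10 hxy ha (neg_pos.2 hb)
      rw [← norm_neg (b • x + a • y)]
      convert this using 2 <;> first | rfl | module
    · simp [norm_smul, hxy]
    · have := h.norm_smul_sub_smul_comm h10 hneg ha hb
      convert this using 2 <;> first | rfl | module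

theorem strictConvexSpace (h : IsAngleFunction ang) (h10 : SideCongruence ang) :
    StrictConvexSpace ℝ X := by
  refine StrictConvexSpace.of_norm_add_ne_two fun {x y} hx hy hxy hsum => hxy ?_
  obtain ⟨m, hm⟩ : ∃ m : X, m = (1 / 2 : ℝ) • (x + y) := ⟨_, rfl⟩
  obtain ⟨d, hd⟩ : ∃ d : X, d = (1 / 2 : ℝ) • (x - y) := ⟨_, rfl⟩
  have hmn : ‖m‖ = 1 := by rw [hm, norm_smul, hsum]; norm_num
  have refl_mid : ∀ t : ℝ, ‖m + t • d‖ = ‖m + (-t) • d‖ := by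
    intro t
    convert h.norm_smul_add_smul_comm h10 (hx.trans hy.symm) ((1 + t) / 2) ((1 - t) / 2)
      using 2 <;> (rw [hm, hd]; module)
  have refl_quarter : ∀ t : ℝ, ‖m + t • d‖ = ‖m + (1 - t) • d‖ := by
    intro t
    convert h.norm_smul_add_smul_comm h10 (hx.trans hmn.symm) t (1 - t)
      using 2 <;> (rw [hm, hd]; module)
  have hper : ∀ n : ℕ, ‖m + (n : ℝ) • d‖ = 1 := by
    intro n
    induction n with
    | zero => simpa using hmn
    | succ k ih =>
      rw [refl_quarter, show (1 : ℝ) - ((k + 1 : ℕ) : ℝ) = -k by push_cast; ring, ← refl_mid, ih]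
  have hd0 : ‖d‖ = 0 := by
    by_contra hne
    have hpos : 0 < ‖d‖ := lt_of_le_of_ne (norm_nonneg d) (Ne.symm hne)
    obtain ⟨n, hn⟩ := exists_nat_gt (2 / ‖d‖)
    rw [div_lt_iff₀ hpos] at hn
    have h1 : ‖(n : ℝ) • d‖ ≤ ‖m + (n : ℝ) • d‖ + ‖m‖ := by
      simpa using norm_sub_le (m + (n : ℝ) • d) m
    rw [hper, hmn, norm_smul, Real.norm_of_nonneg n.cast_nonneg] at h1
    linarith
  rw [norm_eq_zero, hd] at hd0
  exact sub_eq_zero.1 ((smul_eq_zero.1 hd0).resolve_left (by norm_num))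

end IsAngleFunction

/-- In a strictly convex space, rotating `b` towards `a` on its sphere brings it
strictly closer to `a`. -/
theorem norm_sub_lt_of_mem_cone [StrictConvexSpace ℝ X] {a b : X}
    (hli : LinearIndependent ℝ ![a, b]) {α β : ℝ} (hα : 0 < α) (hβ : 0 ≤ β)
    (hn : ‖α • a + β • b‖ = ‖b‖) : ‖a - (α • a + β • b)‖ < ‖a - b‖ := by
  obtain ⟨c, hc⟩ : ∃ c, c = α • a + β • b := ⟨_, rfl⟩
  rw [← hc] at hn ⊢
  rcases le_or_gt 1 (α + β) with h1 | h1
  · obtain ⟨t, ht⟩ : ∃ t, t = (α + β)⁻¹ := ⟨_, rfl⟩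
    have ht0 : 0 < t := ht ▸ inv_pos.2 (by linarith)
    have ht1 : t ≤ 1 := ht ▸ inv_le_one_of_one_le₀ h1
    have hsum : t * α + t * β = 1 := by
      rw [ht, ← mul_add]; exact inv_mul_cancel₀ (by linarith)
    have hβ' : t * β = 1 - t * α := by linarith
    have etc : t • c = (t * α) • a + (1 - t * α) • b := by rw [hc, ← hβ']; module
    have ebc : b - t • c = (-(t * α)) • a + (t * α) • b := by rw [etc]; module
    have eac : a - t • c = (1 - t * α) • (a - b) := by rw [etc]; module
    have hstrict : ‖b‖ < ‖b - t • c‖ + ‖t • c‖ := by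
      have hns : ¬ SameRay ℝ (b - t • c) (t • c) := by
        rw [ebc, etc]
        apply not_sameRay_of_linearIndependent hli
        have := mul_pos ht0 hα
        nlinarith
      simpa using norm_add_lt_of_not_sameRay hns
    have n1 : ‖b - t • c‖ = t * α * ‖a - b‖ := by
      have : b - t • c = (-(t * α)) • (a - b) := by rw [ebc]; module
      rw [this, norm_smul, norm_neg, Real.norm_of_nonneg (mul_pos ht0 hα).le]
    have n2 : ‖a - t • c‖ = (1 - t * α) * ‖a - b‖ := by
      rw [eac, norm_smul, Real.norm_of_nonneg (hβ' ▸ mul_nonneg ht0.le hβ)]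
    have n3 : ‖t • c‖ = t * ‖c‖ := by rw [norm_smul, Real.norm_of_nonneg ht0.le]
    have n4 : ‖a - c‖ ≤ ‖a - t • c‖ + (1 - t) * ‖c‖ := by
      have e : a - c = (a - t • c) - (1 - t) • c := by module
      have := norm_sub_le (a - t • c) ((1 - t) • c)
      rwa [← e, norm_smul, Real.norm_of_nonneg (sub_nonneg.2 ht1)] at this
    linarith
  · have hα1 : 0 < 1 - α := by linarith
    obtain ⟨s, hs⟩ : ∃ s, s = β / (1 - α) := ⟨_, rfl⟩
    have hs0 : 0 ≤ s := hs ▸ div_nonneg hβ hα1.le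
    have hs1 : s < 1 := hs ▸ (div_lt_one hα1).2 (by linarith)
    have hβ' : β = (1 - α) * s := by rw [hs]; field_simp
    have n1 : ‖a - c‖ = (1 - α) * ‖a - s • b‖ := by
      have : a - c = (1 - α) • (a - s • b) := by rw [hc, hβ']; module
      rw [this, norm_smul, Real.norm_of_nonneg hα1.le]
    have n2 : ‖c - s • b‖ = α * ‖a - s • b‖ := by
      have : c - s • b = α • (a - s • b) := by rw [hc, hβ']; module
      rw [this, norm_smul, Real.norm_of_nonneg hα.le]
    have n3 : ‖c‖ ≤ ‖c - s • b‖ + s * ‖b‖ := by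
      have := norm_add_le (c - s • b) (s • b)
      rwa [sub_add_cancel, norm_smul, Real.norm_of_nonneg hs0] at this
    have n4 : ‖a - s • b‖ < ‖a - b‖ + (1 - s) * ‖b‖ := by
      have hns : ¬ SameRay ℝ (a - b) ((1 - s) • b) := by
        have := not_sameRay_of_linearIndependent hli (p := 1) (q := -1) (r := 0) (s := 1 - s)
          (by simpa using (sub_pos.2 hs1).ne')
        simpa [sub_eq_add_neg] using this
      have := norm_add_lt_of_not_sameRay hns
      rw [norm_smul, Real.norm_of_nonneg (sub_pos.2 hs1).le] at this
      have e : a - b + (1 - s) • b = a - s • b := by module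
      rwa [e] at this
    linarith

namespace IsAngleFunction

/-- The angle of `a` with a suitable vector on the arc from `a` to `b` takes any
prescribed value below `ang a b`. -/
theorem exists_mem_cone_ang_eq (h : IsAngleFunction ang) {a b : X}
    (hli : LinearIndependent ℝ ![a, b]) {θ : ℝ} (hθ : 0 ≤ θ) (hθ' : θ < ang a b) :
    ∃ α β : ℝ, 0 < α ∧ 0 ≤ β ∧ ‖α • a + β • b‖ = ‖b‖ ∧ ang a (α • a + β • b) = θ := by
  have ha : a ≠ 0 := hli.ne_zero 0
  have hb : b ≠ 0 := hli.ne_zero 1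
  have hne : ∀ t : ℝ, (1 - t) • a + t • b ≠ 0 := fun t h0 => by
    obtain ⟨h1, h2⟩ := LinearIndependent.pair_iff.1 hli _ _ h0
    linarith
  have hc : ContinuousOn (fun t : ℝ => ang a ((1 - t) • a + t • b)) (Set.Icc 0 1) :=
    (h.continuousOn a ha).comp (by fun_prop) fun t _ => hne t
  have haa : ang a a = 0 := (h.eq_zero_iff a a ha ha).2 (SameRay.refl a)
  obtain ⟨t, ⟨ht0, ht1⟩, ht⟩ := intermediate_value_Icc zero_le_one hc
    (show θ ∈ Set.Icc _ _ by simpa [haa] using ⟨hθ, hθ'.le⟩)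
  have ht1' : t < 1 := lt_of_le_of_ne ht1 (by
    rintro rfl
    simp at ht
    linarith)
  obtain ⟨r, hr⟩ : ∃ r, r = ‖b‖ / ‖(1 - t) • a + t • b‖ := ⟨_, rfl⟩
  have hu := norm_pos_iff.2 (hne t)
  have hr0 : 0 < r := hr ▸ div_pos (norm_pos_iff.2 hb) hu
  have e : (r * (1 - t)) • a + (r * t) • b = r • ((1 - t) • a + t • b) := by module
  refine ⟨r * (1 - t), r * t, mul_pos hr0 (sub_pos.2 ht1'), mul_nonneg hr0.le ht0, ?_, ?_⟩
  · rw [e, norm_smul, Real.norm_of_nonneg hr0.le, hr, div_mul_cancel₀ _ hu.ne']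
  · rw [e, ← ht]
    simpa using h.smul_smul a _ ha (hne t) 1 r one_pos hr0

theorem ang_le_of_norm_eq (h : IsAngleFunction ang) (h10 : SideCongruence ang)
    {a b a' b' : X} (ha : a ≠ 0) (hb : b ≠ 0) (ha' : a' ≠ 0) (hb' : b' ≠ 0)
    (haa : ‖a‖ = ‖a'‖) (hbb : ‖b‖ = ‖b'‖) (hab : ‖a - b‖ = ‖a' - b'‖) :
    ang a b ≤ ang a' b' := by
  have := h.strictConvexSpace h10
  by_contra! hlt
  have h0 := h.nonneg a' b' ha' hb'
  by_cases hli : LinearIndependent ℝ ![a, b]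
  · obtain ⟨α, β, hα, hβ, hn, hang⟩ := h.exists_mem_cone_ang_eq hli h0 hlt
    have hclose := norm_sub_lt_of_mem_cone hli hα hβ hn
    have hc : α • a + β • b ≠ 0 := fun h0 =>
      hα.ne' (LinearIndependent.pair_iff.1 hli _ _ h0).1
    by_cases hac : a' = b'
    · have := (norm_nonneg _).trans_lt hclose
      rw [hab, hac, sub_self, norm_zero] at this
      exact lt_irrefl _ this
    · have := (h10 a' b' a _ ha' hb' ha hc haa.symm (hbb.symm.trans hn.symm) hang.symm hac).2
      linarith
  · rcases sameRay_or_sameRay_neg_iff_not_linearIndependent.2 hli with hs | hs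
    · rw [(h.eq_zero_iff a b ha hb).2 hs] at hlt
      linarith
    · have h2 := hs.norm_add
      rw [norm_neg, ← sub_eq_add_neg, hab, haa, hbb, sub_eq_add_neg, ← norm_neg b',
        ← sameRay_iff_norm_add] at h2
      rw [(h.eq_pi_iff ha' hb').2 h2] at hlt
      exact absurd (h.le_pi a b ha hb) (not_le.2 hlt)

theorem angleCongruence_of_sideCongruence (h : IsAngleFunction ang) (h10 : SideCongruence ang) :
    AngleCongruence ang := by
  intro x y v w hx hy hv hw hxv hyw hang hxy
  obtain ⟨hvw, hn⟩ := h10 x y v w hx hy hv hw hxv hyw hang hxy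
  have hyw' : ‖-y‖ = ‖-w‖ := by simpa using hyw
  have hside : ‖x - y - -y‖ = ‖v - w - -w‖ := by simpa using hxv
  rw [← sub_ne_zero] at hxy
  rw [← neg_ne_zero] at hy hw
  exact ⟨hvw, le_antisymm
    (h.ang_le_of_norm_eq h10 hxy hy (sub_ne_zero.2 hvw) hw hn hyw' hside)
    (h.ang_le_of_norm_eq h10 (sub_ne_zero.2 hvw) hw hxy hy hn.symm hyw'.symm hside.symm)⟩

end IsAngleFunction

end


open Real

theorem congruence_properties_equivalent
    {X : Type*} [NormedAddCommGroup X] [NormedSpace ℝ X]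
    (ang : X → X → ℝ)
    (hrange : ∀ x y : X, x ≠ 0 → y ≠ 0 → ang x y ∈ Set.Icc 0 Real.pi)
    (hcont : ∀ x : X, x ≠ 0 →
      ContinuousOn (fun y => ang x y) {y : X | y ≠ 0} ∧
      ContinuousOn (fun y => ang y x) {y : X | y ≠ 0} ∧
      (fun y => ang x y) '' {y : X | y ≠ 0} = Set.Icc 0 Real.pi ∧
      (fun y => ang y x) '' {y : X | y ≠ 0} = Set.Icc 0 Real.pi)
    (hsymm : ∀ x y : X, x ≠ 0 → y ≠ 0 → ang x y = ang y x)
    (hhomog : ∀ x y : X, x ≠ 0 → y ≠ 0 → ∀ α β : ℝ, 0 < α → 0 < β →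
      ang (α • x) (β • y) = ang x y)
    (hadd : ∀ x y : X, x ≠ 0 → y ≠ 0 → ∀ α β : ℝ, 0 < α → 0 < β →
      ang x (α • x + β • y) + ang (α • x + β • y) y = ang x y)
    (hnd : ∀ x y : X, x ≠ 0 → y ≠ 0 → (ang x y = 0 ↔ ∃ α : ℝ, 0 < α ∧ x = α • y)) :
    (∀ x y v w : X, x ≠ 0 → y ≠ 0 → v ≠ 0 → w ≠ 0 →
      ‖x‖ = ‖v‖ → ‖y‖ = ‖w‖ → ang x y = ang v w → x ≠ y →
      v ≠ w ∧ ang (x - y) (-y) = ang (v - w) (-w)) ↔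
    (∀ x y v w : X, x ≠ 0 → y ≠ 0 → v ≠ 0 → w ≠ 0 →
      ‖x‖ = ‖v‖ → ‖y‖ = ‖w‖ → ang x y = ang v w → x ≠ y →
      v ≠ w ∧ ‖x - y‖ = ‖v - w‖) := by
  have h : IsAngleFunction ang :=
    { nonneg := fun x y hx hy => (hrange x y hx hy).1
      le_pi := fun x y hx hy => (hrange x y hx hy).2
      continuousOn := fun x hx => (hcont x hx).1
      exists_eq_pi := fun x hx => by
        have hmem : Real.pi ∈ Set.Icc 0 Real.pi := ⟨Real.pi_pos.le, le_rfl⟩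
        rw [← (hcont x hx).2.2.1] at hmem
        exact hmem
      symm := hsymm
      smul_smul := hhomog
      add := hadd
      eq_zero_iff := fun x y hx hy => by
        rw [hnd x y hx hy, SameRay.sameRay_comm, ← exists_pos_left_iff_sameRay hy hx]
        simp only [eq_comm] }
  exact ⟨h.sideCongruence_of_angleCongruence, h.angleCongruence_of_sideCongruence⟩
end

section
/- Let X be a real normed space admitting an angle function ang : X_o × X_o → [0,π] which satisfies all five structural axioms and the congruence properties (9) and (10). Then the norm of X is derived from an inner product, i.e., the norm satisfies the parallelogram law ‖x+y‖² + ‖x−y‖² = 2‖x‖² + 2‖y‖² for all x,y ∈ X. -/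
open Real

section SwapInvariant

variable {X : Type*} [NormedAddCommGroup X] [NormedSpace ℝ X]

/-- If swapping vectors of equal norm preserves the norm of linear combinations, then isosceles
orthogonality is homogeneous. -/
theorem norm_add_smul_eq_norm_sub_smul_of_swap
    (swap : ∀ x y : X, ‖x‖ = ‖y‖ → ∀ a b : ℝ, ‖a • x + b • y‖ = ‖b • x + a • y‖)
    {u v : X} (h : ‖u + v‖ = ‖u - v‖) (a b : ℝ) : ‖a • u + b • v‖ = ‖a • u - b • v‖ := by
  have key := swap (u + v) (u - v) h ((a + b) / 2) ((a - b) / 2)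
  convert key using 2 <;> module

/-- Under swap invariance, isosceles orthogonal unit vectors are orthonormal coordinates. -/
theorem sq_norm_smul_add_smul_of_swap
    (swap : ∀ x y : X, ‖x‖ = ‖y‖ → ∀ a b : ℝ, ‖a • x + b • y‖ = ‖b • x + a • y‖)
    {u v : X} (hu : ‖u‖ = 1) (hv : ‖v‖ = 1) (h : ‖u + v‖ = ‖u - v‖) (a b : ℝ) :
    ‖a • u + b • v‖ ^ 2 = a ^ 2 + b ^ 2 := by
  have quarter_turn (c d : ℝ) : ‖c • u + d • v‖ = ‖(-d) • u + c • v‖ := by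
    rw [swap u v (hu.trans hv.symm) c d, norm_add_smul_eq_norm_sub_smul_of_swap swap h d c,
      ← norm_neg]
    congr 1
    module
  obtain ⟨r, hr0, hr⟩ : ∃ r : ℝ, 0 ≤ r ∧ r ^ 2 = a ^ 2 + b ^ 2 :=
    ⟨√(a ^ 2 + b ^ 2), Real.sqrt_nonneg _, Real.sq_sqrt (by positivity)⟩
  by_cases hra : r + a = 0
  · have ha : a = -r := by linarith
    have hb : b = 0 := by
      subst ha
      nlinarith
    simp [hb, norm_smul, hu]
  have hpq : ‖((r + a) • u + b • v) + ((-b) • u + (r + a) • v)‖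
      = ‖((r + a) • u + b • v) - ((-b) • u + (r + a) • v)‖ := by
    have turn := quarter_turn (r + a + b) (b - (r + a))
    rw [show ((r + a) • u + b • v) + ((-b) • u + (r + a) • v)
        = (-(b - (r + a))) • u + (r + a + b) • v by module, ← turn]
    congr 1
    module
  have reflect := norm_add_smul_eq_norm_sub_smul_of_swap swap hpq (1 / 2) (-b / (2 * (r + a)))
  have hfst : (1 / 2 : ℝ) • ((r + a) • u + b • v)
      + (-b / (2 * (r + a))) • ((-b) • u + (r + a) • v) = r • u := by
    match_scalars
    · field_simp
      linear_combination -hr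
    · field_simp
      ring
  have hsnd : (1 / 2 : ℝ) • ((r + a) • u + b • v)
      - (-b / (2 * (r + a))) • ((-b) • u + (r + a) • v) = a • u + b • v := by
    match_scalars
    · field_simp
      linear_combination hr
    · field_simp
      ring
  rw [hfst, hsnd, norm_smul, hu, Real.norm_of_nonneg hr0, mul_one] at reflect
  rw [← reflect, hr]

/-- The parallelogram law holds for multiples of a single vector. -/
theorem parallelogram_smul_smul (z : X) (a b : ℝ) :
    ‖a • z + b • z‖ ^ 2 + ‖a • z - b • z‖ ^ 2 = 2 * ‖a • z‖ ^ 2 + 2 * ‖b • z‖ ^ 2 := by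
  simp only [← add_smul, ← sub_smul, norm_smul, mul_pow, Real.norm_eq_abs, sq_abs]
  ring

/-- Ficken's theorem: swap invariance implies the parallelogram law. -/
theorem parallelogram_of_swap
    (swap : ∀ x y : X, ‖x‖ = ‖y‖ → ∀ a b : ℝ, ‖a • x + b • y‖ = ‖b • x + a • y‖) (x y : X) :
    ‖x + y‖ ^ 2 + ‖x - y‖ ^ 2 = 2 * ‖x‖ ^ 2 + 2 * ‖y‖ ^ 2 := by
  rcases eq_or_ne x 0 with rfl | hx
  · simpa using parallelogram_smul_smul y 0 1
  rcases eq_or_ne y 0 with rfl | hy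
  · simpa using parallelogram_smul_smul x 1 0
  obtain ⟨s, e, he, rfl⟩ : ∃ (s : ℝ) (e : X), ‖e‖ = 1 ∧ x = s • e :=
    ⟨‖x‖, ‖x‖⁻¹ • x, by
      rw [norm_smul, norm_inv, norm_norm, inv_mul_cancel₀ (norm_ne_zero_iff.2 hx)], by
      rw [smul_inv_smul₀ (norm_ne_zero_iff.2 hx)]⟩
  obtain ⟨t, f, hf, rfl⟩ : ∃ (t : ℝ) (f : X), ‖f‖ = 1 ∧ y = t • f :=
    ⟨‖y‖, ‖y‖⁻¹ • y, by
      rw [norm_smul, norm_inv, norm_norm, inv_mul_cancel₀ (norm_ne_zero_iff.2 hy)], by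
      rw [smul_inv_smul₀ (norm_ne_zero_iff.2 hy)]⟩
  by_cases hadd : e + f = 0
  · obtain rfl := eq_neg_of_add_eq_zero_right hadd
    simpa using parallelogram_smul_smul e s (-t)
  by_cases hsub : e - f = 0
  · obtain rfl := sub_eq_zero.1 hsub
    exact parallelogram_smul_smul e s t
  have hm := norm_ne_zero_iff.2 hadd
  have hn := norm_ne_zero_iff.2 hsub
  set m := ‖e + f‖
  set n := ‖e - f‖
  have hu : ‖m⁻¹ • (e + f)‖ = 1 := by
    rw [norm_smul, norm_inv, norm_norm, inv_mul_cancel₀ hm]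
  have hv : ‖n⁻¹ • (e - f)‖ = 1 := by
    rw [norm_smul, norm_inv, norm_norm, inv_mul_cancel₀ hn]
  have hef : ‖(e + f) + (e - f)‖ = ‖(e + f) - (e - f)‖ := by
    rw [show (e + f) + (e - f) = (2 : ℝ) • e by module,
      show (e + f) - (e - f) = (2 : ℝ) • f by module, norm_smul, norm_smul, he, hf]
  have coords := sq_norm_smul_add_smul_of_swap swap hu hv
    (norm_add_smul_eq_norm_sub_smul_of_swap swap hef m⁻¹ n⁻¹)
  have hcomb (a b : ℝ) :
      ‖a • e + b • f‖ ^ 2 = ((a + b) / 2 * m) ^ 2 + ((a - b) / 2 * n) ^ 2 := by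
    rw [← coords]
    congr 2
    rw [smul_smul, smul_smul, mul_inv_cancel_right₀ hm, mul_inv_cancel_right₀ hn]
    module
  have h₁ := hcomb s t
  have h₂ := hcomb s (-t)
  have h₃ := hcomb s 0
  have h₄ := hcomb 0 t
  simp only [neg_smul, ← sub_eq_add_neg, zero_smul, add_zero, zero_add] at h₂ h₃ h₄
  rw [h₁, h₂, h₃, h₄]
  ring

end SwapInvariant

/-- Side-angle-side congruence for a symmetric homogeneous angle gives swap invariance. -/
theorem norm_smul_add_smul_swap_of_angle {X : Type*} [NormedAddCommGroup X] [NormedSpace ℝ X]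
    (ang : X → X → ℝ)
    (hsymm : ∀ x y : X, x ≠ 0 → y ≠ 0 → ang x y = ang y x)
    (hhomog : ∀ x y : X, x ≠ 0 → y ≠ 0 → ∀ α β : ℝ, 0 < α → 0 < β →
      ang (α • x) (β • y) = ang x y)
    (hcong : ∀ x y v w : X, x ≠ 0 → y ≠ 0 → v ≠ 0 → w ≠ 0 →
      ‖x‖ = ‖v‖ → ‖y‖ = ‖w‖ → ang x y = ang v w → x ≠ y →
      v ≠ w ∧ ‖x - y‖ = ‖v - w‖)
    (x y : X) (hxy : ‖x‖ = ‖y‖) (a b : ℝ) : ‖a • x + b • y‖ = ‖b • x + a • y‖ := by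
  rcases eq_or_ne x 0 with rfl | hx
  · obtain rfl : y = 0 := by simpa using hxy.symm
    simp
  have pos_sub (z : X) (hz : ‖x‖ = ‖z‖) (c d : ℝ) (hc : 0 < c) (hd : 0 < d) :
      ‖c • x - d • z‖ = ‖c • z - d • x‖ := by
    have hz0 : z ≠ 0 := norm_ne_zero_iff.1 (hz ▸ norm_ne_zero_iff.2 hx)
    rcases eq_or_ne c d with rfl | hcd
    · exact norm_sub_rev _ _
    refine (hcong (c • x) (d • z) (c • z) (d • x) (smul_ne_zero hc.ne' hx)
      (smul_ne_zero hd.ne' hz0) (smul_ne_zero hc.ne' hz0) (smul_ne_zero hd.ne' hx)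
      (by rw [norm_smul, norm_smul, hz]) (by rw [norm_smul, norm_smul, hz]) ?_ ?_).2
    · rw [hhomog x z hx hz0 c d hc hd, hhomog z x hz0 hx c d hc hd, hsymm x z hx hz0]
    · intro heq
      have hnorm := congrArg norm heq
      rw [norm_smul, norm_smul, ← hz, Real.norm_of_nonneg hc.le, Real.norm_of_nonneg hd.le] at hnorm
      exact hcd (mul_right_cancel₀ (norm_ne_zero_iff.2 hx) hnorm)
  have pos_left (c d : ℝ) (hc : 0 < c) : ‖c • x + d • y‖ = ‖d • x + c • y‖ := by
    rcases lt_trichotomy d 0 with hd | rfl | hd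
    · convert pos_sub y hxy c (-d) hc (neg_pos.2 hd) using 1 <;> exact congrArg norm (by module)
    · simp [norm_smul, hxy]
    · rw [← norm_neg (d • x + c • y)]
      convert pos_sub (-y) (by rwa [norm_neg]) c d hc hd using 1 <;> exact congrArg norm (by module)
  rcases lt_trichotomy a 0 with ha | rfl | ha
  · rw [← norm_neg, ← norm_neg (b • x + a • y)]
    convert pos_left (-a) (-b) (neg_pos.2 ha) using 1 <;> exact congrArg norm (by module)
  · simp [norm_smul, hxy]
  · exact pos_left a b ha

theorem angle_with_congruence_implies_inner_product
    {X : Type*} [NormedAddCommGroup X] [NormedSpace ℝ X]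
    (ang : X → X → ℝ)
    (hrange : ∀ x y : X, x ≠ 0 → y ≠ 0 → ang x y ∈ Set.Icc 0 Real.pi)
    (hcont : ∀ x : X, x ≠ 0 →
      ContinuousOn (fun y => ang x y) {y : X | y ≠ 0} ∧
      ContinuousOn (fun y => ang y x) {y : X | y ≠ 0} ∧
      (fun y => ang x y) '' {y : X | y ≠ 0} = Set.Icc 0 Real.pi ∧
      (fun y => ang y x) '' {y : X | y ≠ 0} = Set.Icc 0 Real.pi)
    (hsymm : ∀ x y : X, x ≠ 0 → y ≠ 0 → ang x y = ang y x)
    (hhomog : ∀ x y : X, x ≠ 0 → y ≠ 0 → ∀ α β : ℝ, 0 < α → 0 < β →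
      ang (α • x) (β • y) = ang x y)
    (hadd : ∀ x y : X, x ≠ 0 → y ≠ 0 → ∀ α β : ℝ, 0 < α → 0 < β →
      ang x (α • x + β • y) + ang (α • x + β • y) y = ang x y)
    (hnd : ∀ x y : X, x ≠ 0 → y ≠ 0 → (ang x y = 0 ↔ ∃ α : ℝ, 0 < α ∧ x = α • y))
    (hcong9 : ∀ x y v w : X, x ≠ 0 → y ≠ 0 → v ≠ 0 → w ≠ 0 →
      ‖x‖ = ‖v‖ → ‖y‖ = ‖w‖ → ang x y = ang v w → x ≠ y →
      v ≠ w ∧ ang (x - y) (-y) = ang (v - w) (-w))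
    (hcong10 : ∀ x y v w : X, x ≠ 0 → y ≠ 0 → v ≠ 0 → w ≠ 0 →
      ‖x‖ = ‖v‖ → ‖y‖ = ‖w‖ → ang x y = ang v w → x ≠ y →
      v ≠ w ∧ ‖x - y‖ = ‖v - w‖) :
    ∀ x y : X, ‖x + y‖ ^ 2 + ‖x - y‖ ^ 2 = 2 * ‖x‖ ^ 2 + 2 * ‖y‖ ^ 2 := by
  exact parallelogram_of_swap (norm_smul_add_smul_swap_of_angle ang hsymm hhomog hcong10)
end

section
/- Let X be a real normed space and let ang : X_o × X_o → [0,π] be an angle function satisfying all five structural axioms and the congruence properties (9) and (10). If x,y,v,w ∈ X_o are such that ‖x‖ = ‖v‖, ‖y‖ = ‖w‖ and ‖x−y‖ = ‖v−w‖, then ang(x,y) = ang(v,w). -/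
open Real

/-- An angle function on a real normed space satisfying the side-angle-side congruence
properties. -/
structure IsCongruenceAngle {X : Type*} [NormedAddCommGroup X] [NormedSpace ℝ X]
    (ang : X → X → ℝ) : Prop where
  le_pi : ∀ x y : X, x ≠ 0 → y ≠ 0 → ang x y ≤ π
  nonneg : ∀ x y : X, x ≠ 0 → y ≠ 0 → 0 ≤ ang x y
  cont : ∀ x : X, x ≠ 0 → ContinuousOn (fun y => ang x y) {y : X | y ≠ 0}
  exists_pi : ∀ x : X, x ≠ 0 → ∃ y, y ≠ 0 ∧ ang x y = π
  symm : ∀ x y : X, x ≠ 0 → y ≠ 0 → ang x y = ang y x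
  homog : ∀ x y : X, x ≠ 0 → y ≠ 0 → ∀ α β : ℝ, 0 < α → 0 < β →
    ang (α • x) (β • y) = ang x y
  add : ∀ x y : X, x ≠ 0 → y ≠ 0 → ∀ α β : ℝ, 0 < α → 0 < β →
    ang x (α • x + β • y) + ang (α • x + β • y) y = ang x y
  eq_zero_iff : ∀ x y : X, x ≠ 0 → y ≠ 0 → (ang x y = 0 ↔ ∃ α : ℝ, 0 < α ∧ x = α • y)
  sas_ang : ∀ x y v w : X, x ≠ 0 → y ≠ 0 → v ≠ 0 → w ≠ 0 →
    ‖x‖ = ‖v‖ → ‖y‖ = ‖w‖ → ang x y = ang v w → x ≠ y →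
    ang (x - y) (-y) = ang (v - w) (-w)
  sas_norm : ∀ x y v w : X, x ≠ 0 → y ≠ 0 → v ≠ 0 → w ≠ 0 →
    ‖x‖ = ‖v‖ → ‖y‖ = ‖w‖ → ang x y = ang v w → x ≠ y → ‖x - y‖ = ‖v - w‖

namespace IsCongruenceAngle

variable {X : Type*} [NormedAddCommGroup X] [NormedSpace ℝ X] {ang : X → X → ℝ}

theorem smul_left (h : IsCongruenceAngle ang) {x y : X} (hx : x ≠ 0) (hy : y ≠ 0) {c : ℝ}
    (hc : 0 < c) : ang (c • x) y = ang x y := by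
  simpa using h.homog x y hx hy c 1 hc one_pos

theorem smul_right (h : IsCongruenceAngle ang) {x y : X} (hx : x ≠ 0) (hy : y ≠ 0) {c : ℝ}
    (hc : 0 < c) : ang x (c • y) = ang x y := by
  simpa using h.homog x y hx hy 1 c one_pos hc

theorem self_smul (h : IsCongruenceAngle ang) {x : X} (hx : x ≠ 0) {c : ℝ} (hc : 0 < c) :
    ang x (c • x) = 0 := by
  rw [h.smul_right hx hx hc]
  exact (h.eq_zero_iff x x hx hx).2 ⟨1, one_pos, (one_smul ℝ x).symm⟩

theorem add_smul_ne_zero {x z : X} (hz : ∀ c : ℝ, z ≠ c • x) (a : ℝ) {b : ℝ} (hb : b ≠ 0) :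
    a • x + b • z ≠ 0 := by
  intro h0
  apply hz (-(b⁻¹ * a))
  have : b⁻¹ • (a • x + b • z) = 0 := by rw [h0, smul_zero]
  rw [smul_add, smul_smul, smul_smul, inv_mul_cancel₀ hb, one_smul] at this
  rw [neg_smul]
  exact eq_neg_of_add_eq_zero_right this

theorem self_neg (h : IsCongruenceAngle ang) {x : X} (hx : x ≠ 0) : ang x (-x) = π := by
  obtain ⟨z, hz0, hz⟩ := h.exists_pi x hx
  by_cases hd : ∃ c : ℝ, z = c • x
  · obtain ⟨c, rfl⟩ := hd
    rcases lt_trichotomy c 0 with hc | hc | hc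
    · rw [← hz, ← h.smul_right hx (neg_ne_zero.2 hx) (neg_pos.2 hc), smul_neg, neg_smul, neg_neg]
    · simp [hc] at hz0
    · exact absurd ((h.self_smul hx hc).symm.trans hz) pi_pos.ne
  · push Not at hd
    exfalso
    set y : X := (-1 : ℝ) • x + (1 : ℝ) • z with hy
    have hy0 : y ≠ 0 := add_smul_ne_zero hd _ one_ne_zero
    have hzy : z = (1 : ℝ) • x + (1 : ℝ) • y := by rw [hy]; module
    have hsum := h.add x y hx hy0 1 1 one_pos one_pos
    rw [← hzy, hz] at hsum
    have hle := h.le_pi x y hx hy0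
    have hnn := h.nonneg z y hz0 hy0
    obtain ⟨α, hα, hαz⟩ := (h.eq_zero_iff z y hz0 hy0).1 (by linarith)
    apply add_smul_ne_zero (x := z) (z := x) (a := α - 1) (b := -α) _ (neg_ne_zero.2 hα.ne')
    · have : (α - 1) • z + (-α) • x = α • y - z := by rw [hy]; module
      rw [this, ← hαz, sub_self]
    · rintro c rfl
      have hc : c ≠ 0 := by rintro rfl; simp at hx
      exact hd c⁻¹ (by rw [smul_smul, inv_mul_cancel₀ hc, one_smul])

theorem self_smul_of_neg (h : IsCongruenceAngle ang) {x : X} (hx : x ≠ 0) {c : ℝ} (hc : c < 0) :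
    ang x (c • x) = π := by
  rw [← h.self_neg hx, ← h.smul_right hx (neg_ne_zero.2 hx) (neg_pos.2 hc), smul_neg, neg_smul,
    neg_neg]

theorem add_ang_neg (h : IsCongruenceAngle ang) {x z : X} (hx : x ≠ 0) (hz : z ≠ 0) :
    ang x z + ang z (-x) = π := by
  have hnx : -x ≠ 0 := neg_ne_zero.2 hx
  by_cases hd : ∃ c : ℝ, z = c • x
  · obtain ⟨c, rfl⟩ := hd
    rcases lt_trichotomy c 0 with hc | hc | hc
    · rw [h.self_smul_of_neg hx hc, h.symm _ _ hz hnx]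
      have : c • x = (-c) • (-x) := by module
      rw [this, h.self_smul hnx (neg_pos.2 hc), add_zero]
    · simp [hc] at hz
    · rw [h.self_smul hx hc, h.smul_left hx hnx hc, h.self_neg hx, zero_add]
  · push Not at hd
    let Y : ℝ → X := fun ε => (-1 : ℝ) • x + ε • z
    have hY0 : Y 0 = -x := by simp [Y]
    have hYc : Filter.Tendsto Y (nhdsWithin 0 (Set.Ioi 0)) (nhds (-x)) := by
      have : Continuous Y := by fun_prop
      exact hY0 ▸ this.continuousAt.tendsto.mono_left nhdsWithin_le_nhds
    have hlim : ∀ u : X, u ≠ 0 →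
        Filter.Tendsto (fun ε => ang u (Y ε)) (nhdsWithin 0 (Set.Ioi 0)) (nhds (ang u (-x))) :=
      fun u hu => ((h.cont u hu).continuousAt (isOpen_ne.mem_nhds hnx)).tendsto.comp hYc
    have h1 := hlim x hx
    have h2 := (hlim z hz).const_add (ang x z)
    have heq : (fun ε => ang x z + ang z (Y ε)) =ᶠ[nhdsWithin 0 (Set.Ioi 0)]
        fun ε => ang x (Y ε) := by
      filter_upwards [self_mem_nhdsWithin] with ε hε
      have hε : 0 < ε := hε
      have hy0 : Y ε ≠ 0 := add_smul_ne_zero hd _ hε.ne'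
      have hzy : z = ε⁻¹ • x + ε⁻¹ • Y ε := by
        simp only [Y, smul_add, smul_smul, inv_mul_cancel₀ hε.ne']
        module
      have := h.add x (Y ε) hx hy0 ε⁻¹ ε⁻¹ (inv_pos.2 hε) (inv_pos.2 hε)
      rwa [← hzy] at this
    rw [← h.self_neg hx]
    exact tendsto_nhds_unique (h2.congr' heq) h1 |>.symm ▸ rfl

theorem neg_right (h : IsCongruenceAngle ang) {x z : X} (hx : x ≠ 0) (hz : z ≠ 0) :
    ang x (-z) = π - ang x z := by
  have := h.add_ang_neg hz hx
  rw [h.symm z x hz hx] at this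
  linarith

theorem neg_left (h : IsCongruenceAngle ang) {x z : X} (hx : x ≠ 0) (hz : z ≠ 0) :
    ang (-x) z = π - ang x z := by
  rw [h.symm _ _ (neg_ne_zero.2 hx) hz, h.neg_right hz hx, h.symm _ _ hx hz]

theorem smul_left_eq_pi_div_two (h : IsCongruenceAngle ang) {x z : X} (hx : x ≠ 0) (hz : z ≠ 0)
    (hxz : ang x z = π / 2) {c : ℝ} (hc : c ≠ 0) : ang (c • x) z = π / 2 := by
  rcases hc.lt_or_gt with hc | hc
  · have : c • x = (-c) • (-x) := by module
    rw [this, h.smul_left (neg_ne_zero.2 hx) hz (neg_pos.2 hc), h.neg_left hx hz, hxz]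
    ring
  · rw [h.smul_left hx hz hc, hxz]

theorem ne_smul_of_eq_pi_div_two (h : IsCongruenceAngle ang) {x z : X} (hx : x ≠ 0) (hz : z ≠ 0)
    (hxz : ang x z = π / 2) (c : ℝ) : z ≠ c • x := by
  rintro rfl
  have := pi_pos
  rcases lt_trichotomy c 0 with hc | hc | hc
  · rw [h.self_smul_of_neg hx hc] at hxz
    linarith
  · simp [hc] at hz
  · rw [h.self_smul hx hc] at hxz
    linarith

theorem add_sub_eq_pi_div_two (h : IsCongruenceAngle ang) {p q : X} (hpq : ‖p‖ = ‖q‖)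
    (hne : p ≠ q) (hadd : p + q ≠ 0) : ang (p + q) (q - p) = π / 2 := by
  have hp : p ≠ 0 := by
    rintro rfl
    rw [norm_zero] at hpq
    exact hne (norm_eq_zero.1 hpq.symm).symm
  have hq : q ≠ 0 := by
    rintro rfl
    rw [norm_zero] at hpq
    exact hne (norm_eq_zero.1 hpq)
  have hsub : q - p ≠ 0 := sub_ne_zero.2 hne.symm
  have hsub' : p - q ≠ 0 := sub_ne_zero.2 hne
  have half : (0 : ℝ) < 2⁻¹ := by norm_num
  have hbase := h.sas_ang p q q p hp hq hq hp hpq hpq.symm (h.symm p q hp hq) hne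
  have hmid := h.sas_ang (-q) ((2⁻¹ : ℝ) • (p - q)) (-p) ((2⁻¹ : ℝ) • (q - p))
    (neg_ne_zero.2 hq) (smul_ne_zero half.ne' hsub') (neg_ne_zero.2 hp)
    (smul_ne_zero half.ne' hsub) (by simp [hpq]) (by rw [norm_smul, norm_smul, norm_sub_rev])
    (by
      rw [h.smul_right (neg_ne_zero.2 hq) hsub' half, h.smul_right (neg_ne_zero.2 hp) hsub half,
        h.symm _ _ (neg_ne_zero.2 hq) hsub', h.symm _ _ (neg_ne_zero.2 hp) hsub, hbase])
    (by
      intro h0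
      apply hadd
      have : p + q = (-2 : ℝ) • (-q - (2⁻¹ : ℝ) • (p - q)) := by module
      rw [this, h0, sub_self, smul_zero])
  have e1 : -q - (2⁻¹ : ℝ) • (p - q) = (2⁻¹ : ℝ) • (-(p + q)) := by module
  have e2 : -p - (2⁻¹ : ℝ) • (q - p) = (2⁻¹ : ℝ) • (-(p + q)) := by module
  have e3 : -((2⁻¹ : ℝ) • (p - q)) = (2⁻¹ : ℝ) • (q - p) := by module
  have e4 : -((2⁻¹ : ℝ) • (q - p)) = (2⁻¹ : ℝ) • (-(q - p)) := by module
  have hn := neg_ne_zero.2 hadd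
  rw [e1, e2, e3, e4, h.homog _ _ hn hsub _ _ half half,
    h.homog _ _ hn (neg_ne_zero.2 hsub) _ _ half half, h.neg_right hn hsub,
    h.neg_left hadd hsub] at hmid
  linarith

/-- In a plane, the perpendicular direction to `d` is unique. -/
theorem coeff_eq_zero_of_perp (h : IsCongruenceAngle ang) {u d : X} (hu : u ≠ 0) (hd : d ≠ 0)
    (hud : ang u d = π / 2) {a t : ℝ} (hne : a • u + t • d ≠ 0)
    (hperp : ang (a • u + t • d) d = π / 2) : t = 0 := by
  by_contra ht
  by_cases ha : a = 0
  · subst ha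
    rw [zero_smul, zero_add] at hne hperp
    exact h.ne_smul_of_eq_pi_div_two hne hd hperp t⁻¹
      (by rw [smul_smul, inv_mul_cancel₀ ht, one_smul])
  have key : ∀ (e : X) (s : ℝ), e ≠ 0 → 0 < s → ang u e = π / 2 → a • u + s • e ≠ 0 →
      ang (a • u + s • e) e = π / 2 → False := by
    intro e s he hs hue hne hperp
    have hau : a • u ≠ 0 := smul_ne_zero ha hu
    have hsum := h.add (a • u) e hau he 1 s one_pos hs
    rw [one_smul, hperp, h.smul_left_eq_pi_div_two hu he hue ha] at hsum
    obtain ⟨α, hα, hαu⟩ := (h.eq_zero_iff _ _ hau hne).1 (by linarith)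
    refine add_smul_ne_zero (h.ne_smul_of_eq_pi_div_two hu he hue) (α * a - a)
      (mul_ne_zero hα.ne' hs.ne') ?_
    have : (α * a - a) • u + (α * s) • e = α • (a • u + s • e) - a • u := by module
    rw [this, ← hαu, sub_self]
  rcases Ne.lt_or_gt ht with ht | ht
  · have e : a • u + (-t) • (-d) = a • u + t • d := by module
    refine key (-d) (-t) (neg_ne_zero.2 hd) (neg_pos.2 ht) ?_ (e ▸ hne) ?_
    · rw [h.neg_right hu hd, hud]
      ring
    · rw [e, h.neg_right hne hd, hperp]
      ring
  · exact key d t hd ht hud hne hperp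

theorem ang_smul_add_eq_ang_smul_sub (h : IsCongruenceAngle ang) {x d : X} (hx : x ≠ 0)
    (hd : d ≠ 0) (hxd : ang x d = π / 2) (c : ℝ) : ang x (c • x - d) = ang x (c • x + d) := by
  have hnd := neg_ne_zero.2 hd
  rcases eq_or_ne c 0 with rfl | hc
  · rw [zero_smul, zero_sub, zero_add, h.neg_right hx hd, hxd]
    ring
  have hind := h.ne_smul_of_eq_pi_div_two hx hd hxd
  have hp : c • x + d ≠ 0 := by simpa using add_smul_ne_zero hind c one_ne_zero
  have hm : c • x - d ≠ 0 := by
    simpa [sub_eq_add_neg] using add_smul_ne_zero hind c (neg_ne_zero.2 one_ne_zero)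
  have hcx : c • x ≠ 0 := smul_ne_zero hc hx
  have hncx : -(c • x) ≠ 0 := neg_ne_zero.2 hcx
  have hcd : ang (c • x) d = π / 2 := h.smul_left_eq_pi_div_two hx hd hxd hc
  have hsas := h.sas_ang (-d) (-(c • x)) d (-(c • x)) hnd hncx hd hncx (norm_neg d) rfl
    (by
      rw [h.symm _ _ hnd hncx, h.symm _ _ hd hncx, h.neg_right hncx hd, h.neg_left hcx hd, hcd]
      ring)
    (by
      rw [Ne, neg_inj]
      exact hind c)
  have e1 : -d - -(c • x) = c • x - d := by abel
  have e2 : d - -(c • x) = c • x + d := by abel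
  rw [e1, e2, neg_neg, h.symm _ _ hm hcx, h.symm _ _ hp hcx] at hsas
  rcases hc.lt_or_gt with hc | hc
  · have e : c • x = (-c) • (-x) := by module
    have hs : ∀ z : X, z ≠ 0 → ang (c • x) z = π - ang x z := fun z hz => by
      rw [e, h.smul_left (neg_ne_zero.2 hx) hz (neg_pos.2 hc), h.neg_left hx hz]
    rw [hs _ hm, hs _ hp] at hsas
    linarith
  · rwa [h.smul_left hx hm hc, h.smul_left hx hp hc] at hsas

/-- In a plane, the vectors equidistant from two points of equal norm make equal angles with
them. -/
theorem ang_eq_of_norm_sub_eq (h : IsCongruenceAngle ang) {x y : X} (hx : x ≠ 0) (hy : y ≠ 0)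
    {α β : ℝ} (hn : ‖y‖ = ‖α • x + β • y‖) (hs : ‖x - y‖ = ‖x - (α • x + β • y)‖) :
    ang x y = ang x (α • x + β • y) := by
  set z : X := α • x + β • y with hz
  by_cases hyz : y = z
  · rw [← hyz]
  obtain ⟨m, hm⟩ : ∃ m, m = (2⁻¹ : ℝ) • (y + z) := ⟨_, rfl⟩
  obtain ⟨d, hd⟩ : ∃ d, d = (2⁻¹ : ℝ) • (z - y) := ⟨_, rfl⟩
  have half : (0 : ℝ) < 2⁻¹ := by norm_num
  have hzy : z - y ≠ 0 := sub_ne_zero.2 (Ne.symm hyz)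
  have hd0 : d ≠ 0 := hd ▸ smul_ne_zero half.ne' hzy
  have hmd : m ≠ 0 → ang m d = π / 2 := by
    intro hm0
    have hyz0 : y + z ≠ 0 := fun h0 => hm0 (by rw [hm, h0, smul_zero])
    rw [hm, hd, h.homog _ _ hyz0 hzy _ _ half half]
    exact h.add_sub_eq_pi_div_two hn hyz hyz0
  have hxmd : x - m ≠ 0 → ang (x - m) d = π / 2 := by
    intro hxm0
    have e1 : x - m = (2⁻¹ : ℝ) • ((x - z) + (x - y)) := by rw [hm]; module
    have e2 : d = (2⁻¹ : ℝ) • ((x - y) - (x - z)) := by rw [hd]; module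
    have e3 : (x - y) - (x - z) = z - y := by abel
    have h0 : (x - z) + (x - y) ≠ 0 := fun h0 => hxm0 (by rw [e1, h0, smul_zero])
    rw [e1, e2, h.homog _ _ h0 (e3 ▸ hzy) _ _ half half]
    exact h.add_sub_eq_pi_div_two hs.symm (fun h1 => hyz (sub_right_injective h1).symm) h0
  have ey : y = m - d := by rw [hm, hd]; module
  have ez : z = m + d := by rw [hm, hd]; module
  have hline : ∃ c : ℝ, m = c • x ∧ ang x d = π / 2 := by
    rcases eq_or_ne m 0 with hm0 | hm0
    · refine ⟨0, by rw [hm0, zero_smul], ?_⟩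
      rw [hm0, sub_zero] at hxmd
      exact hxmd hx
    rcases eq_or_ne (x - m) 0 with hxm | hxm
    · rw [sub_eq_zero] at hxm
      exact ⟨1, by rw [hxm, one_smul], hxm ▸ hmd hm0⟩
    have hα : α ≠ 0 := by
      rintro rfl
      rw [zero_smul, zero_add] at hz
      rw [hz, norm_smul, Real.norm_eq_abs] at hn
      have hβ : |β| = 1 := mul_right_cancel₀ (norm_ne_zero_iff.2 hy) (by rw [← hn, one_mul])
      rcases (abs_eq zero_le_one).1 hβ with rfl | rfl
      · exact hyz (by rw [hz, one_smul])
      · exact hm0 (by rw [hm, hz]; module)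
    have hdec : x - m = (α⁻¹ * (1 - β) - 1) • m + (α⁻¹ * (1 + β)) • d := by
      have h1 : (1 - β) • m + (1 + β) • d = α • x := by
        have : (1 - β) • m + (1 + β) • d = (m + d) - β • (m - d) := by module
        rw [this, ← ey, ← ez, hz, add_sub_cancel_right]
      have h2 : x = α⁻¹ • ((1 - β) • m + (1 + β) • d) := by
        rw [h1, smul_smul, inv_mul_cancel₀ hα, one_smul]
      nth_rewrite 1 [h2]
      module
    have ht := h.coeff_eq_zero_of_perp hm0 hd0 (hmd hm0) (hdec ▸ hxm) (hdec ▸ hxmd hxm)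
    rw [ht, zero_smul, add_zero] at hdec
    have hxm' : x = (α⁻¹ * (1 - β)) • m := by
      rw [← sub_add_cancel x m, hdec]
      module
    have hc : α⁻¹ * (1 - β) ≠ 0 := fun h0 => hx (by rw [hxm', h0, zero_smul])
    refine ⟨(α⁻¹ * (1 - β))⁻¹, ?_, ?_⟩
    · rw [hxm', smul_smul, inv_mul_cancel₀ hc, one_smul]
    · rw [hxm']
      exact h.smul_left_eq_pi_div_two hm0 hd0 (hmd hm0) hc
  obtain ⟨c, hmc, hxd⟩ := hline
  rw [ez, ey, hmc]
  exact h.ang_smul_add_eq_ang_smul_sub hx hd0 hxd c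

theorem exists_ang_eq_of_independent (h : IsCongruenceAngle ang) {x y : X} (hx : x ≠ 0)
    (hy : ∀ c : ℝ, y ≠ c • x) {θ r : ℝ} (hθ : θ ∈ Set.Icc 0 π) (hr : 0 < r) :
    ∃ α β : ℝ, ‖α • x + β • y‖ = r ∧ ang x (α • x + β • y) = θ := by
  let P : ℝ → X := fun t => t • x + (1 - |t|) • y
  have hP0 : ∀ t, P t ≠ 0 := by
    intro t
    by_cases ht : 1 - |t| = 0
    · simp only [P, ht, zero_smul, add_zero]
      refine smul_ne_zero ?_ hx
      rintro rfl
      simp at ht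
    · exact add_smul_ne_zero hy t ht
  have hPc : Continuous P := by fun_prop
  have hcont : Continuous fun t => ang x (P t) := by
    rw [continuous_iff_continuousAt]
    intro t
    exact ContinuousAt.comp (f := P) ((h.cont x hx).continuousAt (isOpen_ne.mem_nhds (hP0 t)))
      hPc.continuousAt
  have h1 : ang x (P 1) = 0 := by
    have : P 1 = (1 : ℝ) • x := by simp [P]
    rw [this, h.self_smul hx one_pos]
  have h2 : ang x (P (-1)) = π := by
    have : P (-1) = -x := by simp [P]
    rw [this, h.self_neg hx]
  obtain ⟨t, -, ht⟩ := intermediate_value_Icc' (by norm_num : (-1 : ℝ) ≤ 1) hcont.continuousOn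
    (show θ ∈ Set.Icc (ang x (P 1)) (ang x (P (-1))) by rwa [h1, h2])
  have hpos : 0 < r / ‖P t‖ := div_pos hr (norm_pos_iff.2 (hP0 t))
  refine ⟨r / ‖P t‖ * t, r / ‖P t‖ * (1 - |t|), ?_⟩
  have e : (r / ‖P t‖ * t) • x + (r / ‖P t‖ * (1 - |t|)) • y = (r / ‖P t‖) • P t := by
    simp only [P]
    module
  rw [e, h.smul_right hx (hP0 t) hpos, norm_smul, Real.norm_eq_abs, abs_of_pos hpos]
  exact ⟨div_mul_cancel₀ r (norm_ne_zero_iff.2 (hP0 t)), ht⟩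

theorem ang_eq_of_independent (h : IsCongruenceAngle ang) {x y v w : X} (hx : x ≠ 0)
    (hy : ∀ c : ℝ, y ≠ c • x) (hv : v ≠ 0) (hw : w ≠ 0) (hxv : ‖x‖ = ‖v‖) (hyw : ‖y‖ = ‖w‖)
    (hs : ‖x - y‖ = ‖v - w‖) : ang x y = ang v w := by
  have hy0 : y ≠ 0 := by simpa using hy 0
  have hvw : v ≠ w := by
    rintro rfl
    rw [sub_self, norm_zero, norm_eq_zero, sub_eq_zero] at hs
    exact hy 1 (by rw [hs, one_smul])
  obtain ⟨α, β, hn, ha⟩ := h.exists_ang_eq_of_independent hx hy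
    ⟨h.nonneg v w hv hw, h.le_pi v w hv hw⟩ (norm_pos_iff.2 hw)
  have hz : α • x + β • y ≠ 0 := by rwa [← norm_ne_zero_iff, hn, norm_ne_zero_iff]
  have hd := h.sas_norm v w x _ hv hw hx hz hxv.symm hn.symm ha.symm hvw
  rw [← ha]
  exact h.ang_eq_of_norm_sub_eq hx hy0 (hyw.trans hn.symm) (hs.trans hd)

theorem ang_eq_of_norm_eq (h : IsCongruenceAngle ang) {x y v w : X} (hx : x ≠ 0) (hy : y ≠ 0)
    (hv : v ≠ 0) (hw : w ≠ 0) (hxv : ‖x‖ = ‖v‖) (hyw : ‖y‖ = ‖w‖) (hs : ‖x - y‖ = ‖v - w‖) :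
    ang x y = ang v w := by
  by_cases h1 : ∀ c : ℝ, y ≠ c • x
  · exact h.ang_eq_of_independent hx h1 hv hw hxv hyw hs
  by_cases h2 : ∀ c : ℝ, w ≠ c • v
  · exact (h.ang_eq_of_independent hv h2 hx hy hxv.symm hyw.symm hs.symm).symm
  push Not at h1 h2
  obtain ⟨c, rfl⟩ := h1
  obtain ⟨b, rfl⟩ := h2
  have hv' : ‖v‖ ≠ 0 := norm_ne_zero_iff.2 hv
  have hc : c ≠ 0 := by rintro rfl; simp at hy
  rw [norm_smul, norm_smul, hxv] at hyw
  have ex : x - c • x = (1 - c) • x := by module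
  have ev : v - b • v = (1 - b) • v := by module
  rw [ex, ev, norm_smul, norm_smul, hxv] at hs
  have hcb : c ^ 2 = b ^ 2 := (sq_eq_sq_iff_abs_eq_abs c b).2 (mul_right_cancel₀ hv' hyw)
  have hcb' : (1 - c) ^ 2 = (1 - b) ^ 2 :=
    (sq_eq_sq_iff_abs_eq_abs _ _).2 (mul_right_cancel₀ hv' hs)
  obtain rfl : c = b := by linarith
  rcases hc.lt_or_gt with hc | hc
  · rw [h.self_smul_of_neg hx hc, h.self_smul_of_neg hv hc]
  · rw [h.self_smul hx hc, h.self_smul hv hc]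

end IsCongruenceAngle

theorem equal_side_lengths_implies_equal_angles
    {X : Type*} [NormedAddCommGroup X] [NormedSpace ℝ X]
    (ang : X → X → ℝ)
    (hrange : ∀ x y : X, x ≠ 0 → y ≠ 0 → ang x y ∈ Set.Icc 0 Real.pi)
    (hcont : ∀ x : X, x ≠ 0 →
      ContinuousOn (fun y => ang x y) {y : X | y ≠ 0} ∧
      ContinuousOn (fun y => ang y x) {y : X | y ≠ 0} ∧
      (fun y => ang x y) '' {y : X | y ≠ 0} = Set.Icc 0 Real.pi ∧
      (fun y => ang y x) '' {y : X | y ≠ 0} = Set.Icc 0 Real.pi)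
    (hsymm : ∀ x y : X, x ≠ 0 → y ≠ 0 → ang x y = ang y x)
    (hhomog : ∀ x y : X, x ≠ 0 → y ≠ 0 → ∀ α β : ℝ, 0 < α → 0 < β →
      ang (α • x) (β • y) = ang x y)
    (hadd : ∀ x y : X, x ≠ 0 → y ≠ 0 → ∀ α β : ℝ, 0 < α → 0 < β →
      ang x (α • x + β • y) + ang (α • x + β • y) y = ang x y)
    (hnd : ∀ x y : X, x ≠ 0 → y ≠ 0 → (ang x y = 0 ↔ ∃ α : ℝ, 0 < α ∧ x = α • y))
    (hcong9 : ∀ x y v w : X, x ≠ 0 → y ≠ 0 → v ≠ 0 → w ≠ 0 →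
      ‖x‖ = ‖v‖ → ‖y‖ = ‖w‖ → ang x y = ang v w → x ≠ y →
      v ≠ w ∧ ang (x - y) (-y) = ang (v - w) (-w))
    (hcong10 : ∀ x y v w : X, x ≠ 0 → y ≠ 0 → v ≠ 0 → w ≠ 0 →
      ‖x‖ = ‖v‖ → ‖y‖ = ‖w‖ → ang x y = ang v w → x ≠ y →
      v ≠ w ∧ ‖x - y‖ = ‖v - w‖) :
    ∀ x y v w : X, x ≠ 0 → y ≠ 0 → v ≠ 0 → w ≠ 0 →
      ‖x‖ = ‖v‖ → ‖y‖ = ‖w‖ → ‖x - y‖ = ‖v - w‖ → ang x y = ang v w := by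
  intro x y v w hx hy hv hw hxv hyw hs
  have h : IsCongruenceAngle ang :=
    { le_pi := fun x y hx hy => (hrange x y hx hy).2
      nonneg := fun x y hx hy => (hrange x y hx hy).1
      cont := fun x hx => (hcont x hx).1
      exists_pi := fun x hx => by
        have hmem : π ∈ (fun y => ang x y) '' {y : X | y ≠ 0} := by
          rw [(hcont x hx).2.2.1]
          exact ⟨pi_pos.le, le_rfl⟩
        exact hmem
      symm := hsymm
      homog := hhomog
      add := hadd
      eq_zero_iff := hnd
      sas_ang := fun x y v w hx hy hv hw h1 h2 h3 h4 =>
        (hcong9 x y v w hx hy hv hw h1 h2 h3 h4).2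
      sas_norm := fun x y v w hx hy hv hw h1 h2 h3 h4 =>
        (hcong10 x y v w hx hy hv hw h1 h2 h3 h4).2 }
  exact h.ang_eq_of_norm_eq hx hy hv hw hxv hyw hs
end

section
/- Let X be a real inner product space and let ang : X_o × X_o → [0,π] be an angle function satisfying all five structural axioms and the congruence properties (9) and (10). Then ang is the usual Euclidean angle function: ang(x,y) = arccos(⟨x,y⟩/(‖x‖·‖y‖)) for all x,y ∈ X_o. -/
open Real
open scoped RealInnerProductSpace

/-- A function that is continuous and additive on `[0, c]` and fixes `c` is the identity on
`[0, c]`. -/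
theorem eq_self_of_additive_on_Icc {c : ℝ} {a : ℝ → ℝ} (ha : ContinuousOn a (Set.Icc 0 c))
    (hc : a c = c)
    (hadd : ∀ s t, 0 ≤ s → 0 ≤ t → s + t ≤ c → a (s + t) = a s + a t)
    {t : ℝ} (ht : t ∈ Set.Icc 0 c) : a t = t := by
  have hcont : ContinuousOn (fun s => |a s - s|) (Set.Icc 0 c) := by fun_prop
  obtain ⟨m, hm, hmax⟩ := isCompact_Icc.exists_isMaxOn ⟨t, ht⟩ hcont
  have hmax : ∀ s ∈ Set.Icc 0 c, |a s - s| ≤ |a m - m| := hmax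
  -- The defect of `m` also occurs in the lower half, where doubling the argument doubles it.
  obtain ⟨m', h0, h2, hm'⟩ :
      ∃ m', 0 ≤ m' ∧ m' + m' ≤ c ∧ |a m' - m'| = |a m - m| := by
    rcases le_total (m + m) c with h | h
    · exact ⟨m, hm.1, h, rfl⟩
    · refine ⟨c - m, by linarith [hm.2], by linarith, ?_⟩
      have := hadd m (c - m) hm.1 (by linarith [hm.2]) (by linarith)
      rw [add_sub_cancel, hc] at this
      rw [← abs_neg]
      congr 1
      linarith
  have hdouble := hmax (m' + m') ⟨by linarith, h2⟩
  rw [hadd m' m' h0 h0 h2, show a m' + a m' - (m' + m') = 2 * (a m' - m') by ring, abs_mul,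
    abs_two, hm'] at hdouble
  have hzero : |a t - t| = 0 :=
    le_antisymm ((hmax t ht).trans (by linarith)) (abs_nonneg _)
  exact sub_eq_zero.mp (abs_eq_zero.mp hzero)

section AngleFunction

variable {X : Type*} [NormedAddCommGroup X] [InnerProductSpace ℝ X]

/-- The parametrization of the unit circle through the orthonormal pair `x`, `u`. -/
noncomputable def circlePoint (x u : X) (t : ℝ) : X := Real.cos t • x + Real.sin t • u

theorem continuous_circlePoint (x u : X) : Continuous (circlePoint x u) := by
  unfold circlePoint
  fun_prop

theorem circlePoint_zero (x u : X) : circlePoint x u 0 = x := by simp [circlePoint]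

theorem circlePoint_pi (x u : X) : circlePoint x u Real.pi = -x := by simp [circlePoint]

theorem inner_circlePoint {x u : X} (hx : ‖x‖ = 1) (hu : ‖u‖ = 1) (hxu : ⟪x, u⟫ = 0) (s t : ℝ) :
    ⟪circlePoint x u s, circlePoint x u t⟫ = Real.cos (t - s) := by
  simp only [circlePoint, inner_add_left, inner_add_right,
    real_inner_smul_right, real_inner_self_eq_norm_sq, hx, hu, hxu, real_inner_comm, Real.cos_sub]
  ring

theorem norm_circlePoint {x u : X} (hx : ‖x‖ = 1) (hu : ‖u‖ = 1) (hxu : ⟪x, u⟫ = 0) (t : ℝ) :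
    ‖circlePoint x u t‖ = 1 := by
  have h := inner_circlePoint hx hu hxu t t
  rw [real_inner_self_eq_norm_sq, sub_self, Real.cos_zero] at h
  exact (pow_eq_one_iff_of_nonneg (norm_nonneg _) two_ne_zero).mp h

theorem sin_smul_circlePoint (x u : X) (s t : ℝ) :
    Real.sin (s + t) • circlePoint x u s =
      Real.sin t • x + Real.sin s • circlePoint x u (s + t) := by
  have h : Real.sin (s + t) * Real.cos s = Real.sin t + Real.sin s * Real.cos (s + t) := by
    rw [Real.sin_add, Real.cos_add]
    linear_combination Real.sin t * Real.sin_sq_add_cos_sq s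
  simp only [circlePoint, smul_add, smul_smul, h, add_smul]
  rw [mul_comm (Real.sin (s + t))]
  abel

/-- A vector whose angle with the unit vector `x` is neither `0` nor `π` is a positive multiple
of a point on a unit circle through `x`. -/
theorem exists_eq_norm_smul_circlePoint {x y : X} (hx : ‖x‖ = 1) (hy : y ≠ 0)
    (hsin : Real.sin (InnerProductGeometry.angle x y) ≠ 0) :
    ∃ u : X, ‖u‖ = 1 ∧ ⟪x, u⟫ = 0 ∧
      y = ‖y‖ • circlePoint x u (InnerProductGeometry.angle x y) := by
  set t := InnerProductGeometry.angle x y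
  have hn : ‖y‖ ≠ 0 := norm_ne_zero_iff.mpr hy
  have hxy : ⟪x, y⟫ = ‖y‖ * Real.cos t := by
    have := InnerProductGeometry.cos_angle_mul_norm_mul_norm x y
    rw [hx, one_mul] at this
    rw [← this, mul_comm]
  refine ⟨(‖y‖ * Real.sin t)⁻¹ • (y - (‖y‖ * Real.cos t) • x), ?_, ?_, ?_⟩
  · have h : ‖(‖y‖ * Real.sin t)⁻¹ • (y - (‖y‖ * Real.cos t) • x)‖ ^ 2 = 1 := by
      rw [norm_smul, mul_pow, norm_sub_sq_real, real_inner_smul_right, real_inner_comm, hxy,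
        norm_smul, hx, Real.norm_eq_abs, Real.norm_eq_abs, sq_abs, mul_one, sq_abs]
      field_simp
      linear_combination -Real.sin_sq_add_cos_sq t
    exact (pow_eq_one_iff_of_nonneg (norm_nonneg _) two_ne_zero).mp h
  · rw [real_inner_smul_right, inner_sub_right, real_inner_smul_right,
      real_inner_self_eq_norm_sq, hx, hxy]
    ring
  · rw [circlePoint, smul_add, smul_smul, smul_smul, smul_smul,
      mul_inv_cancel₀ (mul_ne_zero hn hsin), one_smul, add_sub_cancel]

/-- The angle of a vector with its opposite is maximal. -/
theorem angleFunction_neg_eq_pi {ang : X → X → ℝ}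
    (hrange : ∀ x y : X, x ≠ 0 → y ≠ 0 → ang x y ∈ Set.Icc 0 Real.pi)
    (hsurj : ∀ x : X, x ≠ 0 → (fun y => ang x y) '' {y : X | y ≠ 0} = Set.Icc 0 Real.pi)
    (hhomog : ∀ x y : X, x ≠ 0 → y ≠ 0 → ∀ α β : ℝ, 0 < α → 0 < β →
      ang (α • x) (β • y) = ang x y)
    (hadd : ∀ x y : X, x ≠ 0 → y ≠ 0 → ∀ α β : ℝ, 0 < α → 0 < β →
      ang x (α • x + β • y) + ang (α • x + β • y) y = ang x y)
    (hnd : ∀ x y : X, x ≠ 0 → y ≠ 0 → (ang x y = 0 ↔ ∃ α : ℝ, 0 < α ∧ x = α • y))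
    {x : X} (hx : x ≠ 0) : ang x (-x) = Real.pi := by
  obtain ⟨y, hy, hxy⟩ : Real.pi ∈ (fun y => ang x y) '' {y : X | y ≠ 0} :=
    hsurj x hx ▸ Set.right_mem_Icc.mpr Real.pi_pos.le
  have hy : y ≠ 0 := hy
  have hxy : ang x y = Real.pi := hxy
  have hne : ¬ ∃ α : ℝ, 0 < α ∧ x = α • y := fun h =>
    Real.pi_ne_zero (hxy.symm.trans ((hnd x y hx hy).mpr h))
  have hz : y - x ≠ 0 := fun h => hne ⟨1, one_pos, by rw [one_smul, sub_eq_zero.mp h]⟩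
  have hsum := hadd x (y - x) hx hz 1 1 one_pos one_pos
  rw [one_smul, one_smul, add_sub_cancel, hxy] at hsum
  obtain ⟨α, hα, h⟩ := (hnd y (y - x) hy hz).mp <| le_antisymm
    (by linarith [(hrange x (y - x) hx hz).2]) (hrange y (y - x) hy hz).1
  have hmul : α • x = (α - 1) • y := by
    rw [smul_sub, eq_sub_iff_add_eq] at h
    rw [sub_smul, one_smul, ← h]
    abel
  have hx' : x = (α⁻¹ * (α - 1)) • y := by
    rw [mul_smul, ← hmul, smul_smul, inv_mul_cancel₀ hα.ne', one_smul]
  set k := α⁻¹ * (α - 1)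
  have hk : k < 0 := by
    refine lt_of_le_of_ne (not_lt.mp fun hk => hne ⟨k, hk, hx'⟩) fun hk => hx ?_
    rw [hx', hk, zero_smul]
  have hh := hhomog x y hx hy 1 (-k) one_pos (neg_pos.mpr hk)
  rwa [one_smul, neg_smul, ← hx', hxy] at hh

/-- If equal angles between vectors of equal lengths subtend equal distances, then equal angles
between unit vectors force equal inner products. -/
theorem inner_eq_of_angleFunction_eq {ang : X → X → ℝ}
    (hcong : ∀ x y v w : X, x ≠ 0 → y ≠ 0 → v ≠ 0 → w ≠ 0 →
      ‖x‖ = ‖v‖ → ‖y‖ = ‖w‖ → ang x y = ang v w → x ≠ y →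
      v ≠ w ∧ ‖x - y‖ = ‖v - w‖)
    {x y v w : X} (hx : ‖x‖ = 1) (hy : ‖y‖ = 1) (hv : ‖v‖ = 1) (hw : ‖w‖ = 1)
    (h : ang x y = ang v w) : ⟪x, y⟫ = ⟪v, w⟫ := by
  have ne_zero {z : X} (hz : ‖z‖ = 1) : z ≠ 0 := norm_ne_zero_iff.mp (hz ▸ one_ne_zero)
  have hdist : ‖x - y‖ = ‖v - w‖ := by
    by_cases hxy : x = y
    · by_cases hvw : v = w
      · rw [hxy, hvw, sub_self, sub_self]
      · exact absurd hxy (hcong v w x y (ne_zero hv) (ne_zero hw) (ne_zero hx) (ne_zero hy)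
          (hv.trans hx.symm) (hw.trans hy.symm) h.symm hvw).1
    · exact (hcong x y v w (ne_zero hx) (ne_zero hy) (ne_zero hv) (ne_zero hw)
        (hx.trans hv.symm) (hy.trans hw.symm) h hxy).2
  have h1 := norm_sub_sq_real x y
  have h2 := norm_sub_sq_real v w
  rw [hx, hy] at h1
  rw [hv, hw, ← hdist] at h2
  linarith

end AngleFunction

theorem angle_is_euclidean_angle
    {X : Type*} [NormedAddCommGroup X] [InnerProductSpace ℝ X]
    (ang : X → X → ℝ)
    (hrange : ∀ x y : X, x ≠ 0 → y ≠ 0 → ang x y ∈ Set.Icc 0 Real.pi)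
    (hcont : ∀ x : X, x ≠ 0 →
      ContinuousOn (fun y => ang x y) {y : X | y ≠ 0} ∧
      ContinuousOn (fun y => ang y x) {y : X | y ≠ 0} ∧
      (fun y => ang x y) '' {y : X | y ≠ 0} = Set.Icc 0 Real.pi ∧
      (fun y => ang y x) '' {y : X | y ≠ 0} = Set.Icc 0 Real.pi)
    (hsymm : ∀ x y : X, x ≠ 0 → y ≠ 0 → ang x y = ang y x)
    (hhomog : ∀ x y : X, x ≠ 0 → y ≠ 0 → ∀ α β : ℝ, 0 < α → 0 < β →
      ang (α • x) (β • y) = ang x y)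
    (hadd : ∀ x y : X, x ≠ 0 → y ≠ 0 → ∀ α β : ℝ, 0 < α → 0 < β →
      ang x (α • x + β • y) + ang (α • x + β • y) y = ang x y)
    (hnd : ∀ x y : X, x ≠ 0 → y ≠ 0 → (ang x y = 0 ↔ ∃ α : ℝ, 0 < α ∧ x = α • y))
    (hcong9 : ∀ x y v w : X, x ≠ 0 → y ≠ 0 → v ≠ 0 → w ≠ 0 →
      ‖x‖ = ‖v‖ → ‖y‖ = ‖w‖ → ang x y = ang v w → x ≠ y →
      v ≠ w ∧ ang (x - y) (-y) = ang (v - w) (-w))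
    (hcong10 : ∀ x y v w : X, x ≠ 0 → y ≠ 0 → v ≠ 0 → w ≠ 0 →
      ‖x‖ = ‖v‖ → ‖y‖ = ‖w‖ → ang x y = ang v w → x ≠ y →
      v ≠ w ∧ ‖x - y‖ = ‖v - w‖) :
    ∀ x y : X, x ≠ 0 → y ≠ 0 →
      ang x y = Real.arccos (⟪x, y⟫ / (‖x‖ * ‖y‖)) := by
  intro x y hx hy
  change ang x y = InnerProductGeometry.angle x y
  have self_eq_zero {z : X} (hz : z ≠ 0) : ang z z = 0 :=
    (hnd z z hz hz).mpr ⟨1, one_pos, (one_smul ℝ z).symm⟩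
  have neg_eq_pi {z : X} (hz : z ≠ 0) : ang z (-z) = Real.pi :=
    angleFunction_neg_eq_pi hrange (fun x hx => (hcont x hx).2.2.1) hhomog hadd hnd hz
  wlog hx1 : ‖x‖ = 1 generalizing x
  · have hn : 0 < ‖x‖⁻¹ := inv_pos.mpr (norm_pos_iff.mpr hx)
    have h := this (‖x‖⁻¹ • x) (smul_ne_zero hn.ne' hx) (norm_smul_inv_norm (𝕜 := ℝ) hx)
    rwa [InnerProductGeometry.angle_smul_left_of_pos _ _ hn,
      show ang (‖x‖⁻¹ • x) y = ang x y by
        simpa using hhomog x y hx hy ‖x‖⁻¹ 1 hn one_pos] at h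
  by_cases h0 : InnerProductGeometry.angle x y = 0
  · obtain ⟨-, r, hr, rfl⟩ := InnerProductGeometry.angle_eq_zero_iff.mp h0
    rw [h0, ← self_eq_zero hx]
    simpa using hhomog x x hx hx 1 r one_pos hr
  by_cases hpi : InnerProductGeometry.angle x y = Real.pi
  · obtain ⟨-, r, hr, rfl⟩ := InnerProductGeometry.angle_eq_pi_iff.mp hpi
    rw [hpi, ← neg_eq_pi hx]
    simpa using hhomog x (-x) hx (neg_ne_zero.mpr hx) 1 (-r) one_pos (neg_pos.mpr hr)
  have hmem : InnerProductGeometry.angle x y ∈ Set.Ioo 0 Real.pi :=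
    ⟨lt_of_le_of_ne (InnerProductGeometry.angle_nonneg x y) (Ne.symm h0),
      lt_of_le_of_ne (InnerProductGeometry.angle_le_pi x y) hpi⟩
  obtain ⟨u, hu, hxu, hyu⟩ :=
    exists_eq_norm_smul_circlePoint hx1 hy (Real.sin_pos_of_mem_Ioo hmem).ne'
  have hunit := norm_circlePoint hx1 hu hxu
  have hne : ∀ t, circlePoint x u t ≠ 0 := fun t => norm_ne_zero_iff.mp (hunit t ▸ one_ne_zero)
  set a : ℝ → ℝ := fun t => ang x (circlePoint x u t) with ha
  have ha0 : a 0 = 0 := by rw [ha]; simpa only [circlePoint_zero] using self_eq_zero hx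
  have hapi : a Real.pi = Real.pi := by rw [ha]; simpa only [circlePoint_pi] using neg_eq_pi hx
  have hacont : Continuous a :=
    (hcont x hx).1.comp_continuous (continuous_circlePoint x u) hne
  have hrot : ∀ s t, t ∈ Set.Icc 0 Real.pi →
      ang (circlePoint x u s) (circlePoint x u (s + t)) = a t := by
    intro s t ht
    obtain ⟨r, hr, hrt⟩ := intermediate_value_Icc Real.pi_pos.le hacont.continuousOn
      (ha0.symm ▸ hapi.symm ▸ hrange _ _ (hne s) (hne (s + t)) :
        ang (circlePoint x u s) (circlePoint x u (s + t)) ∈ Set.Icc (a 0) (a Real.pi))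
    have hcos : Real.cos r = Real.cos t := by
      have h := inner_eq_of_angleFunction_eq hcong10 hx1 (hunit r) (hunit s) (hunit (s + t)) hrt
      nth_rewrite 1 [← circlePoint_zero x u] at h
      rwa [inner_circlePoint hx1 hu hxu, inner_circlePoint hx1 hu hxu, sub_zero,
        add_sub_cancel_left] at h
    rw [← hrt, Real.injOn_cos hr ht hcos]
  have hopen : ∀ s t, 0 < s → 0 < t → s + t < Real.pi → a (s + t) = a s + a t := by
    intro s t hs ht hst
    have hss : 0 < Real.sin s := Real.sin_pos_of_pos_of_lt_pi hs (by linarith)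
    have hts : 0 < Real.sin t := Real.sin_pos_of_pos_of_lt_pi ht (by linarith)
    have hsts : 0 < Real.sin (s + t) := Real.sin_pos_of_pos_of_lt_pi (by linarith) hst
    have h := hadd x (circlePoint x u (s + t)) hx (hne _) _ _ hts hss
    rw [← sin_smul_circlePoint] at h
    have h1 := hhomog x (circlePoint x u s) hx (hne s) 1 _ one_pos hsts
    have h2 := hhomog (circlePoint x u s) (circlePoint x u (s + t)) (hne s) (hne _) _ 1 hsts
      one_pos
    rw [one_smul] at h1 h2
    rw [h1, h2, hrot s t ⟨ht.le, by linarith⟩] at h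
    exact h.symm
  have hclosed : ∀ s t, 0 ≤ s → 0 ≤ t → s + t ≤ Real.pi → a (s + t) = a s + a t := by
    intro s t hs ht hst
    rcases hs.eq_or_lt with rfl | hs
    · rw [zero_add, ha0, zero_add]
    rcases ht.eq_or_lt with rfl | ht
    · rw [add_zero, ha0, add_zero]
    have heq : Set.EqOn (fun r => a (s + r)) (fun r => a s + a r) (Set.Ioo 0 (Real.pi - s)) :=
      fun r hr => hopen s r hs hr.1 (by linarith [hr.2])
    refine heq.closure (by fun_prop) (by fun_prop) ?_
    rw [closure_Ioo (by linarith)]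
    exact ⟨ht.le, by linarith⟩
  have hcircle : ang x y = a (InnerProductGeometry.angle x y) := by
    have h := hhomog x _ hx (hne (InnerProductGeometry.angle x y)) 1 ‖y‖ one_pos
      (norm_pos_iff.mpr hy)
    rwa [one_smul, ← hyu] at h
  rw [hcircle]
  exact eq_self_of_additive_on_Icc hacont.continuousOn hapi hclosed ⟨hmem.1.le, hmem.2.le⟩
end

section
/- Let X be a real normed space with P-angle ang_p. The following three properties are equivalent: (a) ang_p satisfies non-degeneracy, i.e., for all x,y ∈ X_o, ang_p(x,y) = 0 if and only if x = αy for some α > 0; (b) ang_p satisfies parallelism, i.e., for all x,y ∈ X_o, ang_p(x,y) = π if and only if y = αx for some α < 0; (c) X is strictly convex. -/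
open Real

/-- The P-angle of a normed space. -/
noncomputable def angP {X : Type*} [NormedAddCommGroup X] [NormedSpace ℝ X]
    (x y : X) : ℝ :=
  Real.arccos ((‖x‖ ^ 2 + ‖y‖ ^ 2 - ‖x - y‖ ^ 2) / (2 * ‖x‖ * ‖y‖))

theorem angP_eq_zero_iff_norm_sub {X : Type*} [NormedAddCommGroup X] [NormedSpace ℝ X]
    {x y : X} (hx : x ≠ 0) (hy : y ≠ 0) :
    angP x y = 0 ↔ ‖x - y‖ = |‖x‖ - ‖y‖| := by
  have hx' := norm_pos_iff.2 hx
  have hy' := norm_pos_iff.2 hy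
  rw [angP, Real.arccos_eq_zero, le_div_iff₀ (by positivity)]
  constructor
  · intro h
    refine le_antisymm ?_ (abs_norm_sub_norm_le x y)
    refine le_of_pow_le_pow_left₀ two_ne_zero (abs_nonneg _) ?_
    rw [sq_abs]
    linarith
  · intro h
    rw [h, sq_abs]
    nlinarith

theorem angP_eq_pi_iff_norm_sub {X : Type*} [NormedAddCommGroup X] [NormedSpace ℝ X]
    {x y : X} (hx : x ≠ 0) (hy : y ≠ 0) :
    angP x y = Real.pi ↔ ‖x - y‖ = ‖x‖ + ‖y‖ := by
  have hx' := norm_pos_iff.2 hx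
  have hy' := norm_pos_iff.2 hy
  rw [angP, Real.arccos_eq_pi, div_le_iff₀ (by positivity)]
  constructor
  · intro h
    refine le_antisymm (norm_sub_le x y) ?_
    refine le_of_pow_le_pow_left₀ two_ne_zero (by positivity) ?_
    linarith
  · intro h
    rw [h]
    nlinarith

theorem norm_sub_smul_self {X : Type*} [NormedAddCommGroup X] [NormedSpace ℝ X]
    {α : ℝ} (hα : α < 0) (x : X) : ‖x - α • x‖ = ‖x‖ + ‖α • x‖ := by
  rw [show x - α • x = (1 - α) • x by module, norm_smul, norm_smul,
    Real.norm_of_nonneg (by linarith), Real.norm_of_nonpos hα.le]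
  ring

theorem norm_smul_sub_self {X : Type*} [NormedAddCommGroup X] [NormedSpace ℝ X]
    {α : ℝ} (hα : 0 < α) (y : X) : ‖α • y - y‖ = |‖α • y‖ - ‖y‖| := by
  rw [show α • y - y = (α - 1) • y by module, norm_smul, norm_smul, Real.norm_of_nonneg hα.le,
    Real.norm_eq_abs, show α * ‖y‖ - ‖y‖ = (α - 1) * ‖y‖ by ring, abs_mul, abs_norm]

theorem exists_pos_smul_of_norm_sub_eq {X : Type*} [NormedAddCommGroup X] [NormedSpace ℝ X]
    (hX : ∀ x y : X, x ≠ 0 → y ≠ 0 → ‖x + y‖ = ‖x‖ + ‖y‖ → ∃ α : ℝ, 0 < α ∧ y = α • x)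
    {x y : X} (hy : y ≠ 0) (h : ‖x - y‖ = ‖x‖ - ‖y‖) : ∃ α : ℝ, 0 < α ∧ x = α • y := by
  rcases eq_or_ne x y with rfl | hxy
  · exact ⟨1, one_pos, (one_smul ℝ x).symm⟩
  · obtain ⟨α, hα, he⟩ := hX y (x - y) hy (sub_ne_zero.2 hxy) (by
      rw [add_sub_cancel, h]; ring)
    exact ⟨1 + α, by positivity, by rw [add_smul, one_smul, ← he, add_sub_cancel]⟩

theorem angP_nondegeneracy_parallelism_strict_convexity
    {X : Type*} [NormedAddCommGroup X] [NormedSpace ℝ X] :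
    [(∀ x y : X, x ≠ 0 → y ≠ 0 → (angP x y = 0 ↔ ∃ α : ℝ, 0 < α ∧ x = α • y)),
     (∀ x y : X, x ≠ 0 → y ≠ 0 → (angP x y = Real.pi ↔ ∃ α : ℝ, α < 0 ∧ y = α • x)),
     (∀ x y : X, x ≠ 0 → y ≠ 0 → ‖x + y‖ = ‖x‖ + ‖y‖ → ∃ α : ℝ, 0 < α ∧ y = α • x)].TFAE := by
  tfae_have 3 → 1 := by
    intro hX x y hx hy
    rw [angP_eq_zero_iff_norm_sub hx hy]
    constructor
    · intro h
      rcases le_total ‖y‖ ‖x‖ with hle | hle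
      · exact exists_pos_smul_of_norm_sub_eq hX hy (by rw [h, abs_of_nonneg (sub_nonneg.2 hle)])
      · obtain ⟨α, hα, rfl⟩ := exists_pos_smul_of_norm_sub_eq hX hx (x := y) (by
          rw [norm_sub_rev, h, abs_of_nonpos (sub_nonpos.2 hle), neg_sub])
        exact ⟨α⁻¹, inv_pos.2 hα, (inv_smul_smul₀ hα.ne' x).symm⟩
    · rintro ⟨α, hα, rfl⟩
      exact norm_smul_sub_self hα y
  tfae_have 1 → 3 := by
    intro hX x y hx hy h
    have hx' := norm_pos_iff.2 hx
    have hy' := norm_pos_iff.2 hy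
    have hxy : x + y ≠ 0 := norm_pos_iff.1 (by rw [h]; positivity)
    obtain ⟨α, hα, he⟩ := (hX (x + y) y hxy hy).1 ((angP_eq_zero_iff_norm_sub hxy hy).2 (by
      rw [add_sub_cancel_right, h, add_sub_cancel_right, abs_norm]))
    have hα1 : 0 < α - 1 := by
      rw [he, norm_smul, Real.norm_of_nonneg hα.le] at h
      nlinarith
    have hxe : x = (α - 1) • y := by rw [sub_smul, one_smul, ← he, add_sub_cancel_right]
    exact ⟨(α - 1)⁻¹, inv_pos.2 hα1, by rw [hxe, inv_smul_smul₀ hα1.ne']⟩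
  tfae_have 3 → 2 := by
    intro hX x y hx hy
    rw [angP_eq_pi_iff_norm_sub hx hy]
    constructor
    · intro h
      obtain ⟨α, hα, he⟩ := hX x (-y) hx (neg_ne_zero.2 hy) (by rw [← sub_eq_add_neg, norm_neg, h])
      exact ⟨-α, neg_lt_zero.2 hα, by rw [neg_smul, ← he, neg_neg]⟩
    · rintro ⟨α, hα, rfl⟩
      exact norm_sub_smul_self hα x
  tfae_have 2 → 3 := by
    intro hX x y hx hy h
    have hy' := neg_ne_zero.2 hy
    obtain ⟨α, hα, he⟩ := (hX x (-y) hx hy').1 ((angP_eq_pi_iff_norm_sub hx hy').2 (by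
      rw [sub_neg_eq_add, norm_neg, h]))
    exact ⟨-α, neg_pos.2 hα, by rw [neg_smul, ← he, neg_neg]⟩
  tfae_finish
end

section
/- Let X be a real normed space of dimension at least 2 with P-angle ang_p. Then ang_p is homogeneous, i.e., ang_p(αx,βy) = ang_p(x,y) for all x,y ∈ X_o and all α,β > 0, if and only if the norm of X is derived from an inner product, i.e., satisfies the parallelogram law ‖x+y‖² + ‖x−y‖² = 2‖x‖² + 2‖y‖² for all x,y ∈ X. -/
open Real

theorem angP_arg_bounds {X : Type*} [NormedAddCommGroup X] {x y : X}
    (hx : x ≠ 0) (hy : y ≠ 0) :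
    -1 ≤ (‖x‖ ^ 2 + ‖y‖ ^ 2 - ‖x - y‖ ^ 2) / (2 * ‖x‖ * ‖y‖) ∧
      (‖x‖ ^ 2 + ‖y‖ ^ 2 - ‖x - y‖ ^ 2) / (2 * ‖x‖ * ‖y‖) ≤ 1 := by
  have hx' := norm_pos_iff.mpr hx
  have hy' := norm_pos_iff.mpr hy
  have hpos : 0 < 2 * ‖x‖ * ‖y‖ := by positivity
  have hup := pow_le_pow_left₀ (norm_nonneg _) (norm_sub_le x y) 2
  have hlow := pow_le_pow_left₀ (abs_nonneg _) (abs_norm_sub_norm_le x y) 2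
  rw [sq_abs] at hlow
  constructor
  · rw [le_div_iff₀ hpos]
    linarith [add_sq ‖x‖ ‖y‖]
  · rw [div_le_one hpos]
    linarith [sub_sq ‖x‖ ‖y‖]

theorem angP_eq_angP_iff {X : Type*} [NormedAddCommGroup X] [NormedSpace ℝ X]
    {x y u v : X} (hx : x ≠ 0) (hy : y ≠ 0) (hu : u ≠ 0) (hv : v ≠ 0) :
    angP x y = angP u v ↔
      (‖x‖ ^ 2 + ‖y‖ ^ 2 - ‖x - y‖ ^ 2) / (2 * ‖x‖ * ‖y‖) =
        (‖u‖ ^ 2 + ‖v‖ ^ 2 - ‖u - v‖ ^ 2) / (2 * ‖u‖ * ‖v‖) :=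
  Real.arccos_injOn.eq_iff (angP_arg_bounds hx hy) (angP_arg_bounds hu hv)

theorem angP_eq_angle {X : Type*} [NormedAddCommGroup X] [InnerProductSpace ℝ X] (x y : X) :
    angP x y = InnerProductGeometry.angle x y := by
  rw [angP, InnerProductGeometry.angle, norm_sub_sq_real]
  congr 1
  rw [show ‖x‖ ^ 2 + ‖y‖ ^ 2 - (‖x‖ ^ 2 - 2 * inner ℝ x y + ‖y‖ ^ 2) = 2 * inner ℝ x y by ring,
    mul_assoc, mul_div_mul_left _ _ two_ne_zero]

theorem angP_homogeneous_iff_inner_product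
    {X : Type*} [NormedAddCommGroup X] [NormedSpace ℝ X]
    (hdim : 2 ≤ Module.rank ℝ X) :
    (∀ x y : X, x ≠ 0 → y ≠ 0 → ∀ α β : ℝ, 0 < α → 0 < β →
      angP (α • x) (β • y) = angP x y) ↔
    (∀ x y : X, ‖x + y‖ ^ 2 + ‖x - y‖ ^ 2 = 2 * ‖x‖ ^ 2 + 2 * ‖y‖ ^ 2) := by
  constructor
  · intro h x y
    rcases eq_or_ne y 0 with rfl | hy
    · simp
      ring
    rcases eq_or_ne (x - y) 0 with hxy | hxy
    · obtain rfl := sub_eq_zero.mp hxy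
      rw [← two_smul ℝ x, norm_smul]
      norm_num
      ring
    have hy' : -y ≠ 0 := neg_ne_zero.mpr hy
    have key := h (x - y) (-y) hxy hy' 1 2 one_pos two_pos
    rw [one_smul, angP_eq_angP_iff hxy (smul_ne_zero two_ne_zero hy') hxy hy',
      show x - y - (2 : ℝ) • (-y) = x + y by module, show x - y - -y = x by abel,
      norm_smul, norm_neg, Real.norm_two] at key
    have h₁ := norm_pos_iff.mpr hxy
    have h₂ := norm_pos_iff.mpr hy
    field_simp at key
    linarith
  · intro h x y _ _ α β hα hβ
    let _ : InnerProductSpace ℝ X := InnerProductSpace.ofNorm ℝ fun x y => by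
      linarith [h x y]
    have e : ∀ u v : X, angP u v = InnerProductGeometry.angle u v := angP_eq_angle
    rw [e, e, InnerProductGeometry.angle_smul_left_of_pos _ _ hα,
      InnerProductGeometry.angle_smul_right_of_pos _ _ hβ]
end

section
/- Let X be a real normed space with I-angle ang_i. The following three properties are equivalent: (a) ang_i satisfies non-degeneracy, i.e., for all x,y ∈ X_o, ang_i(x,y) = 0 if and only if x = αy for some α > 0; (b) ang_i satisfies parallelism, i.e., for all x,y ∈ X_o, ang_i(x,y) = π if and only if y = αx for some α < 0; (c) X is strictly convex. -/
open Real

/-- The I-angle of a normed space. -/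
noncomputable def angI {X : Type*} [NormedAddCommGroup X] [NormedSpace ℝ X]
    (x y : X) : ℝ :=
  Real.arccos ((‖x + y‖ ^ 2 - ‖x - y‖ ^ 2) / (4 * ‖x‖ * ‖y‖))

theorem angI_neg_right {X : Type*} [NormedAddCommGroup X] [NormedSpace ℝ X] (x y : X) :
    angI x (-y) = Real.pi - angI x y := by
  unfold angI
  rw [← Real.arccos_neg, norm_neg, sub_neg_eq_add, ← sub_eq_add_neg, ← neg_div, neg_sub]

theorem angI_eq_zero_iff {X : Type*} [NormedAddCommGroup X] [NormedSpace ℝ X] {x y : X}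
    (hx : x ≠ 0) (hy : y ≠ 0) :
    angI x y = 0 ↔ ‖x + y‖ = ‖x‖ + ‖y‖ ∧ ‖x - y‖ = |‖x‖ - ‖y‖| := by
  have hx' := norm_pos_iff.mpr hx
  have hy' := norm_pos_iff.mpr hy
  rw [angI, Real.arccos_eq_zero, one_le_div (by positivity)]
  have h1 := norm_add_le x y
  have h2 := abs_norm_sub_norm_le x y
  have h3 := sq_abs (‖x‖ - ‖y‖)
  have h4 := abs_nonneg (‖x‖ - ‖y‖)
  have h5 := norm_nonneg (x + y)
  constructor
  · intro h
    constructor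
    · exact le_antisymm h1 (by nlinarith)
    · exact le_antisymm (by nlinarith) h2
  · rintro ⟨h6, h7⟩
    rw [h6, h7, h3]
    linarith

/-- In any normed space the I-angle between positively proportional vectors vanishes. -/
theorem angI_smul_left_self {X : Type*} [NormedAddCommGroup X] [NormedSpace ℝ X] {y : X}
    (hy : y ≠ 0) {α : ℝ} (hα : 0 < α) : angI (α • y) y = 0 := by
  rw [angI_eq_zero_iff (smul_ne_zero hα.ne' hy) hy]
  have hadd : α • y + y = (α + 1) • y := by module
  have hsub : α • y - y = (α - 1) • y := by module
  rw [hadd, hsub, norm_smul, norm_smul, norm_smul, Real.norm_of_nonneg hα.le,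
    Real.norm_of_nonneg (by linarith : 0 ≤ α + 1), Real.norm_eq_abs]
  refine ⟨by ring, ?_⟩
  rw [← sub_one_mul, abs_mul, abs_norm]

/-- If the triangle inequality is an equality at `x`, `y`, then `x + y` and `y` form a zero
I-angle. -/
theorem angI_add_eq_zero {X : Type*} [NormedAddCommGroup X] [NormedSpace ℝ X] {x y : X}
    (hy : y ≠ 0) (h : ‖x + y‖ = ‖x‖ + ‖y‖) : angI (x + y) y = 0 := by
  have hy' := norm_pos_iff.mpr hy
  have hx' := norm_nonneg x
  have hxy : x + y ≠ 0 := norm_pos_iff.mp (by linarith)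
  rw [angI_eq_zero_iff hxy hy, add_sub_cancel_right, h, add_sub_cancel_right, abs_norm]
  refine ⟨le_antisymm (by linarith [norm_add_le (x + y) y]) ?_, rfl⟩
  have h2 : ‖(x + y + y) + x‖ = 2 * (‖x‖ + ‖y‖) := by
    rw [show (x + y + y) + x = (2 : ℝ) • (x + y) by module, norm_smul, h, Real.norm_two]
  linarith [norm_add_le (x + y + y) x]

theorem angI_nondegeneracy_parallelism_strict_convexity
    {X : Type*} [NormedAddCommGroup X] [NormedSpace ℝ X] :
    [(∀ x y : X, x ≠ 0 → y ≠ 0 → (angI x y = 0 ↔ ∃ α : ℝ, 0 < α ∧ x = α • y)),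
     (∀ x y : X, x ≠ 0 → y ≠ 0 → (angI x y = Real.pi ↔ ∃ α : ℝ, α < 0 ∧ y = α • x)),
     (∀ x y : X, x ≠ 0 → y ≠ 0 → ‖x + y‖ = ‖x‖ + ‖y‖ → ∃ α : ℝ, 0 < α ∧ y = α • x)].TFAE := by
  have hpi : ∀ x y : X, angI x (-y) = Real.pi ↔ angI x y = 0 := fun x y => by
    rw [angI_neg_right, sub_eq_self]
  have hpar : ∀ x y : X, (∃ α : ℝ, α < 0 ∧ -y = α • x) ↔ ∃ α : ℝ, 0 < α ∧ x = α • y := by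
    intro x y
    constructor
    · rintro ⟨α, hα, h⟩
      refine ⟨(-α)⁻¹, inv_pos.mpr (by linarith), ?_⟩
      rw [← neg_neg y, h, ← neg_smul, inv_smul_smul₀ (by linarith)]
    · rintro ⟨α, hα, rfl⟩
      refine ⟨-α⁻¹, by simpa using hα, ?_⟩
      rw [neg_smul, inv_smul_smul₀ hα.ne']
  tfae_have 1 → 2 := fun h x y hx hy => by
    have := h x (-y) hx (neg_ne_zero.mpr hy)
    rwa [← hpi, ← hpar, neg_neg] at this
  tfae_have 2 → 1 := fun h x y hx hy => by
    rw [← hpi, ← hpar]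
    exact h x (-y) hx (neg_ne_zero.mpr hy)
  tfae_have 1 → 3 := by
    intro h x y hx hy hxy
    have hx' := norm_pos_iff.mpr hx
    have hy' := norm_pos_iff.mpr hy
    have hne : x + y ≠ 0 := norm_pos_iff.mp (by linarith)
    obtain ⟨α, hα, hαy⟩ := (h (x + y) y hne hy).mp (angI_add_eq_zero hy hxy)
    have hα1 : 0 < α - 1 := by
      rw [hαy, norm_smul, Real.norm_of_nonneg hα.le] at hxy
      nlinarith
    have hxα : x = (α - 1) • y := by rw [sub_smul, one_smul, ← hαy, add_sub_cancel_right]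
    exact ⟨(α - 1)⁻¹, inv_pos.mpr hα1, by rw [hxα, inv_smul_smul₀ hα1.ne']⟩
  tfae_have 3 → 1 := by
    intro h x y hx hy
    constructor
    · intro h0
      refine h y x hy hx ?_
      rw [add_comm, ((angI_eq_zero_iff hx hy).mp h0).1, add_comm]
    · rintro ⟨α, hα, rfl⟩
      exact angI_smul_left_self hy hα
  tfae_finish
end

section
/- Let X be a real normed space of dimension at least 2 with I-angle ang_i. Then ang_i is homogeneous, i.e., ang_i(αx,βy) = ang_i(x,y) for all x,y ∈ X_o and all α,β > 0, if and only if the norm of X is derived from an inner product, i.e., satisfies the parallelogram law ‖x+y‖² + ‖x−y‖² = 2‖x‖² + 2‖y‖² for all x,y ∈ X. -/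
open Real

theorem angI_arg_mem_Icc {X : Type*} [NormedAddCommGroup X] [NormedSpace ℝ X]
    {x y : X} (hx : x ≠ 0) (hy : y ≠ 0) :
    (‖x + y‖ ^ 2 - ‖x - y‖ ^ 2) / (4 * ‖x‖ * ‖y‖) ∈ Set.Icc (-1 : ℝ) 1 := by
  have hx' : 0 < ‖x‖ := norm_pos_iff.mpr hx
  have hy' : 0 < ‖y‖ := norm_pos_iff.mpr hy
  have upper (u : X) (v : X) : ‖u + v‖ ^ 2 ≤ (‖u‖ + ‖v‖) ^ 2 :=
    pow_le_pow_left₀ (norm_nonneg _) (norm_add_le u v) 2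
  have lower (u : X) (v : X) : (‖u‖ - ‖v‖) ^ 2 ≤ ‖u - v‖ ^ 2 :=
    sq_le_sq.mpr (by simpa using abs_norm_sub_norm_le u v)
  have h₁ := upper x y
  have h₂ := lower x y
  have h₃ := upper x (-y)
  have h₄ := lower x (-y)
  simp only [norm_neg, ← sub_eq_add_neg, sub_neg_eq_add] at h₃ h₄
  constructor
  · rw [le_div_iff₀ (by positivity)]
    linarith
  · rw [div_le_one (by positivity)]
    linarith

theorem norm_sq_sub_smul_smul_of_angI {X : Type*} [NormedAddCommGroup X] [NormedSpace ℝ X]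
    {x y : X} (hx : x ≠ 0) (hy : y ≠ 0) {α β : ℝ} (hα : 0 < α) (hβ : 0 < β)
    (h : angI (α • x) (β • y) = angI x y) :
    ‖α • x + β • y‖ ^ 2 - ‖α • x - β • y‖ ^ 2 =
      α * β * (‖x + y‖ ^ 2 - ‖x - y‖ ^ 2) := by
  have hx' : 0 < ‖x‖ := norm_pos_iff.mpr hx
  have hy' : 0 < ‖y‖ := norm_pos_iff.mpr hy
  have key := Real.arccos_injOn
    (angI_arg_mem_Icc (smul_ne_zero hα.ne' hx) (smul_ne_zero hβ.ne' hy))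
    (angI_arg_mem_Icc hx hy) h
  rw [norm_smul α x, norm_smul β y, Real.norm_of_nonneg hα.le, Real.norm_of_nonneg hβ.le,
    div_eq_div_iff (by positivity) (by positivity)] at key
  refine mul_right_cancel₀ (b := 4 * ‖x‖ * ‖y‖) (by positivity) ?_
  linear_combination key

/-- If the third differences of the squared norm vanish along every line, then the norm satisfies
the parallelogram law. -/
theorem parallelogram_law_of_third_difference {X : Type*} [NormedAddCommGroup X]
    [NormedSpace ℝ X]
    (h : ∀ z w : X, ‖z + (3 : ℝ) • w‖ ^ 2 - ‖z - (3 : ℝ) • w‖ ^ 2 =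
      3 * (‖z + w‖ ^ 2 - ‖z - w‖ ^ 2)) (x y : X) :
    ‖x + y‖ ^ 2 + ‖x - y‖ ^ 2 = 2 * ‖x‖ ^ 2 + 2 * ‖y‖ ^ 2 := by
  have scale (c : ℝ) (v : X) : ‖c • v‖ ^ 2 = c ^ 2 * ‖v‖ ^ 2 := by
    rw [norm_smul, mul_pow, Real.norm_eq_abs, sq_abs]
  have h₁ := h ((2 : ℝ) • x + y) y
  have h₂ := h ((4 : ℝ) • y - x) x
  have h₃ := h ((4 : ℝ) • y + x) x
  rw [show (2 : ℝ) • x + y + (3 : ℝ) • y = (2 : ℝ) • (x + (2 : ℝ) • y) by module,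
    show (2 : ℝ) • x + y - (3 : ℝ) • y = (2 : ℝ) • (x - y) by module,
    show (2 : ℝ) • x + y + y = (2 : ℝ) • (x + y) by module,
    show (2 : ℝ) • x + y - y = (2 : ℝ) • x by module] at h₁
  rw [show (4 : ℝ) • y - x + (3 : ℝ) • x = (2 : ℝ) • (x + (2 : ℝ) • y) by module,
    show (4 : ℝ) • y - x - (3 : ℝ) • x = (-4 : ℝ) • (x - y) by module,
    show (4 : ℝ) • y - x + x = (4 : ℝ) • y by module,
    show (4 : ℝ) • y - x - x = (2 : ℝ) • ((2 : ℝ) • y - x) by module] at h₂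
  rw [show (4 : ℝ) • y + x + (3 : ℝ) • x = (4 : ℝ) • (x + y) by module,
    show (4 : ℝ) • y + x - (3 : ℝ) • x = (2 : ℝ) • ((2 : ℝ) • y - x) by module,
    show (4 : ℝ) • y + x + x = (2 : ℝ) • (x + (2 : ℝ) • y) by module,
    show (4 : ℝ) • y + x - x = (4 : ℝ) • y by module] at h₃
  rw [scale, scale, scale, scale] at h₁ h₂ h₃
  linarith

theorem angI_smul_smul_of_parallelogram_law {X : Type*} [NormedAddCommGroup X]
    [NormedSpace ℝ X]
    (h : ∀ x y : X, ‖x + y‖ ^ 2 + ‖x - y‖ ^ 2 = 2 * ‖x‖ ^ 2 + 2 * ‖y‖ ^ 2)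
    (x y : X) {α β : ℝ} (hα : 0 < α) (hβ : 0 < β) :
    angI (α • x) (β • y) = angI x y := by
  let _ : InnerProductSpace ℝ X := InnerProductSpace.ofNorm ℝ fun u v => by
    linear_combination h u v
  have polar (u v : X) : ‖u + v‖ ^ 2 - ‖u - v‖ ^ 2 = 4 * inner ℝ u v := by
    rw [norm_add_sq_real, norm_sub_sq_real]
    ring
  unfold angI
  rw [polar, polar, real_inner_smul_left, real_inner_smul_right, norm_smul α x, norm_smul β y,
    Real.norm_of_nonneg hα.le, Real.norm_of_nonneg hβ.le,
    show 4 * (α * (β * inner ℝ x y)) = (α * β) * (4 * inner ℝ x y) by ring,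
    show 4 * (α * ‖x‖) * (β * ‖y‖) = (α * β) * (4 * ‖x‖ * ‖y‖) by ring,
    mul_div_mul_left _ _ (mul_pos hα hβ).ne']

theorem angI_homogeneous_iff_inner_product
    {X : Type*} [NormedAddCommGroup X] [NormedSpace ℝ X]
    (hdim : 2 ≤ Module.rank ℝ X) :
    (∀ x y : X, x ≠ 0 → y ≠ 0 → ∀ α β : ℝ, 0 < α → 0 < β →
      angI (α • x) (β • y) = angI x y) ↔
    (∀ x y : X, ‖x + y‖ ^ 2 + ‖x - y‖ ^ 2 = 2 * ‖x‖ ^ 2 + 2 * ‖y‖ ^ 2) := by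
  refine ⟨fun h => parallelogram_law_of_third_difference fun z w => ?_,
    fun h x y _ _ α β hα hβ => angI_smul_smul_of_parallelogram_law h x y hα hβ⟩
  rcases eq_or_ne z 0 with rfl | hz
  · simp
  rcases eq_or_ne w 0 with rfl | hw
  · simp
  simpa using norm_sq_sub_smul_smul_of_angI hz hw one_pos three_pos
    (h z w hz hw 1 3 one_pos three_pos)
end

section
/- Let X be a real normed space and let ang : X_o × X_o → [0,π] be an angle function satisfying the structural axioms (1) continuity, (3) homogeneity, and (5) non-degeneracy, as well as the positional property (6) parallelism. Let x,y ∈ X_o be linearly independent vectors and suppose the function f : ℝ → [0,π] given by f(t) = ang(y, x+ty) is injective. Then f is a decreasing homeomorphism from ℝ onto the open interval (0,π). -/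
open Real

theorem add_smul_ne_zero_of_linearIndependent {X : Type*} [AddCommGroup X] [Module ℝ X]
    {x y : X} (hxy : LinearIndependent ℝ ![x, y]) (t : ℝ) : x + t • y ≠ 0 := by
  intro h
  have := LinearIndependent.pair_iff.1 hxy 1 t (by simpa using h)
  exact one_ne_zero this.1

/-- Along a ray, a positively homogeneous function that is continuous away from the origin
converges to its value at the direction of the ray. -/
theorem tendsto_add_smul_of_homogeneous {X : Type*} [NormedAddCommGroup X] [NormedSpace ℝ X]
    {φ : X → ℝ} (hφ : ContinuousOn φ {z : X | z ≠ 0})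
    (hφh : ∀ z : X, z ≠ 0 → ∀ β : ℝ, 0 < β → φ (β • z) = φ z)
    {x v : X} (hv : v ≠ 0) (hne : ∀ t : ℝ, x + t • v ≠ 0) :
    Filter.Tendsto (fun t : ℝ => φ (x + t • v)) Filter.atTop (nhds (φ v)) := by
  have hc : ContinuousAt φ v := hφ.continuousAt (isOpen_ne.mem_nhds hv)
  have hlim : Filter.Tendsto (fun t : ℝ => t⁻¹ • x + v) Filter.atTop (nhds v) := by
    simpa using ((tendsto_inv_atTop_zero (𝕜 := ℝ)).smul_const x).add_const v
  refine (hc.tendsto.comp hlim).congr' ?_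
  filter_upwards [Filter.eventually_gt_atTop (0 : ℝ)] with t ht
  rw [Function.comp_apply, ← hφh _ (hne t) t⁻¹ (inv_pos.2 ht), smul_add, smul_smul,
    inv_mul_cancel₀ ht.ne', one_smul]

theorem angle_ray_function_decreasing_homeomorphism
    {X : Type*} [NormedAddCommGroup X] [NormedSpace ℝ X]
    (ang : X → X → ℝ)
    (hrange : ∀ x y : X, x ≠ 0 → y ≠ 0 → ang x y ∈ Set.Icc 0 Real.pi)
    (hcont : ∀ x : X, x ≠ 0 →
      ContinuousOn (fun y => ang x y) {y : X | y ≠ 0} ∧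
      ContinuousOn (fun y => ang y x) {y : X | y ≠ 0} ∧
      (fun y => ang x y) '' {y : X | y ≠ 0} = Set.Icc 0 Real.pi ∧
      (fun y => ang y x) '' {y : X | y ≠ 0} = Set.Icc 0 Real.pi)
    (hhomog : ∀ x y : X, x ≠ 0 → y ≠ 0 → ∀ α β : ℝ, 0 < α → 0 < β →
      ang (α • x) (β • y) = ang x y)
    (hnd : ∀ x y : X, x ≠ 0 → y ≠ 0 → (ang x y = 0 ↔ ∃ α : ℝ, 0 < α ∧ x = α • y))
    (hpar : ∀ x y : X, x ≠ 0 → y ≠ 0 → (ang x y = Real.pi ↔ ∃ α : ℝ, α < 0 ∧ y = α • x))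
    (x y : X) (hxy : LinearIndependent ℝ ![x, y])
    (hinj : Function.Injective (fun t : ℝ => ang y (x + t • y))) :
    StrictAnti (fun t : ℝ => ang y (x + t • y)) ∧
    Continuous (fun t : ℝ => ang y (x + t • y)) ∧
    Set.range (fun t : ℝ => ang y (x + t • y)) = Set.Ioo 0 Real.pi := by
  have hne := add_smul_ne_zero_of_linearIndependent hxy
  have hy : y ≠ 0 := by simpa using hxy.ne_zero 1
  have hφ := (hcont y hy).1
  have hφh : ∀ z : X, z ≠ 0 → ∀ β : ℝ, 0 < β → ang y (β • z) = ang y z := fun z hz β hβ => by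
    simpa using hhomog y z hy hz 1 β one_pos hβ
  have hf : Continuous (fun t : ℝ => ang y (x + t • y)) :=
    hφ.comp_continuous (by fun_prop) hne
  have htop : Filter.Tendsto (fun t : ℝ => ang y (x + t • y)) Filter.atTop (nhds 0) := by
    have h := tendsto_add_smul_of_homogeneous hφ hφh hy hne
    rwa [(hnd y y hy hy).2 ⟨1, one_pos, (one_smul ℝ y).symm⟩] at h
  have hbot : Filter.Tendsto (fun t : ℝ => ang y (x + t • y)) Filter.atBot (nhds Real.pi) := by
    have h := (tendsto_add_smul_of_homogeneous hφ hφh (neg_ne_zero.2 hy)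
      (fun t => by simpa using hne (-t))).comp Filter.tendsto_neg_atBot_atTop
    rw [(hpar y (-y) hy (neg_ne_zero.2 hy)).2 ⟨-1, by norm_num, by simp⟩] at h
    simpa [Function.comp_def] using h
  have hanti : StrictAnti (fun t : ℝ => ang y (x + t • y)) := by
    refine (hf.strictMono_of_inj hinj).resolve_left fun hm => ?_
    have h0 := (hrange y _ hy (hne 0)).1
    have h1 := hm.monotone.ge_of_tendsto htop 1
    have h01 := hm (zero_lt_one' ℝ)
    dsimp only at h1 h01
    linarith
  refine ⟨hanti, hf, Set.Subset.antisymm ?_ fun c hc => ?_⟩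
  · rintro _ ⟨t, rfl⟩
    exact ⟨(hrange y _ hy (hne (t + 1))).1.trans_lt (hanti (lt_add_one t)),
      (hanti (sub_one_lt t)).trans_le (hrange y _ hy (hne (t - 1))).2⟩
  · obtain ⟨a, ha⟩ := (htop.eventually_lt_const hc.1).exists
    obtain ⟨b, hb⟩ := (hbot.eventually_const_lt hc.2).exists
    exact mem_range_of_exists_le_of_exists_ge hf ⟨a, ha.le⟩ ⟨b, hb.le⟩
end

section
/- Let X be a strictly convex real normed space with associated Thy-angle ang_thy. If x,y ∈ X_o are linearly independent, then the function f : ℝ → (0,π) given by f(t) = ang_thy(y, x+ty) is a decreasing homeomorphism from ℝ onto (0,π). -/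
open Real

/-- The Thy-angle of a normed space. -/
noncomputable def angThy {X : Type*} [NormedAddCommGroup X] [NormedSpace ℝ X]
    (x y : X) : ℝ :=
  Real.arccos ((1 / 4) * (‖‖x‖⁻¹ • x + ‖y‖⁻¹ • y‖ ^ 2 - ‖‖x‖⁻¹ • x - ‖y‖⁻¹ • y‖ ^ 2))

/-- Linearly independent vectors do not lie on the same ray. -/
theorem LinearIndependent.not_sameRay {X : Type*} [AddCommGroup X] [Module ℝ X] {x y : X}
    (h : LinearIndependent ℝ ![x, y]) : ¬ SameRay ℝ x y := fun hs =>
  sameRay_or_sameRay_neg_iff_not_linearIndependent.1 (Or.inl hs) h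

/-- If `x` and `y` are linearly independent, the line `x + t • y` avoids the origin. -/
theorem LinearIndependent.add_smul_ne_zero {X : Type*} [AddCommGroup X] [Module ℝ X] {x y : X}
    (h : LinearIndependent ℝ ![x, y]) (t : ℝ) : x + t • y ≠ 0 := fun h0 =>
  one_ne_zero (LinearIndependent.pair_iff.1 h 1 t (by rwa [one_smul])).1

/-- In a strictly convex space, if the unit vector `a • p + b • e` lies in the open cone spanned by
the independent unit vectors `p` and `e`, then it is strictly closer to `e` than `p` is. -/
theorem norm_sub_lt_norm_sub_of_mem_open_cone {X : Type*} [NormedAddCommGroup X] [NormedSpace ℝ X]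
    [StrictConvexSpace ℝ X] {e p : X} {a b : ℝ}
    (h : LinearIndependent ℝ ![p, e]) (he : ‖e‖ = 1) (hp : ‖p‖ = 1)
    (hq : ‖a • p + b • e‖ = 1) (ha : 0 < a) (hb : 0 < b) :
    ‖a • p + b • e - e‖ < ‖p - e‖ := by
  have hab : 1 < a + b := by
    have hnot : ¬ SameRay ℝ (a • p + (0 : ℝ) • e) ((0 : ℝ) • p + b • e) :=
      ((LinearIndependent.pair_add_smul_add_smul_iff _ _ _ _).2
        ⟨h, by simp [ha.ne', hb.ne']⟩).not_sameRay
    have := norm_add_lt_of_not_sameRay hnot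
    simp only [zero_smul, add_zero, zero_add] at this
    rwa [hq, norm_smul, norm_smul, he, hp, Real.norm_of_nonneg ha.le,
      Real.norm_of_nonneg hb.le, mul_one, mul_one] at this
  have hs : 0 < a + b := by linarith
  obtain ⟨c, hc⟩ : ∃ c : ℝ, c = (a + b)⁻¹ := ⟨_, rfl⟩
  have hcs : c * (a + b) = 1 := by rw [hc]; field_simp
  have hc0 : 0 < c := hc ▸ inv_pos.2 hs
  have hc1 : c < 1 := hc ▸ inv_lt_one_of_one_lt₀ hab
  -- `c • (a • p + b • e)` is the intersection of the two diagonals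
  have h1 : ‖a • p + b • e - e‖ < (1 - c) + c * a * ‖p - e‖ := by
    have hnot : ¬ SameRay ℝ (((1 - c) * a) • p + ((1 - c) * b) • e)
        ((c * a) • p + (-(c * a)) • e) := by
      refine ((LinearIndependent.pair_add_smul_add_smul_iff _ _ _ _).2 ⟨h, fun heq => ?_⟩).not_sameRay
      have : (1 - c) * (c * a) * (a + b) = 0 := by linear_combination -heq
      have hpos : 0 < (1 - c) * (c * a) * (a + b) := by
        have : 0 < 1 - c := by linarith
        positivity
      exact hpos.ne' this
    have key := norm_add_lt_of_not_sameRay hnot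
    have e1 : ((1 - c) * a) • p + ((1 - c) * b) • e = (1 - c) • (a • p + b • e) := by module
    have e2 : (c * a) • p + (-(c * a)) • e = (c * a) • (p - e) := by module
    have e3 : (1 - c) • (a • p + b • e) + (c * a) • (p - e) = a • p + b • e - e := by
      have : (1 - c) • (a • p + b • e) + (c * a) • (p - e) =
        a • p + b • e - (c * (a + b)) • e := by module
      rw [this, hcs, one_smul]
    rw [e1, e2, e3, norm_smul, norm_smul, hq, Real.norm_of_nonneg (by linarith),
      Real.norm_of_nonneg (by positivity), mul_one] at key
    exact key
  have h2 : 1 ≤ c + c * b * ‖p - e‖ := by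
    have e1 : p = c • (a • p + b • e) + (c * b) • (p - e) := by
      have : c • (a • p + b • e) + (c * b) • (p - e) = (c * (a + b)) • p := by module
      rw [this, hcs, one_smul]
    calc 1 = ‖c • (a • p + b • e) + (c * b) • (p - e)‖ := by rw [← e1, hp]
      _ ≤ ‖c • (a • p + b • e)‖ + ‖(c * b) • (p - e)‖ := norm_add_le _ _
      _ = c + c * b * ‖p - e‖ := by
        rw [norm_smul, norm_smul, hq, Real.norm_of_nonneg hc0.le,
          Real.norm_of_nonneg (by positivity), mul_one]
  have h3 : c * a * ‖p - e‖ + c * b * ‖p - e‖ = ‖p - e‖ := by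
    linear_combination ‖p - e‖ * hcs
  linarith

/-- Moving along the line `x + t • y` in direction `y` brings the normalized vector closer to the
normalization of `y`. -/
theorem strictAnti_norm_normalized_sub {X : Type*} [NormedAddCommGroup X] [NormedSpace ℝ X]
    [StrictConvexSpace ℝ X] {x y : X} (h : LinearIndependent ℝ ![x, y]) :
    StrictAnti fun t : ℝ => ‖‖y‖⁻¹ • y - ‖x + t • y‖⁻¹ • (x + t • y)‖ := by
  intro s t hst
  have hy : 0 < ‖y‖ := norm_pos_iff.2 (h.ne_zero 1)
  have hs : 0 < ‖x + s • y‖ := norm_pos_iff.2 (h.add_smul_ne_zero s)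
  have ht : 0 < ‖x + t • y‖ := norm_pos_iff.2 (h.add_smul_ne_zero t)
  have hcomb : ‖x + t • y‖⁻¹ • (x + t • y) =
      (‖x + t • y‖⁻¹ * ‖x + s • y‖) • (‖x + s • y‖⁻¹ • (x + s • y)) +
        (‖x + t • y‖⁻¹ * (t - s) * ‖y‖) • (‖y‖⁻¹ • y) := by
    rw [smul_smul, smul_smul, mul_assoc, mul_inv_cancel₀ hs.ne', mul_assoc,
      mul_inv_cancel₀ hy.ne']
    module
  have hind : LinearIndependent ℝ ![‖x + s • y‖⁻¹ • (x + s • y), ‖y‖⁻¹ • y] := by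
    have := (LinearIndependent.pair_add_smul_add_smul_iff (R := ℝ) (x := x) (y := y)
      (a := ‖x + s • y‖⁻¹) (b := ‖x + s • y‖⁻¹ * s) (c := 0) (d := ‖y‖⁻¹)).2
      ⟨h, by simp [hs.ne', hy.ne']⟩
    simpa [smul_add, smul_smul] using this
  have hunit : ∀ v : X, 0 < ‖v‖ → ‖‖v‖⁻¹ • v‖ = 1 := fun v hv => by
    rw [norm_smul, norm_inv, norm_norm, inv_mul_cancel₀ hv.ne']
  have key := norm_sub_lt_norm_sub_of_mem_open_cone hind (hunit y hy) (hunit _ hs)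
    (hcomb ▸ hunit _ ht) (by positivity)
    (mul_pos (mul_pos (inv_pos.2 ht) (sub_pos.2 hst)) hy)
  rw [← hcomb] at key
  simpa only [norm_sub_rev] using key

theorem strictMono_norm_normalized_add {X : Type*} [NormedAddCommGroup X] [NormedSpace ℝ X]
    [StrictConvexSpace ℝ X] {x y : X} (h : LinearIndependent ℝ ![x, y]) :
    StrictMono fun t : ℝ => ‖‖y‖⁻¹ • y + ‖x + t • y‖⁻¹ • (x + t • y)‖ := by
  have hneg : LinearIndependent ℝ ![x, -y] := by
    have := (LinearIndependent.pair_add_smul_add_smul_iff (R := ℝ) (x := x) (y := y)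
      (a := 1) (b := 0) (c := 0) (d := -1)).2 ⟨h, by simp⟩
    simpa using this
  intro s t hst
  have key := strictAnti_norm_normalized_sub hneg (neg_lt_neg hst)
  have hrw : ∀ v : X, ‖-(‖y‖⁻¹ • y) - v‖ = ‖‖y‖⁻¹ • y + v‖ := fun v => by
    rw [← norm_neg]; congr 1; abel
  simpa only [neg_smul, neg_neg, norm_neg, smul_neg, hrw] using key

theorem angThy_smul_right {X : Type*} [NormedAddCommGroup X] [NormedSpace ℝ X] (x y : X) {c : ℝ}
    (hc : 0 < c) : angThy x (c • y) = angThy x y := by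
  have : ‖c • y‖⁻¹ • c • y = ‖y‖⁻¹ • y := by
    rw [norm_smul, Real.norm_of_nonneg hc.le, smul_smul, mul_inv, mul_right_comm,
      inv_mul_cancel₀ hc.ne', one_mul]
  rw [angThy, angThy, this]

theorem angThy_self {X : Type*} [NormedAddCommGroup X] [NormedSpace ℝ X] {x : X} (hx : x ≠ 0) :
    angThy x x = 0 := by
  have hu : ‖‖x‖⁻¹ • x‖ = 1 := norm_smul_inv_norm (𝕜 := ℝ) hx
  rw [angThy, ← two_smul ℝ (‖x‖⁻¹ • x), norm_smul, hu, sub_self, norm_zero]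
  norm_num

theorem angThy_neg_right_self {X : Type*} [NormedAddCommGroup X] [NormedSpace ℝ X] {x : X}
    (hx : x ≠ 0) : angThy x (-x) = π := by
  have hu : ‖‖x‖⁻¹ • x‖ = 1 := norm_smul_inv_norm (𝕜 := ℝ) hx
  rw [angThy, norm_neg, smul_neg, sub_neg_eq_add, ← two_smul ℝ (‖x‖⁻¹ • x), norm_smul, hu,
    add_neg_cancel, norm_zero]
  norm_num

theorem continuousAt_angThy_right {X : Type*} [NormedAddCommGroup X] [NormedSpace ℝ X] (x : X)
    {y : X} (hy : y ≠ 0) : ContinuousAt (angThy x) y := by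
  have hn : ContinuousAt (fun z : X => ‖z‖⁻¹ • z) y :=
    (continuous_norm.continuousAt.inv₀ (norm_ne_zero_iff.2 hy)).smul continuousAt_id
  exact Real.continuous_arccos.continuousAt.comp
    (continuousAt_const.mul (((continuousAt_const.add hn).norm.pow 2).sub
      ((continuousAt_const.sub hn).norm.pow 2)))

theorem tendsto_angThy_ray_atTop {X : Type*} [NormedAddCommGroup X] [NormedSpace ℝ X] (x y : X)
    {z : X} (hz : z ≠ 0) :
    Filter.Tendsto (fun t : ℝ => angThy y (x + t • z)) Filter.atTop (nhds (angThy y z)) := by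
  have hlim : Filter.Tendsto (fun t : ℝ => t⁻¹ • x + z) Filter.atTop (nhds z) := by
    simpa using ((tendsto_inv_atTop_zero (𝕜 := ℝ)).smul_const x).add_const z
  refine ((continuousAt_angThy_right y hz).tendsto.comp hlim).congr' ?_
  filter_upwards [Filter.eventually_gt_atTop (0 : ℝ)] with t ht
  rw [Function.comp_apply, ← angThy_smul_right y _ ht, smul_add, smul_smul,
    mul_inv_cancel₀ ht.ne', one_smul]

theorem strictAnti_angThy_ray {X : Type*} [NormedAddCommGroup X] [NormedSpace ℝ X]
    [StrictConvexSpace ℝ X] {x y : X} (h : LinearIndependent ℝ ![x, y]) :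
    StrictAnti fun t : ℝ => angThy y (x + t • y) := by
  intro s t hst
  have hle : ∀ r : ℝ, ‖‖y‖⁻¹ • y + ‖x + r • y‖⁻¹ • (x + r • y)‖ ≤ 2 ∧
      ‖‖y‖⁻¹ • y - ‖x + r • y‖⁻¹ • (x + r • y)‖ ≤ 2 := fun r => by
    have hu : ‖‖y‖⁻¹ • y‖ = 1 := norm_smul_inv_norm (𝕜 := ℝ) (h.ne_zero 1)
    have hv : ‖‖x + r • y‖⁻¹ • (x + r • y)‖ = 1 :=
      norm_smul_inv_norm (𝕜 := ℝ) (h.add_smul_ne_zero r)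
    constructor
    · linarith [norm_add_le (‖y‖⁻¹ • y) (‖x + r • y‖⁻¹ • (x + r • y))]
    · linarith [norm_sub_le (‖y‖⁻¹ • y) (‖x + r • y‖⁻¹ • (x + r • y))]
  have h1 := pow_lt_pow_left₀ (strictAnti_norm_normalized_sub h hst) (norm_nonneg _) two_ne_zero
  have h2 := pow_lt_pow_left₀ (strictMono_norm_normalized_add h hst) (norm_nonneg _) two_ne_zero
  have h3 := pow_le_pow_left₀ (norm_nonneg _) (hle s).2 2
  have h4 := pow_le_pow_left₀ (norm_nonneg _) (hle t).1 2
  refine Real.arccos_lt_arccos ?_ ?_ ?_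
  · nlinarith [sq_nonneg ‖‖y‖⁻¹ • y + ‖x + s • y‖⁻¹ • (x + s • y)‖]
  · linarith
  · nlinarith [sq_nonneg ‖‖y‖⁻¹ • y - ‖x + t • y‖⁻¹ • (x + t • y)‖]

theorem angThy_ray_function_decreasing_homeomorphism
    {X : Type*} [NormedAddCommGroup X] [NormedSpace ℝ X]
    (hsc : ∀ x y : X, x ≠ 0 → y ≠ 0 → ‖x + y‖ = ‖x‖ + ‖y‖ → ∃ α : ℝ, 0 < α ∧ y = α • x)
    (x y : X) (hxy : LinearIndependent ℝ ![x, y]) :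
    StrictAnti (fun t : ℝ => angThy y (x + t • y)) ∧
    Continuous (fun t : ℝ => angThy y (x + t • y)) ∧
    Set.range (fun t : ℝ => angThy y (x + t • y)) = Set.Ioo 0 Real.pi := by
  have : StrictConvexSpace ℝ X := by
    refine StrictConvexSpace.of_norm_add fun u v hu hv huv => ?_
    obtain ⟨α, hα, rfl⟩ := hsc u v (norm_ne_zero_iff.1 (by simp [hu]))
      (norm_ne_zero_iff.1 (by simp [hv])) (by rw [huv, hu, hv]; norm_num)
    exact SameRay.sameRay_nonneg_smul_right u hα.le
  have hy : y ≠ 0 := hxy.ne_zero 1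
  have hanti := strictAnti_angThy_ray hxy
  have hcont : Continuous (fun t : ℝ => angThy y (x + t • y)) :=
    continuous_iff_continuousAt.2 fun t =>
      (continuousAt_angThy_right y (hxy.add_smul_ne_zero t)).comp
        (f := fun t : ℝ => x + t • y) (by fun_prop)
  refine ⟨hanti, hcont, Set.Subset.antisymm ?_ fun c hc => ?_⟩
  · rintro _ ⟨t, rfl⟩
    exact ⟨(Real.arccos_nonneg _).trans_lt (hanti (lt_add_one t)),
      (hanti (sub_one_lt t)).trans_le (Real.arccos_le_pi _)⟩
  · have htop := tendsto_angThy_ray_atTop x y hy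
    have hbot := tendsto_angThy_ray_atTop x y (neg_ne_zero.2 hy)
    rw [angThy_self hy] at htop
    rw [angThy_neg_right_self hy] at hbot
    obtain ⟨a, ha⟩ := (htop.eventually_lt_const hc.1).exists
    obtain ⟨b, hb⟩ := (hbot.eventually_const_lt hc.2).exists
    exact mem_range_of_exists_le_of_exists_ge hcont ⟨a, ha.le⟩
      ⟨-b, by simpa using hb.le⟩
end

section
/- Let X be a 2-dimensional real normed space and let x,y ∈ X be linearly independent. Let proj_{x,y} : X → X be the linear projection onto the line spanned by x in the direction of y (i.e., the linear map with proj_{x,y}(x) = x and proj_{x,y}(y) = 0), and let ‖proj_{x,y}‖ denote its operator norm. Then ‖proj_{x,y}‖⁻¹ = s(x,y), where s(x,y) = (inf_{t∈ℝ} ‖x+ty‖)/‖x‖ is the Minkowskian sine function. -/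
open Real

theorem inverse_operator_norm_of_projection_eq_sine
    {X : Type*} [NormedAddCommGroup X] [NormedSpace ℝ X]
    (hdim : Module.finrank ℝ X = 2)
    (x y : X) (hxy : LinearIndependent ℝ ![x, y])
    (P : X →L[ℝ] X) (hPx : P x = x) (hPy : P y = 0) :
    ‖P‖⁻¹ = (⨅ t : ℝ, ‖x + t • y‖) / ‖x‖ := by
  have hx : 0 < ‖x‖ := norm_pos_iff.mpr (hxy.ne_zero 0)
  have hle (t : ℝ) : ‖x‖ ≤ ‖P‖ * ‖x + t • y‖ := by
    simpa [hPx, hPy] using P.le_opNorm (x + t • y)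
  have hP : 0 < ‖P‖ := by
    rcases (norm_nonneg P).eq_or_lt with h | h
    · have := hle 0
      rw [← h, zero_mul] at this
      linarith
    · exact h
  have hlower : ‖x‖ / ‖P‖ ≤ ⨅ t : ℝ, ‖x + t • y‖ :=
    le_ciInf fun t => (div_le_iff₀' hP).mpr (hle t)
  have hinf (t : ℝ) : ⨅ t : ℝ, ‖x + t • y‖ ≤ ‖x + t • y‖ :=
    ciInf_le ⟨0, by rintro _ ⟨s, rfl⟩; exact norm_nonneg _⟩ t
  set m := ⨅ t : ℝ, ‖x + t • y‖
  have hm : 0 < m := (div_pos hx hP).trans_le hlower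
  have hupper : ‖P‖ ≤ ‖x‖ / m := by
    refine P.opNorm_le_bound (by positivity) fun z => ?_
    have hz : z ∈ Submodule.span ℝ {x, y} := by
      have h := hxy.span_eq_top_of_card_eq_finrank (by simp [hdim])
      rw [Matrix.range_cons_cons_empty] at h
      simp [h]
    obtain ⟨a, b, rfl⟩ := Submodule.mem_span_pair.mp hz
    have hnorm : |a| * m ≤ ‖a • x + b • y‖ := by
      rcases eq_or_ne a 0 with rfl | ha
      · simp
      · have h : a • x + b • y = a • (x + (b / a) • y) := by
          rw [smul_add, smul_smul, mul_div_cancel₀ _ ha]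
        rw [h, norm_smul, Real.norm_eq_abs]
        exact mul_le_mul_of_nonneg_left (hinf _) (abs_nonneg a)
    calc ‖P (a • x + b • y)‖ = ‖x‖ / m * (|a| * m) := by
          simp only [map_add, map_smul, hPx, hPy, smul_zero, add_zero, norm_smul,
            Real.norm_eq_abs]
          field_simp
      _ ≤ ‖x‖ / m * ‖a • x + b • y‖ := by gcongr
  rw [le_antisymm hupper ((div_le_comm₀ hP hm).mp hlower), inv_div]
end

section
/- Let X be a strictly convex 2-dimensional real normed space equipped with a nonzero alternating bilinear determinant form [·,·], and let ang_s be the associated S-angle. Then ang_s is symmetric, i.e., ang_s(x,y) = ang_s(y,x) for all x,y ∈ X_o, if and only if X is a Radon plane, i.e., Birkhoff orthogonality in X is a symmetric relation. -/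
open Real

/-- The S-angle of a strictly convex normed plane, constructed from a determinant
form `ω` and the map `b` sending each nonzero vector `y` to the unit vector that is
Birkhoff orthogonal to `y` with `ω y (b y) > 0`. -/
noncomputable def angS {X : Type*} [NormedAddCommGroup X] [NormedSpace ℝ X]
    (ω : X →ₗ[ℝ] X →ₗ[ℝ] ℝ) (b : X → X) (x y : X) : ℝ :=
  if 0 ≤ ω x (b y) then Real.arcsin ((⨅ t : ℝ, ‖x + t • y‖) / ‖x‖)
  else Real.pi - Real.arcsin ((⨅ t : ℝ, ‖x + t • y‖) / ‖x‖)

section Telescoping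

/-- A function whose increments are dominated by the mesh times the increments of another
function takes equal values at the endpoints of the unit interval. -/
lemma eq_of_abs_sub_le_mul_sub (r g : ℝ → ℝ) (C : ℝ)
    (h : ∀ s t : ℝ, 0 ≤ s → s ≤ t → t ≤ 1 → |r t - r s| ≤ C * ((t - s) * (g t - g s))) :
    r 1 = r 0 := by
  have hpart : ∀ n : ℕ, |r 1 - r 0| ≤ (C * (g 1 - g 0)) / ((n : ℝ) + 1) := by
    intro n
    have hn : (0 : ℝ) < (n : ℝ) + 1 := by positivity
    have hsum : ∀ k : ℕ, k ≤ n + 1 →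
        |r (k / ((n : ℝ) + 1)) - r 0| ≤ C * (g (k / ((n : ℝ) + 1)) - g 0) / ((n : ℝ) + 1) := by
      intro k
      induction k with
      | zero => intro _; simp
      | succ k ih =>
        intro hk
        have hk' : ((k + 1 : ℕ) : ℝ) ≤ (n : ℝ) + 1 := by exact_mod_cast hk
        have hstep := h (k / ((n : ℝ) + 1)) ((k + 1 : ℕ) / ((n : ℝ) + 1)) (by positivity)
          (by gcongr; simp) ((div_le_one hn).2 hk')
        have hmesh : ((k + 1 : ℕ) : ℝ) / ((n : ℝ) + 1) - k / ((n : ℝ) + 1)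
            = 1 / ((n : ℝ) + 1) := by
          push_cast; ring
        rw [hmesh] at hstep
        refine (abs_sub_le _ (r (k / ((n : ℝ) + 1))) _).trans
          ((add_le_add hstep (ih (by omega))).trans (le_of_eq ?_))
        ring
    have := hsum (n + 1) le_rfl
    rwa [show ((n + 1 : ℕ) : ℝ) / ((n : ℝ) + 1) = 1 by push_cast; exact div_self hn.ne'] at this
  have hlim : Filter.Tendsto (fun n : ℕ => (C * (g 1 - g 0)) / ((n : ℝ) + 1)) Filter.atTop
      (nhds 0) :=
    ((tendsto_const_div_atTop_nhds_zero_nat (C * (g 1 - g 0))).comp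
      (Filter.tendsto_add_atTop_nat 1)).congr (fun n => by simp)
  exact sub_eq_zero.1 (abs_nonpos_iff.1 (ge_of_tendsto' hlim hpart))

end Telescoping

section Plane

variable {X : Type*} [NormedAddCommGroup X] [NormedSpace ℝ X]

lemma alternating_swap {ω : X →ₗ[ℝ] X →ₗ[ℝ] ℝ} (halt : ∀ x : X, ω x x = 0) (x y : X) :
    ω y x = -ω x y := by
  have h := halt (x + y)
  simp only [map_add, LinearMap.add_apply, halt] at h
  linarith

/-- Cramer's rule in a plane. -/
lemma alternating_smul_eq (hdim : Module.finrank ℝ X = 2) {ω : X →ₗ[ℝ] X →ₗ[ℝ] ℝ}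
    (halt : ∀ x : X, ω x x = 0) (p q v : X) :
    ω p q • v = ω v q • p + ω p v • q := by
  have : Module.Finite ℝ X := Module.finite_of_finrank_pos (by omega)
  let e := Module.finBasisOfFinrankEq ℝ X hdim
  have hrepr : ∀ x : X, x = e.repr x 0 • e 0 + e.repr x 1 • e 1 := fun x => by
    conv_lhs => rw [← e.sum_repr x, Fin.sum_univ_two]
  generalize e 0 = e₀ at hrepr
  generalize e 1 = e₁ at hrepr
  rw [hrepr p, hrepr q, hrepr v]
  simp only [map_add, map_smul, LinearMap.add_apply, LinearMap.smul_apply, smul_eq_mul, halt,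
    alternating_swap halt e₀ e₁]
  module

/-- The Plücker relation in a plane. -/
lemma alternating_mul_eq (hdim : Module.finrank ℝ X = 2) {ω : X →ₗ[ℝ] X →ₗ[ℝ] ℝ}
    (halt : ∀ x : X, ω x x = 0) (p q v w : X) :
    ω p q * ω v w = ω v q * ω p w + ω p v * ω q w := by
  simpa using congrArg (fun z => ω z w) (alternating_smul_eq hdim halt p q v)

lemma norm_le_norm_smul_add_smul {p q : X} (hpq : ∀ t : ℝ, ‖p‖ ≤ ‖p + t • q‖) (c d : ℝ) :
    |c| * ‖p‖ ≤ ‖c • p + d • q‖ := by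
  rcases eq_or_ne c 0 with rfl | hc
  · simp
  · have : c • p + d • q = c • (p + (d / c) • q) := by
      rw [smul_add, smul_smul, mul_div_cancel₀ _ hc]
    rw [this, norm_smul, Real.norm_eq_abs]
    exact mul_le_mul_of_nonneg_left (hpq _) (abs_nonneg c)

lemma abs_alternating_mul_norm_le (hdim : Module.finrank ℝ X = 2) {ω : X →ₗ[ℝ] X →ₗ[ℝ] ℝ}
    (halt : ∀ x : X, ω x x = 0) {p q : X} (hpq : ∀ t : ℝ, ‖p‖ ≤ ‖p + t • q‖) (v : X) :
    |ω v q| * ‖p‖ ≤ |ω p q| * ‖v‖ := by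
  refine (norm_le_norm_smul_add_smul hpq (ω v q) (ω p v)).trans (le_of_eq ?_)
  rw [← alternating_smul_eq hdim halt, norm_smul, Real.norm_eq_abs]

lemma bddBelow_range_norm_add_smul (x y : X) : BddBelow (Set.range fun t : ℝ => ‖x + t • y‖) :=
  ⟨0, by rintro _ ⟨t, rfl⟩; exact norm_nonneg _⟩

lemma iInf_norm_add_smul_nonneg (x y : X) : 0 ≤ ⨅ t : ℝ, ‖x + t • y‖ :=
  le_ciInf fun _ => norm_nonneg _

lemma iInf_norm_add_smul_le (x y : X) : ⨅ t : ℝ, ‖x + t • y‖ ≤ ‖x‖ := by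
  simpa using ciInf_le (bddBelow_range_norm_add_smul x y) 0

lemma iInf_norm_add_smul_div_le_one (x y : X) : (⨅ t : ℝ, ‖x + t • y‖) / ‖x‖ ≤ 1 :=
  div_le_one_of_le₀ (iInf_norm_add_smul_le x y) (norm_nonneg x)

lemma sin_angS (ω : X →ₗ[ℝ] X →ₗ[ℝ] ℝ) (b : X → X) (x y : X) :
    Real.sin (angS ω b x y) = (⨅ t : ℝ, ‖x + t • y‖) / ‖x‖ := by
  have h0 : 0 ≤ (⨅ t : ℝ, ‖x + t • y‖) / ‖x‖ :=
    div_nonneg (iInf_norm_add_smul_nonneg x y) (norm_nonneg x)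
  have h := Real.sin_arcsin (by linarith) (iInf_norm_add_smul_div_le_one x y)
  unfold angS
  split_ifs
  · exact h
  · rw [Real.sin_pi_sub, h]

lemma iInf_norm_add_smul_div_eq_one_iff {x : X} (hx : x ≠ 0) (y : X) :
    (⨅ t : ℝ, ‖x + t • y‖) / ‖x‖ = 1 ↔ ∀ t : ℝ, ‖x‖ ≤ ‖x + t • y‖ := by
  rw [div_eq_one_iff_eq (norm_ne_zero_iff.2 hx)]
  refine ⟨fun h t => h ▸ ciInf_le (bddBelow_range_norm_add_smul x y) t, fun h => ?_⟩
  exact le_antisymm (iInf_norm_add_smul_le x y) (le_ciInf h)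

section Perp

variable {ω : X →ₗ[ℝ] X →ₗ[ℝ] ℝ} {b : X → X}

lemma abs_alternating_le_mul_norm (hdim : Module.finrank ℝ X = 2) (halt : ∀ x : X, ω x x = 0)
    (hb : ∀ y : X, y ≠ 0 → ‖b y‖ = 1 ∧ (∀ t : ℝ, ‖b y‖ ≤ ‖b y + t • y‖) ∧ 0 < ω y (b y))
    {y : X} (hy : y ≠ 0) (v : X) : |ω y v| ≤ ω y (b y) * ‖v‖ := by
  obtain ⟨h1, h2, h3⟩ := hb y hy
  have h := abs_alternating_mul_norm_le hdim halt h2 v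
  rwa [h1, mul_one, alternating_swap halt y v, alternating_swap halt y (b y), abs_neg, abs_neg,
    abs_of_pos h3] at h

/-- The distance from `x` to the line spanned by `y` in terms of the determinant form. -/
lemma iInf_norm_add_smul_eq (hdim : Module.finrank ℝ X = 2) (halt : ∀ x : X, ω x x = 0)
    (hb : ∀ y : X, y ≠ 0 → ‖b y‖ = 1 ∧ (∀ t : ℝ, ‖b y‖ ≤ ‖b y + t • y‖) ∧ 0 < ω y (b y))
    (x : X) {y : X} (hy : y ≠ 0) : ⨅ t : ℝ, ‖x + t • y‖ = |ω x y| / ω y (b y) := by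
  obtain ⟨h1, -, h3⟩ := hb y hy
  apply le_antisymm
  · refine (ciInf_le (bddBelow_range_norm_add_smul x y) (-ω x (b y) / ω y (b y))).trans
      (le_of_eq ?_)
    have hxy : x + (-ω x (b y) / ω y (b y)) • y = (ω y x / ω y (b y)) • b y := by
      have h := alternating_smul_eq hdim halt y (b y) x
      have hx : x = (ω y (b y))⁻¹ • (ω x (b y) • y + ω y x • b y) := by
        rw [← h, inv_smul_smul₀ h3.ne']
      nth_rewrite 1 [hx]
      module
    rw [hxy, norm_smul, h1, mul_one, Real.norm_eq_abs, abs_div, abs_of_pos h3,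
      alternating_swap halt x y, abs_neg]
  · refine le_ciInf fun t => ?_
    rw [div_le_iff₀ h3]
    have h := abs_alternating_le_mul_norm hdim halt hb hy (x + t • y)
    rw [map_add, map_smul, halt, smul_zero, add_zero, alternating_swap halt x y, abs_neg] at h
    linarith

/-- In a Radon plane the map `b` controls the variation of `y ↦ ω y (b y) / ‖y‖`. -/
lemma mul_norm_sub_mul_norm_le (hdim : Module.finrank ℝ X = 2) (halt : ∀ x : X, ω x x = 0)
    (hb : ∀ y : X, y ≠ 0 → ‖b y‖ = 1 ∧ (∀ t : ℝ, ‖b y‖ ≤ ‖b y + t • y‖) ∧ 0 < ω y (b y))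
    (hradon : ∀ x y : X, (∀ t : ℝ, ‖x‖ ≤ ‖x + t • y‖) → (∀ t : ℝ, ‖y‖ ≤ ‖y + t • x‖))
    {u v : X} (hu : u ≠ 0) (hv : v ≠ 0) :
    ω v (b v) * ‖u‖ - ω u (b u) * ‖v‖ ≤ ‖u‖ * ω (v - u) (b v - b u) := by
  have h1 := abs_alternating_mul_norm_le hdim halt (hradon _ _ (hb u hu).2.1) v
  rw [abs_of_pos (hb u hu).2.2] at h1
  have h2 := abs_alternating_le_mul_norm hdim halt hb hu (b v)
  rw [(hb v hv).1, mul_one] at h2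
  have h3 : ω v (b u) * ‖u‖ ≤ |ω v (b u)| * ‖u‖ :=
    mul_le_mul_of_nonneg_right (le_abs_self _) (norm_nonneg u)
  have h4 : 0 ≤ ‖u‖ * (ω u (b u) - ω u (b v)) :=
    mul_nonneg (norm_nonneg u) (sub_nonneg.2 ((le_abs_self _).trans h2))
  simp only [map_sub, LinearMap.sub_apply]
  linarith

lemma abs_div_norm_sub_div_norm_le (hdim : Module.finrank ℝ X = 2) (halt : ∀ x : X, ω x x = 0)
    (hb : ∀ y : X, y ≠ 0 → ‖b y‖ = 1 ∧ (∀ t : ℝ, ‖b y‖ ≤ ‖b y + t • y‖) ∧ 0 < ω y (b y))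
    (hradon : ∀ x y : X, (∀ t : ℝ, ‖x‖ ≤ ‖x + t • y‖) → (∀ t : ℝ, ‖y‖ ≤ ‖y + t • x‖))
    {u v : X} {m : ℝ} (hm : 0 < m) (hu : m ≤ ‖u‖) (hv : m ≤ ‖v‖) :
    |ω v (b v) / ‖v‖ - ω u (b u) / ‖u‖| ≤ m⁻¹ * ω (v - u) (b v - b u) := by
  have hu0 : 0 < ‖u‖ := hm.trans_le hu
  have hv0 : 0 < ‖v‖ := hm.trans_le hv
  have huv := mul_norm_sub_mul_norm_le hdim halt hb hradon (norm_pos_iff.1 hu0)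
    (norm_pos_iff.1 hv0)
  have hvu := mul_norm_sub_mul_norm_le hdim halt hb hradon (norm_pos_iff.1 hv0)
    (norm_pos_iff.1 hu0)
  have hsymm : ω (u - v) (b u - b v) = ω (v - u) (b v - b u) := by
    rw [← neg_sub v u, ← neg_sub (b v) (b u)]
    simp only [map_neg, LinearMap.neg_apply, neg_neg]
  rw [hsymm] at hvu
  set D := ω (v - u) (b v - b u)
  have hD : 0 ≤ D := by
    by_contra! hneg
    have := mul_neg_of_pos_of_neg hu0 hneg
    have := mul_neg_of_pos_of_neg hv0 hneg
    linarith
  have hmu : ‖v‖⁻¹ * D ≤ m⁻¹ * D := by gcongr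
  have hmv : ‖u‖⁻¹ * D ≤ m⁻¹ * D := by gcongr
  have hsub : ω v (b v) / ‖v‖ - ω u (b u) / ‖u‖
      = (ω v (b v) * ‖u‖ - ω u (b u) * ‖v‖) / (‖u‖ * ‖v‖) := by
    field_simp
  rw [abs_le]
  constructor
  · rw [hsub, neg_le, ← neg_div, div_le_iff₀ (by positivity)]
    have h : ‖u‖⁻¹ * D * (‖u‖ * ‖v‖) ≤ m⁻¹ * D * (‖u‖ * ‖v‖) := by gcongr
    have : ‖u‖⁻¹ * D * (‖u‖ * ‖v‖) = ‖v‖ * D := by field_simp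
    linarith
  · rw [hsub, div_le_iff₀ (by positivity)]
    have h : ‖v‖⁻¹ * D * (‖u‖ * ‖v‖) ≤ m⁻¹ * D * (‖u‖ * ‖v‖) := by gcongr
    have : ‖v‖⁻¹ * D * (‖u‖ * ‖v‖) = ‖u‖ * D := by field_simp
    linarith

lemma div_norm_eq_div_norm (hdim : Module.finrank ℝ X = 2) (halt : ∀ x : X, ω x x = 0)
    (hb : ∀ y : X, y ≠ 0 → ‖b y‖ = 1 ∧ (∀ t : ℝ, ‖b y‖ ≤ ‖b y + t • y‖) ∧ 0 < ω y (b y))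
    (hradon : ∀ x y : X, (∀ t : ℝ, ‖x‖ ≤ ‖x + t • y‖) → (∀ t : ℝ, ‖y‖ ≤ ‖y + t • x‖))
    {u v : X} (huv : ω u v ≠ 0) : ω v (b v) / ‖v‖ = ω u (b u) / ‖u‖ := by
  have hq : v - u ≠ 0 := fun h => huv (by rw [sub_eq_zero.1 h, halt])
  have hN := (hb _ hq).2.2
  have hm : 0 < |ω u v| / ω (v - u) (b (v - u)) := div_pos (abs_pos.2 huv) hN
  have hline : ∀ t : ℝ, |ω u v| / ω (v - u) (b (v - u)) ≤ ‖u + t • (v - u)‖ := by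
    intro t
    have h := abs_alternating_le_mul_norm hdim halt hb hq (u + t • (v - u))
    rw [map_add, map_smul, halt, smul_zero, add_zero, map_sub, LinearMap.sub_apply, halt,
      sub_zero, alternating_swap halt u v, abs_neg] at h
    rw [div_le_iff₀ hN]
    simpa [mul_comm] using h
  have h := eq_of_abs_sub_le_mul_sub
    (fun t => ω (u + t • (v - u)) (b (u + t • (v - u))) / ‖u + t • (v - u)‖)
    (fun t => ω (v - u) (b (u + t • (v - u)))) (|ω u v| / ω (v - u) (b (v - u)))⁻¹ ?_
  · simpa using h
  · intro s t _ _ _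
    refine (abs_div_norm_sub_div_norm_le hdim halt hb hradon hm (hline s) (hline t)).trans
      (le_of_eq ?_)
    rw [show u + t • (v - u) - (u + s • (v - u)) = (t - s) • (v - u) by module, map_smul,
      LinearMap.smul_apply, smul_eq_mul, map_sub (ω (v - u))]

lemma iInf_div_norm_symm (hdim : Module.finrank ℝ X = 2) (halt : ∀ x : X, ω x x = 0)
    (hb : ∀ y : X, y ≠ 0 → ‖b y‖ = 1 ∧ (∀ t : ℝ, ‖b y‖ ≤ ‖b y + t • y‖) ∧ 0 < ω y (b y))
    (hradon : ∀ x y : X, (∀ t : ℝ, ‖x‖ ≤ ‖x + t • y‖) → (∀ t : ℝ, ‖y‖ ≤ ‖y + t • x‖))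
    {x y : X} (hx : x ≠ 0) (hy : y ≠ 0) :
    (⨅ t : ℝ, ‖x + t • y‖) / ‖x‖ = (⨅ t : ℝ, ‖y + t • x‖) / ‖y‖ := by
  rw [iInf_norm_add_smul_eq hdim halt hb x hy, iInf_norm_add_smul_eq hdim halt hb y hx,
    alternating_swap halt x y, abs_neg]
  rcases eq_or_ne (ω x y) 0 with h | h
  · simp [h]
  · have hxy := div_norm_eq_div_norm hdim halt hb hradon h
    have hx0 := norm_ne_zero_iff.2 hx
    have hy0 := norm_ne_zero_iff.2 hy
    rw [div_eq_div_iff hy0 hx0] at hxy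
    rw [div_div, div_div, hxy]

/-- If `x` and `y` disagree on the obtuseness of their angle, then the angle is right. -/
lemma iInf_div_norm_eq_one (hdim : Module.finrank ℝ X = 2) (halt : ∀ x : X, ω x x = 0)
    (hb : ∀ y : X, y ≠ 0 → ‖b y‖ = 1 ∧ (∀ t : ℝ, ‖b y‖ ≤ ‖b y + t • y‖) ∧ 0 < ω y (b y))
    (hradon : ∀ x y : X, (∀ t : ℝ, ‖x‖ ≤ ‖x + t • y‖) → (∀ t : ℝ, ‖y‖ ≤ ‖y + t • x‖))
    {x y : X} (hx : x ≠ 0) (hy : y ≠ 0) (hxy : ω x (b y) * ω y (b x) ≤ 0) :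
    (⨅ t : ℝ, ‖y + t • x‖) / ‖y‖ = 1 := by
  refine le_antisymm (iInf_norm_add_smul_div_le_one y x) ?_
  obtain ⟨hbx, -, hNx⟩ := hb x hx
  obtain ⟨hby, -, hNy⟩ := hb y hy
  have hy0 : 0 < ‖y‖ := norm_pos_iff.2 hy
  have hby0 : b y ≠ 0 := norm_ne_zero_iff.1 (by rw [hby]; exact one_ne_zero)
  have hconst := div_norm_eq_div_norm hdim halt hb hradon hNy.ne'
  rw [hby, div_one] at hconst
  have hbb := abs_alternating_le_mul_norm hdim halt hb hby0 (b x)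
  rw [hbx, mul_one, hconst, alternating_swap halt (b x) (b y), abs_neg] at hbb
  have hplucker := alternating_mul_eq hdim halt x (b x) y (b y)
  have hle : ω x (b x) * ω y (b y) ≤ |ω x y| * |ω (b x) (b y)| := by
    rw [← abs_mul]
    exact le_trans (by linarith) (le_abs_self _)
  have hle' := hle.trans (mul_le_mul_of_nonneg_left hbb (abs_nonneg _))
  rw [← mul_div_assoc, le_div_iff₀ hy0] at hle'
  rw [iInf_norm_add_smul_eq hdim halt hb y hx, alternating_swap halt x y, abs_neg, div_div,
    le_div_iff₀ (by positivity), one_mul]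
  refine le_of_mul_le_mul_right ?_ hNy
  linarith

end Perp

end Plane

theorem angS_symmetric_iff_radon
    {X : Type*} [NormedAddCommGroup X] [NormedSpace ℝ X]
    (hdim : Module.finrank ℝ X = 2)
    (hsc : ∀ x y : X, x ≠ 0 → y ≠ 0 → ‖x + y‖ = ‖x‖ + ‖y‖ → ∃ α : ℝ, 0 < α ∧ y = α • x)
    (ω : X →ₗ[ℝ] X →ₗ[ℝ] ℝ) (hω : ω ≠ 0) (halt : ∀ x : X, ω x x = 0)
    (b : X → X)
    (hb : ∀ y : X, y ≠ 0 → ‖b y‖ = 1 ∧ (∀ t : ℝ, ‖b y‖ ≤ ‖b y + t • y‖) ∧ 0 < ω y (b y)) :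
    (∀ x y : X, x ≠ 0 → y ≠ 0 → angS ω b x y = angS ω b y x) ↔
    (∀ x y : X, (∀ t : ℝ, ‖x‖ ≤ ‖x + t • y‖) → (∀ t : ℝ, ‖y‖ ≤ ‖y + t • x‖)) := by
  constructor
  · intro hsymm x y hxy
    rcases eq_or_ne x 0 with rfl | hx
    · simp
    rcases eq_or_ne y 0 with rfl | hy
    · simp
    rw [← iInf_norm_add_smul_div_eq_one_iff hy, ← sin_angS ω b, ← hsymm x y hx hy, sin_angS,
      iInf_norm_add_smul_div_eq_one_iff hx]
    exact hxy
  · intro hradon x y hx hy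
    have hs := iInf_div_norm_symm hdim halt hb hradon hx hy
    unfold angS
    rw [hs]
    split_ifs with hxy hyx hyx
    · rfl
    · rw [iInf_div_norm_eq_one hdim halt hb hradon hx hy
        (mul_nonpos_of_nonneg_of_nonpos hxy (not_le.1 hyx).le), Real.arcsin_one]
      ring
    · rw [iInf_div_norm_eq_one hdim halt hb hradon hx hy
        (mul_nonpos_of_nonpos_of_nonneg (not_le.1 hxy).le hyx), Real.arcsin_one]
      ring
    · rfl
end

section
/- Let X be a strictly convex real normed space of dimension at least 2, with the functionals t* and t** defined as follows: for x,y ∈ X_o, t*(x,y) is the unique real number with ‖x − t*(x,y)·y‖ = inf_{t∈ℝ} ‖x − ty‖, and t**(x,y) equals 0 if x ⊣_B y, and otherwise is the unique nonzero real number with ‖x − t**(x,y)·y‖ = ‖x‖. Then X is an inner product space (i.e., the parallelogram law ‖x+y‖² + ‖x−y‖² = 2‖x‖² + 2‖y‖² holds) if and only if t*(x,y) = t**(x,y)/2 for all x,y ∈ X_o. -/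
open Real

/-- In a strictly convex space a point of least norm on a line is unique. -/
theorem minimizer_unique {X : Type*} [NormedAddCommGroup X] [NormedSpace ℝ X]
    [StrictConvexSpace ℝ X] {x y : X} (hy : y ≠ 0) {s r : ℝ}
    (hs : ∀ t : ℝ, ‖x - s • y‖ ≤ ‖x - t • y‖) (hr : ∀ t : ℝ, ‖x - r • y‖ ≤ ‖x - t • y‖) :
    s = r := by
  by_contra hne
  have hxy : x - s • y ≠ x - r • y := fun h =>
    hne (smul_left_injective ℝ hy (sub_right_injective h))
  have hlt := norm_combo_lt_of_ne le_rfl (hr s) hxy (a := 1 / 2) (b := 1 / 2)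
    (by norm_num) (by norm_num) (by norm_num)
  have hmid : (1 / 2 : ℝ) • (x - s • y) + (1 / 2 : ℝ) • (x - r • y) =
      x - ((s + r) / 2) • y := by module
  rw [hmid] at hlt
  exact absurd (hs _) (not_le.mpr hlt)

/-- In a strictly convex space a line meets a sphere in at most two points. -/
theorem chord_unique {X : Type*} [NormedAddCommGroup X] [NormedSpace ℝ X]
    [StrictConvexSpace ℝ X] {x y : X} (hy : y ≠ 0) {s r : ℝ} (hs0 : s ≠ 0) (hr0 : r ≠ 0)
    (hs : ‖x - s • y‖ = ‖x‖) (hr : ‖x - r • y‖ = ‖x‖) : s = r := by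
  have key : ∀ a b c : ℝ, a < b → b < c → ‖x - a • y‖ = ‖x‖ → ‖x - b • y‖ = ‖x‖ →
      ‖x - c • y‖ = ‖x‖ → False := by
    intro a b c hab hbc ha hb hc
    have hxy : x - a • y ≠ x - c • y := fun h =>
      (hab.trans hbc).ne (smul_left_injective ℝ hy (sub_right_injective h))
    have hca : 0 < c - a := by linarith
    have hlt := norm_combo_lt_of_ne ha.le hc.le hxy (a := (c - b) / (c - a))
      (b := (b - a) / (c - a)) (div_pos (by linarith) hca) (div_pos (by linarith) hca)
      (by field_simp; ring)
    have hcomb : ((c - b) / (c - a)) • (x - a • y) + ((b - a) / (c - a)) • (x - c • y) =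
        x - b • y := by
      match_scalars <;> field_simp <;> ring
    rw [hcomb, hb] at hlt
    exact lt_irrefl _ hlt
  have h0 : ‖x - (0 : ℝ) • y‖ = ‖x‖ := by simp
  by_contra hne
  rcases lt_or_gt_of_ne hs0 with h1 | h1 <;> rcases lt_or_gt_of_ne hr0 with h2 | h2 <;>
    rcases lt_or_gt_of_ne hne with h3 | h3
  · exact key _ _ _ h3 h2 hs hr h0
  · exact key _ _ _ h3 h1 hr hs h0
  · exact key _ _ _ h1 h2 hs h0 hr
  · exact key _ _ _ h1 h2 hs h0 hr
  · exact key _ _ _ h2 h1 hr h0 hs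
  · exact key _ _ _ h2 h1 hr h0 hs
  · exact key _ _ _ h1 h3 h0 hs hr
  · exact key _ _ _ h2 h3 h0 hr hs

/-- Homogeneity of isosceles orthogonality implies Ficken's condition. -/
theorem norm_combo_comm_of_isosceles {X : Type*} [NormedAddCommGroup X] [NormedSpace ℝ X]
    (hiso : ∀ u v : X, ‖u + v‖ = ‖u - v‖ → ∀ t : ℝ, ‖u + t • v‖ = ‖u - t • v‖)
    {a b : X} (h : ‖a‖ = ‖b‖) (t : ℝ) : ‖a - t • b‖ = ‖b - t • a‖ := by
  by_cases ht : t = 1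
  · subst ht
    rw [one_smul, one_smul, norm_sub_rev]
  have ht' : 1 - t ≠ 0 := sub_ne_zero.mpr (Ne.symm ht)
  have h1 : ‖(a + b) + (a - b)‖ = ‖(a + b) - (a - b)‖ := by
    have e1 : (a + b) + (a - b) = (2 : ℝ) • a := by module
    have e2 : (a + b) - (a - b) = (2 : ℝ) • b := by module
    rw [e1, e2, norm_smul, norm_smul, h]
  have h2 := hiso _ _ h1 ((1 + t) / (1 - t))
  have e1 : a - t • b = ((1 - t) / 2) • ((a + b) + ((1 + t) / (1 - t)) • (a - b)) := by
    match_scalars <;> field_simp <;> ring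
  have e2 : b - t • a = ((1 - t) / 2) • ((a + b) - ((1 + t) / (1 - t)) • (a - b)) := by
    match_scalars <;> field_simp <;> ring
  rw [e1, e2, norm_smul, norm_smul, h2]

/-- Ficken's condition for vectors of arbitrary norms. -/
theorem norm_mul_norm_sub_smul {X : Type*} [NormedAddCommGroup X] [NormedSpace ℝ X]
    (hF : ∀ a b : X, ‖a‖ = ‖b‖ → ∀ t : ℝ, ‖a - t • b‖ = ‖b - t • a‖)
    {x y : X} (hx : x ≠ 0) (q : ℝ) :
    ‖y‖ * ‖x - q • y‖ = ‖x‖ * ‖y - (q * ‖y‖ ^ 2 / ‖x‖ ^ 2) • x‖ := by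
  have hx' : ‖x‖ ≠ 0 := norm_ne_zero_iff.mpr hx
  have h := hF (‖y‖ • x) (‖x‖ • y) (by simp [norm_smul, mul_comm]) (q * ‖y‖ / ‖x‖)
  have e1 : ‖y‖ • x - (q * ‖y‖ / ‖x‖) • ‖x‖ • y = ‖y‖ • (x - q • y) := by
    match_scalars <;> field_simp
  have e2 : ‖x‖ • y - (q * ‖y‖ / ‖x‖) • ‖y‖ • x =
      ‖x‖ • (y - (q * ‖y‖ ^ 2 / ‖x‖ ^ 2) • x) := by
    match_scalars <;> field_simp
  rwa [e1, e2, norm_smul, norm_smul, norm_norm, norm_norm] at h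

/-- Under Ficken's condition the best approximation coefficients `ts` define a symmetric form
`ts y x * ‖x‖ ^ 2` that polarizes the squared norm. -/
theorem norm_add_sq_of_ficken {X : Type*} [NormedAddCommGroup X] [NormedSpace ℝ X]
    (hF : ∀ a b : X, ‖a‖ = ‖b‖ → ∀ t : ℝ, ‖a - t • b‖ = ‖b - t • a‖)
    (ts : X → X → ℝ)
    (hmin : ∀ x y : X, x ≠ 0 → y ≠ 0 → ∀ t : ℝ, ‖x - ts x y • y‖ ≤ ‖x - t • y‖)
    (huniq : ∀ x y : X, x ≠ 0 → y ≠ 0 → ∀ s : ℝ,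
      (∀ t : ℝ, ‖x - s • y‖ ≤ ‖x - t • y‖) → ts x y = s)
    {x y : X} (hx : x ≠ 0) (hy : y ≠ 0) :
    ‖x + y‖ ^ 2 = ‖x‖ ^ 2 + ‖y‖ ^ 2 + 2 * (ts y x * ‖x‖ ^ 2) := by
  have hsymm : ∀ a b : X, a ≠ 0 → b ≠ 0 → ts a b * ‖b‖ ^ 2 = ts b a * ‖a‖ ^ 2 := by
    intro a b ha hb
    have ha' : 0 < ‖a‖ := norm_pos_iff.mpr ha
    have hb' : 0 < ‖b‖ := norm_pos_iff.mpr hb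
    have h := huniq b a hb ha (ts a b * ‖b‖ ^ 2 / ‖a‖ ^ 2) (fun t => by
      have h1 := norm_mul_norm_sub_smul hF (y := b) ha (ts a b)
      have h2 := norm_mul_norm_sub_smul hF (y := b) ha (t * ‖a‖ ^ 2 / ‖b‖ ^ 2)
      have e : t * ‖a‖ ^ 2 / ‖b‖ ^ 2 * ‖b‖ ^ 2 / ‖a‖ ^ 2 = t := by field_simp
      rw [e] at h2
      refine le_of_mul_le_mul_left ?_ ha'
      rw [← h1, ← h2]
      exact mul_le_mul_of_nonneg_left (hmin a b ha hb _) hb'.le)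
    rw [h]
    field_simp
  have hadd : ∀ a b : X, a ≠ 0 → b ≠ 0 → a + b ≠ 0 → ts (a + b) a = 1 + ts b a := by
    intro a b ha hb hab
    refine huniq _ _ hab ha _ fun t => ?_
    have h := hmin b a hb ha (t - 1)
    have e1 : a + b - (1 + ts b a) • a = b - ts b a • a := by module
    have e2 : a + b - t • a = b - (t - 1) • a := by module
    rwa [e1, e2]
  by_cases hz : x + y = 0
  · obtain rfl : y = -x := (neg_eq_of_add_eq_zero_right hz).symm
    have h : ts (-x) x = -1 := huniq _ _ hy hx _ fun t => by simp
    rw [hz, h, norm_neg, norm_zero]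
    ring
  · have hsum : ts y (x + y) = 1 - ts x (x + y) := by
      refine huniq _ _ hy hz _ fun t => ?_
      have h := hmin x (x + y) hx hz (1 - t)
      have e1 : y - (1 - ts x (x + y)) • (x + y) = -(x - ts x (x + y) • (x + y)) := by module
      have e2 : y - t • (x + y) = -(x - (1 - t) • (x + y)) := by module
      rwa [e1, e2, norm_neg, norm_neg]
    have h1 := hsymm x (x + y) hx hz
    have h2 := hsymm y (x + y) hy hz
    have h3 := hsymm x y hx hy
    have h4 := hadd x y hx hy hz
    have h5 := hadd y x hy hx (by rwa [add_comm])
    rw [add_comm y x] at h5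
    rw [h4] at h1
    rw [h5, hsum] at h2
    linarith

/-- Ficken's condition together with unique best approximations on lines implies the
parallelogram law. -/
theorem parallelogram_of_ficken {X : Type*} [NormedAddCommGroup X] [NormedSpace ℝ X]
    (hF : ∀ a b : X, ‖a‖ = ‖b‖ → ∀ t : ℝ, ‖a - t • b‖ = ‖b - t • a‖)
    (ts : X → X → ℝ)
    (hmin : ∀ x y : X, x ≠ 0 → y ≠ 0 → ∀ t : ℝ, ‖x - ts x y • y‖ ≤ ‖x - t • y‖)
    (huniq : ∀ x y : X, x ≠ 0 → y ≠ 0 → ∀ s : ℝ,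
      (∀ t : ℝ, ‖x - s • y‖ ≤ ‖x - t • y‖) → ts x y = s) (x y : X) :
    ‖x + y‖ ^ 2 + ‖x - y‖ ^ 2 = 2 * ‖x‖ ^ 2 + 2 * ‖y‖ ^ 2 := by
  by_cases hx : x = 0
  · subst hx
    rw [zero_add, zero_sub, norm_neg, norm_zero]
    ring
  by_cases hy : y = 0
  · subst hy
    rw [add_zero, sub_zero, norm_zero]
    ring
  have hneg : ts (-y) x = -ts y x := by
    refine huniq _ _ (neg_ne_zero.mpr hy) hx _ fun t => ?_
    have h := hmin y x hy hx (-t)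
    have e1 : -y - (-ts y x) • x = -(y - ts y x • x) := by module
    have e2 : -y - t • x = -(y - (-t) • x) := by module
    rwa [e1, e2, norm_neg, norm_neg]
  have h1 := norm_add_sq_of_ficken hF ts hmin huniq hx hy
  have h2 := norm_add_sq_of_ficken hF ts hmin huniq hx (neg_ne_zero.mpr hy)
  rw [hneg, norm_neg, ← sub_eq_add_neg] at h2
  linarith

/-- In an inner product space the midpoint of a chord of a sphere has least norm on its line. -/
theorem midpoint_minimizes_of_parallelogram {X : Type*} [NormedAddCommGroup X] [NormedSpace ℝ X]
    (hpar : ∀ x y : X, ‖x + y‖ ^ 2 + ‖x - y‖ ^ 2 = 2 * ‖x‖ ^ 2 + 2 * ‖y‖ ^ 2)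
    {x y : X} {s : ℝ} (hs0 : s ≠ 0) (hs : ‖x - s • y‖ = ‖x‖) (t : ℝ) :
    ‖x - (s / 2) • y‖ ≤ ‖x - t • y‖ := by
  let _ : InnerProductSpace ℝ X := InnerProductSpace.ofNorm ℝ fun a b => by
    have := hpar a b
    linarith
  have hexp : ∀ r : ℝ, ‖x - r • y‖ ^ 2 = ‖x‖ ^ 2 - 2 * r * inner ℝ x y + r ^ 2 * ‖y‖ ^ 2 := by
    intro r
    rw [norm_sub_sq_real, inner_smul_right, norm_smul, mul_pow, Real.norm_eq_abs, sq_abs]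
    ring
  have hI : 2 * inner ℝ x y = s * ‖y‖ ^ 2 := by
    have h := hexp s
    rw [hs] at h
    refine mul_left_cancel₀ hs0 ?_
    linarith
  refine (sq_le_sq₀ (norm_nonneg _) (norm_nonneg _)).mp ?_
  have hI' : inner ℝ x y = s * ‖y‖ ^ 2 / 2 := by linarith
  rw [hexp, hexp, hI']
  nlinarith [mul_nonneg (sq_nonneg (t - s / 2)) (sq_nonneg ‖y‖)]

theorem inner_product_iff_tstar_eq_half_tstarstar
    {X : Type*} [NormedAddCommGroup X] [NormedSpace ℝ X]
    (hdim : 2 ≤ Module.rank ℝ X)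
    (hsc : ∀ x y : X, x ≠ 0 → y ≠ 0 → ‖x + y‖ = ‖x‖ + ‖y‖ → ∃ α : ℝ, 0 < α ∧ y = α • x)
    (ts tss : X → X → ℝ)
    (hts : ∀ x y : X, x ≠ 0 → y ≠ 0 →
      ‖x - ts x y • y‖ = ⨅ t : ℝ, ‖x - t • y‖)
    (htss_orth : ∀ x y : X, x ≠ 0 → y ≠ 0 →
      (∀ t : ℝ, ‖x‖ ≤ ‖x + t • y‖) → tss x y = 0)
    (htss : ∀ x y : X, x ≠ 0 → y ≠ 0 →
      ¬ (∀ t : ℝ, ‖x‖ ≤ ‖x + t • y‖) → tss x y ≠ 0 ∧ ‖x - tss x y • y‖ = ‖x‖) :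
    (∀ x y : X, ‖x + y‖ ^ 2 + ‖x - y‖ ^ 2 = 2 * ‖x‖ ^ 2 + 2 * ‖y‖ ^ 2) ↔
    (∀ x y : X, x ≠ 0 → y ≠ 0 → ts x y = tss x y / 2) := by
  have : StrictConvexSpace ℝ X := StrictConvexSpace.of_norm_add fun x y hx hy hxy => by
    obtain ⟨α, hα, rfl⟩ := hsc x y (norm_ne_zero_iff.mp (by simp [hx]))
      (norm_ne_zero_iff.mp (by simp [hy])) (by rw [hx, hy, hxy]; norm_num)
    exact SameRay.sameRay_nonneg_smul_right x hα.le
  have hmin : ∀ x y : X, x ≠ 0 → y ≠ 0 → ∀ t : ℝ, ‖x - ts x y • y‖ ≤ ‖x - t • y‖ := by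
    intro x y hx hy t
    rw [hts x y hx hy]
    exact ciInf_le ⟨0, by rintro _ ⟨r, rfl⟩; exact norm_nonneg _⟩ t
  have huniq : ∀ x y : X, x ≠ 0 → y ≠ 0 → ∀ s : ℝ,
      (∀ t : ℝ, ‖x - s • y‖ ≤ ‖x - t • y‖) → ts x y = s :=
    fun x y hx hy s hs => minimizer_unique hy (hmin x y hx hy) hs
  have horth : ∀ x y : X, (∀ t : ℝ, ‖x‖ ≤ ‖x + t • y‖) →
      ∀ t : ℝ, ‖x - (0 : ℝ) • y‖ ≤ ‖x - t • y‖ := by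
    intro x y h t
    simpa [sub_eq_add_neg] using h (-t)
  constructor
  · intro hpar x y hx hy
    by_cases h : ∀ t : ℝ, ‖x‖ ≤ ‖x + t • y‖
    · rw [htss_orth x y hx hy h, zero_div]
      exact huniq x y hx hy 0 (horth x y h)
    · obtain ⟨h0, hs⟩ := htss x y hx hy h
      exact huniq x y hx hy _ (midpoint_minimizes_of_parallelogram hpar h0 hs)
  · intro hhalf
    have hmid : ∀ u v : X, ‖u + v‖ = ‖u - v‖ → ∀ t : ℝ, ‖u‖ ≤ ‖u + t • v‖ := by
      intro u v huv t
      by_cases hv : v = 0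
      · simp [hv]
      have hx : u + v ≠ 0 := by
        intro h
        rw [h, norm_zero] at huv
        have h' := norm_eq_zero.mp huv.symm
        have e : v = (1 / 2 : ℝ) • ((u + v) - (u - v)) := by module
        rw [h, h', sub_zero, smul_zero] at e
        exact hv e
      have e : u + v - (2 : ℝ) • v = u - v := by module
      have h2 : ‖u + v - (2 : ℝ) • v‖ = ‖u + v‖ := by rw [e, huv]
      have hno : ¬ ∀ t : ℝ, ‖u + v‖ ≤ ‖u + v + t • v‖ := by
        intro h
        have h0 := horth _ _ h
        have := minimizer_unique hv h0 (r := 2) fun t => by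
          rw [h2]
          simpa using h0 t
        norm_num at this
      obtain ⟨hs0, hs⟩ := htss _ _ hx hv hno
      have hs2 := chord_unique hv hs0 two_ne_zero hs h2
      have h := hmin _ _ hx hv (1 - t)
      rw [hhalf _ _ hx hv, hs2] at h
      have e1 : u + v - ((2 : ℝ) / 2) • v = u := by module
      have e2 : u + v - (1 - t) • v = u + t • v := by module
      rwa [e1, e2] at h
    have hchord : ∀ u v : X, (∀ t : ℝ, ‖u‖ ≤ ‖u + t • v‖) →
        ∀ t : ℝ, ‖u + t • v‖ = ‖u - t • v‖ := by
      intro u v h t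
      by_cases hu : u = 0
      · simp [hu]
      by_cases hv : v = 0
      · simp [hv]
      by_cases ht : t = 0
      · simp [ht]
      have hx : u + t • v ≠ 0 :=
        norm_pos_iff.mp ((norm_pos_iff.mpr hu).trans_le (h t))
      have hts' : ts (u + t • v) v = t := huniq _ _ hx hv t fun r => by
        have e : u + t • v - r • v = u + (t - r) • v := by module
        rw [add_sub_cancel_right, e]
        exact h _
      have hno : ¬ ∀ r : ℝ, ‖u + t • v‖ ≤ ‖u + t • v + r • v‖ := fun h' =>
        ht (hts'.symm.trans (huniq _ _ hx hv 0 (horth _ _ h')))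
      obtain ⟨-, hs⟩ := htss _ _ hx hv hno
      have hs2 : tss (u + t • v) v = 2 * t := by
        have := hhalf _ _ hx hv
        linarith
      have e : u + t • v - (2 * t) • v = u - t • v := by module
      rw [hs2, e] at hs
      exact hs.symm
    exact parallelogram_of_ficken
      (fun a b => norm_combo_comm_of_isosceles fun u v huv => hchord u v (hmid u v huv))
      ts hmin huniq
end

section
/- Let X be a strictly convex real normed space and define λ(x,y) = min{|t*(x,y)|, |t**(x,y) − t*(x,y)|} for x,y ∈ X_o. Then: (i) λ(x,y) ≤ ‖x‖/‖y‖, with equality if and only if y = αx for some α ≠ 0; and (ii) λ(x,y) = 0 if and only if x ⊣_B y. -/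
open Real

/-- In a strictly convex space, equal-norm vectors attaining equality in the triangle inequality
coincide. -/
lemma eq_of_norm_eq_of_two_mul_norm_le_norm_add {X : Type*} [NormedAddCommGroup X] [NormedSpace ℝ X]
    (hsc : ∀ x y : X, x ≠ 0 → y ≠ 0 → ‖x + y‖ = ‖x‖ + ‖y‖ → ∃ α : ℝ, 0 < α ∧ y = α • x)
    {x z : X} (hx : x ≠ 0) (hz : ‖z‖ = ‖x‖) (h : 2 * ‖x‖ ≤ ‖x + z‖) : z = x := by
  have hz0 : z ≠ 0 := norm_ne_zero_iff.mp (hz ▸ norm_ne_zero_iff.mpr hx)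
  obtain ⟨α, hα, rfl⟩ := hsc x z hx hz0 (le_antisymm (norm_add_le _ _) (by linarith))
  rw [norm_smul, Real.norm_of_nonneg hα.le] at hz
  have : α = 1 := mul_right_cancel₀ (norm_ne_zero_iff.mpr hx) (by linarith)
  rw [this, one_smul]

/-- A parameter with strictly smaller distance to `x` lies between two parameters `0` and `u`
giving the same distance `‖x‖`. -/
lemma abs_add_abs_sub_of_norm_lt {X : Type*} [NormedAddCommGroup X] [NormedSpace ℝ X]
    {x y : X} {s u : ℝ} (hu : u ≠ 0) (hxu : ‖x - u • y‖ = ‖x‖) (hs : ‖x - s • y‖ < ‖x‖) :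
    |s| + |u - s| = |u| := by
  obtain ⟨θ, rfl⟩ : ∃ θ, s = θ * u := ⟨s / u, by field_simp⟩
  have h0 : 0 ≤ θ := by
    by_contra! h
    have h1 : (1 - θ) • x = (x - (θ * u) • y) + (-θ) • (x - u • y) := by module
    have h2 := norm_add_le (x - (θ * u) • y) ((-θ) • (x - u • y))
    rw [← h1, norm_smul, norm_smul, Real.norm_of_nonneg (by linarith : 0 ≤ 1 - θ),
      Real.norm_of_nonneg (by linarith : 0 ≤ -θ), hxu] at h2
    linarith
  have h1 : θ ≤ 1 := by
    by_contra! h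
    have h1 : θ • (x - u • y) = (x - (θ * u) • y) + (θ - 1) • x := by module
    have h2 := norm_add_le (x - (θ * u) • y) ((θ - 1) • x)
    rw [← h1, norm_smul, norm_smul, Real.norm_of_nonneg h0,
      Real.norm_of_nonneg (by linarith : 0 ≤ θ - 1), hxu] at h2
    linarith
  rw [show u - θ * u = (1 - θ) * u by ring, abs_mul, abs_mul, abs_of_nonneg h0,
    abs_of_nonneg (by linarith : 0 ≤ 1 - θ)]
  ring

theorem lambda_bound_and_birkhoff
    {X : Type*} [NormedAddCommGroup X] [NormedSpace ℝ X]
    (hsc : ∀ x y : X, x ≠ 0 → y ≠ 0 → ‖x + y‖ = ‖x‖ + ‖y‖ → ∃ α : ℝ, 0 < α ∧ y = α • x)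
    (ts tss : X → X → ℝ)
    (hts : ∀ x y : X, x ≠ 0 → y ≠ 0 →
      ‖x - ts x y • y‖ = ⨅ t : ℝ, ‖x - t • y‖)
    (htss_orth : ∀ x y : X, x ≠ 0 → y ≠ 0 →
      (∀ t : ℝ, ‖x‖ ≤ ‖x + t • y‖) → tss x y = 0)
    (htss : ∀ x y : X, x ≠ 0 → y ≠ 0 →
      ¬ (∀ t : ℝ, ‖x‖ ≤ ‖x + t • y‖) → tss x y ≠ 0 ∧ ‖x - tss x y • y‖ = ‖x‖)
    (x y : X) (hx : x ≠ 0) (hy : y ≠ 0) :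
    (min |ts x y| |tss x y - ts x y| ≤ ‖x‖ / ‖y‖ ∧
      (min |ts x y| |tss x y - ts x y| = ‖x‖ / ‖y‖ ↔ ∃ α : ℝ, α ≠ 0 ∧ y = α • x)) ∧
    (min |ts x y| |tss x y - ts x y| = 0 ↔ ∀ t : ℝ, ‖x‖ ≤ ‖x + t • y‖) := by
  have hm : ∀ t : ℝ, ‖x - ts x y • y‖ ≤ ‖x - t • y‖ := fun t => by
    rw [hts x y hx hy]
    exact ciInf_le ⟨0, by rintro _ ⟨t, rfl⟩; exact norm_nonneg _⟩ t
  have hu0 := htss_orth x y hx hy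
  have hu1 := htss x y hx hy
  generalize ts x y = s at *
  generalize tss x y = u at *
  have hxp : 0 < ‖x‖ := norm_pos_iff.mpr hx
  have hyp : 0 < ‖y‖ := norm_pos_iff.mpr hy
  have hsx : ‖x - s • y‖ ≤ ‖x‖ := by simpa using hm 0
  by_cases ho : ∀ t : ℝ, ‖x‖ ≤ ‖x + t • y‖
  · have hs : s = 0 := by
      have h1 : ‖x‖ ≤ ‖x - s • y‖ := by simpa [sub_eq_add_neg] using ho (-s)
      have h2 : x + (x - s • y) = (2 : ℝ) • (x + (-s / 2) • y) := by module
      have h3 := eq_of_norm_eq_of_two_mul_norm_le_norm_add hsc hx (le_antisymm hsx h1) (by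
        rw [h2, norm_smul, Real.norm_of_nonneg zero_le_two]
        linarith [ho (-s / 2)])
      simpa [hy] using h3
    have hmin : min |s| |u - s| = 0 := by simp [hs, hu0 ho]
    rw [hmin]
    refine ⟨⟨by positivity, fun h => absurd h (by positivity), ?_⟩, fun _ => ho, fun _ => rfl⟩
    rintro ⟨α, hα, rfl⟩
    have := ho (-α⁻¹)
    simp [smul_smul, hα] at this
    exact absurd this hx
  · obtain ⟨hu, hxu⟩ := hu1 ho
    have hslt : ‖x - s • y‖ < ‖x‖ := by
      push Not at ho
      obtain ⟨t, ht⟩ := ho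
      have := hm (-t)
      rw [neg_smul, sub_neg_eq_add] at this
      exact this.trans_lt ht
    have hadd := abs_add_abs_sub_of_norm_lt hu hxu hslt
    have hmin : min |s| |u - s| ≤ |u| / 2 := by
      rcases min_le_iff.mp (le_refl (min |s| |u - s|)) with h | h <;>
        linarith [min_le_left |s| |u - s|, min_le_right |s| |u - s|]
    have hnorm : ‖x + (u • y - x)‖ = |u| * ‖y‖ := by
      rw [add_sub_cancel, norm_smul, Real.norm_eq_abs]
    have hxu' : ‖u • y - x‖ = ‖x‖ := by rw [norm_sub_rev, hxu]
    have hule : |u| / 2 ≤ ‖x‖ / ‖y‖ := by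
      rw [div_le_div_iff₀ two_pos hyp]
      linarith [norm_add_le x (u • y - x)]
    refine ⟨⟨hmin.trans hule, fun h => ?_, ?_⟩, fun h => ?_, fun h => absurd h ho⟩
    · have h1 : ‖x‖ / ‖y‖ ≤ |u| / 2 := h ▸ hmin
      rw [div_le_div_iff₀ hyp two_pos] at h1
      have h2 := eq_of_norm_eq_of_two_mul_norm_le_norm_add hsc hx hxu' (by linarith)
      have h3 : u • y = (2 : ℝ) • x := by rw [two_smul, ← sub_eq_iff_eq_add, h2]
      refine ⟨u⁻¹ * 2, by positivity, ?_⟩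
      rw [mul_smul, ← h3, inv_smul_smul₀ hu]
    · rintro ⟨α, hα, rfl⟩
      have hs : s = α⁻¹ := by
        have h1 := hm α⁻¹
        rw [inv_smul_smul₀ hα, sub_self, norm_zero, norm_le_zero_iff,
          show x - s • α • x = (1 - s * α) • x by module, smul_eq_zero_iff_left hx] at h1
        exact eq_inv_of_mul_eq_one_left (by linarith)
      have hus : u = 2 * α⁻¹ := by
        rw [show x - u • α • x = (1 - u * α) • x by module, norm_smul, Real.norm_eq_abs] at hxu
        have h1 : |1 - u * α| = 1 := mul_right_cancel₀ hxp.ne' (by linarith)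
        rcases (abs_eq zero_le_one).mp h1 with h2 | h2
        · exact absurd (show u * α = 0 by linarith) (mul_ne_zero hu hα)
        · field_simp
          linarith
      rw [hus, hs, show 2 * α⁻¹ - α⁻¹ = α⁻¹ by ring, min_self, abs_inv, norm_smul,
        Real.norm_eq_abs]
      field_simp
    · rcases min_choice |s| |u - s| with h1 | h1 <;> rw [h1, abs_eq_zero] at h
      · simp [h] at hslt
      · rw [← sub_eq_zero.mp h, hxu] at hslt
        exact absurd hslt (lt_irrefl _)
end

section
/- A real normed space X of dimension at least 2 has the Wilson property if and only if its norm is derived from an inner product, i.e., satisfies the parallelogram law ‖x+y‖² + ‖x−y‖² = 2‖x‖² + 2‖y‖² for all x,y ∈ X. Here X has the Wilson property when for every pair of nonzero vectors x,y ∈ X the joint limit lim arccos((‖p‖² + ‖q‖² − ‖p−q‖²)/(2‖p‖·‖q‖)) exists as p → 0 along the ray {sx : s > 0} and q → 0 along the ray {ty : t > 0}, with s and t tending to 0⁺ independently. -/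
open Real Filter

section WilsonAngle

variable {X : Type*} [NormedAddCommGroup X]

/-- The cosine of Wilson's 3-point angle of `p`, `0`, `q`. -/
noncomputable def wilsonCos (p q : X) : ℝ :=
  (‖p‖ ^ 2 + ‖q‖ ^ 2 - ‖p - q‖ ^ 2) / (2 * ‖p‖ * ‖q‖)

lemma wilsonCos_mem_Icc {p q : X} (hp : p ≠ 0) (hq : q ≠ 0) :
    wilsonCos p q ∈ Set.Icc (-1 : ℝ) 1 := by
  have hp' := norm_pos_iff.2 hp
  have hq' := norm_pos_iff.2 hq
  have hpos : 0 < 2 * ‖p‖ * ‖q‖ := by positivity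
  have hle : ‖p - q‖ ^ 2 ≤ (‖p‖ + ‖q‖) ^ 2 :=
    pow_le_pow_left₀ (norm_nonneg _) (norm_sub_le p q) 2
  have hge : (‖p‖ - ‖q‖) ^ 2 ≤ ‖p - q‖ ^ 2 :=
    sq_le_sq.2 ((abs_norm_sub_norm_le p q).trans (le_abs_self _))
  constructor
  · rw [wilsonCos, le_div_iff₀ hpos]
    nlinarith
  · rw [wilsonCos, div_le_iff₀ hpos]
    nlinarith

variable [NormedSpace ℝ X]

lemma wilsonCos_smul_smul {s : ℝ} (hs : 0 < s) (p q : X) :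
    wilsonCos (s • p) (s • q) = wilsonCos p q := by
  simp only [wilsonCos, ← smul_sub, norm_smul, Real.norm_eq_abs, abs_of_pos hs]
  rw [← mul_div_mul_left (‖p‖ ^ 2 + ‖q‖ ^ 2 - ‖p - q‖ ^ 2) _ (pow_ne_zero 2 hs.ne')]
  congr 1 <;> ring

/-- If the Wilson angle has a joint limit along two rays, its cosine does not change when one
point is moved along its ray. -/
lemma wilsonCos_smul_right_of_tendsto {x y : X} (hx : x ≠ 0) (hy : y ≠ 0) {L : ℝ}
    (h : Tendsto (fun st : ℝ × ℝ => arccos (wilsonCos (st.1 • x) (st.2 • y)))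
      (nhdsWithin 0 (Set.Ioi 0) ×ˢ nhdsWithin 0 (Set.Ioi 0)) (nhds L))
    {r : ℝ} (hr : 0 < r) : wilsonCos x (r • y) = wilsonCos x y := by
  have key : ∀ a : ℝ, 0 < a → arccos (wilsonCos x (a • y)) = L := by
    intro a ha
    have hmul : Tendsto (fun s : ℝ => s * a) (nhdsWithin 0 (Set.Ioi 0))
        (nhdsWithin 0 (Set.Ioi 0)) := by
      refine tendsto_nhdsWithin_iff.2 ⟨?_, ?_⟩
      · have : Tendsto (fun s : ℝ => s * a) (nhds 0) (nhds (0 * a)) :=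
          (continuous_mul_const a).tendsto 0
        rw [zero_mul] at this
        exact this.mono_left nhdsWithin_le_nhds
      · filter_upwards [self_mem_nhdsWithin] with s hs
        exact mul_pos hs ha
    have hlim := h.comp (tendsto_id.prodMk hmul)
    refine tendsto_nhds_unique (tendsto_const_nhds.congr' ?_) hlim
    filter_upwards [self_mem_nhdsWithin] with s hs
    simp only [Function.comp_apply, id_eq, mul_smul]
    rw [wilsonCos_smul_smul hs]
  have h1 := key 1 one_pos
  rw [one_smul] at h1
  exact Real.arccos_injOn (wilsonCos_mem_Icc hx (smul_ne_zero hr.ne' hy))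
    (wilsonCos_mem_Icc hx hy) ((key r hr).trans h1.symm)

/-- The parallelogram law for `x` and `y` says that the Wilson angle at `0` of `x - y` and `-y`
is that of `x - y` and `-2 • y`. -/
lemma parallelogram_of_wilsonCos_eq {x y : X} (hxy : x - y ≠ 0) (hy : y ≠ 0)
    (h : wilsonCos (x - y) ((2 : ℝ) • -y) = wilsonCos (x - y) (-y)) :
    ‖x + y‖ ^ 2 + ‖x - y‖ ^ 2 = 2 * ‖x‖ ^ 2 + 2 * ‖y‖ ^ 2 := by
  have e1 : x - y - (2 : ℝ) • -y = x + y := by module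
  have e2 : x - y - -y = x := by module
  have hu := norm_ne_zero_iff.2 hxy
  have hy' := norm_ne_zero_iff.2 hy
  simp only [wilsonCos, e1, e2, norm_smul, norm_neg, Real.norm_eq_abs, abs_two] at h
  field_simp at h
  linarith

end WilsonAngle

lemma wilsonCos_smul_smul_of_inner {X : Type*} [NormedAddCommGroup X] [InnerProductSpace ℝ X]
    {s t : ℝ} (hs : 0 < s) (ht : 0 < t) (x y : X) :
    wilsonCos (s • x) (t • y) = inner ℝ x y / (‖x‖ * ‖y‖) := by
  have h : ‖s • x‖ ^ 2 + ‖t • y‖ ^ 2 - ‖s • x - t • y‖ ^ 2 = (2 * s * t) * inner ℝ x y := by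
    rw [norm_sub_sq_real, real_inner_smul_left, real_inner_smul_right]
    ring
  rw [wilsonCos, h, ← mul_div_mul_left (inner ℝ x y) _ (by positivity : 2 * s * t ≠ 0)]
  simp only [norm_smul, Real.norm_eq_abs, abs_of_pos hs, abs_of_pos ht]
  congr 1
  ring

theorem wilson_property_iff_inner_product
    {X : Type*} [NormedAddCommGroup X] [NormedSpace ℝ X]
    (hdim : 2 ≤ Module.rank ℝ X) :
    (∀ x y : X, x ≠ 0 → y ≠ 0 →
      ∃ L : ℝ, Tendsto
        (fun st : ℝ × ℝ =>
          Real.arccos ((‖st.1 • x‖ ^ 2 + ‖st.2 • y‖ ^ 2 - ‖st.1 • x - st.2 • y‖ ^ 2) /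
            (2 * ‖st.1 • x‖ * ‖st.2 • y‖)))
        ((nhdsWithin 0 (Set.Ioi 0)) ×ˢ (nhdsWithin 0 (Set.Ioi 0))) (nhds L)) ↔
    (∀ x y : X, ‖x + y‖ ^ 2 + ‖x - y‖ ^ 2 = 2 * ‖x‖ ^ 2 + 2 * ‖y‖ ^ 2) := by
  constructor
  · intro H x y
    rcases eq_or_ne y 0 with rfl | hy
    · simp
      ring
    rcases eq_or_ne (x - y) 0 with hxy | hxy
    · obtain rfl := sub_eq_zero.1 hxy
      rw [← two_smul ℝ x, norm_smul, sub_self, norm_zero, Real.norm_eq_abs, abs_two]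
      ring
    obtain ⟨L, hL⟩ := H (x - y) (-y) hxy (neg_ne_zero.2 hy)
    exact parallelogram_of_wilsonCos_eq hxy hy
      (wilsonCos_smul_right_of_tendsto hxy (neg_ne_zero.2 hy) hL two_pos)
  · intro H x y _ _
    let _ : InnerProductSpace ℝ X := InnerProductSpace.ofNorm ℝ fun u v => by
      linarith [H u v]
    refine ⟨arccos (inner ℝ x y / (‖x‖ * ‖y‖)), tendsto_const_nhds.congr' ?_⟩
    filter_upwards [prod_mem_prod self_mem_nhdsWithin self_mem_nhdsWithin] with st hst
    exact congrArg arccos (wilsonCos_smul_smul_of_inner hst.1 hst.2 x y).symm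
end

section
/- Let X be a real normed space with D-A-F angle ang. Then ang satisfies the parallelism property, i.e., for all x,y ∈ X_o, ang(x,y) = π if and only if y = αx for some α < 0, if and only if X is strictly convex. -/
open Real

/-- The Diminnie-Andalafte-Freese angle of a normed space. -/
noncomputable def angDAF {X : Type*} [NormedAddCommGroup X] [NormedSpace ℝ X]
    (x y : X) : ℝ :=
  Real.arccos (1 - (1 / 2) * ‖‖x‖⁻¹ • x - ‖y‖⁻¹ • y‖ ^ 2)

/-- Normalizing a nonzero vector produces a unit vector. -/
theorem norm_inv_norm_smul {X : Type*} [NormedAddCommGroup X] [NormedSpace ℝ X]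
    {x : X} (hx : x ≠ 0) : ‖‖x‖⁻¹ • x‖ = 1 :=
  norm_smul_inv_norm (𝕜 := ℝ) hx

/-- Equality in the triangle inequality is inherited by all nonnegative combinations. -/
theorem norm_smul_add_smul_of_norm_add_eq {X : Type*} [NormedAddCommGroup X] [NormedSpace ℝ X]
    {x y : X} (h : ‖x + y‖ = ‖x‖ + ‖y‖) {a b : ℝ} (ha : 0 ≤ a) (hb : 0 ≤ b) :
    ‖a • x + b • y‖ = a * ‖x‖ + b * ‖y‖ := by
  refine le_antisymm ?_ ?_
  · simpa [norm_smul_of_nonneg ha, norm_smul_of_nonneg hb] using norm_add_le (a • x) (b • y)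
  · have hma : 0 ≤ max a b - a := sub_nonneg.2 (le_max_left a b)
    have hmb : 0 ≤ max a b - b := sub_nonneg.2 (le_max_right a b)
    have hsum : max a b • (x + y) =
        a • x + b • y + ((max a b - a) • x + (max a b - b) • y) := by module
    have hnorm := norm_add_le (a • x + b • y) ((max a b - a) • x + (max a b - b) • y)
    have hrest := norm_add_le ((max a b - a) • x) ((max a b - b) • y)
    rw [← hsum, norm_smul_of_nonneg (ha.trans (le_max_left a b)), h] at hnorm
    rw [norm_smul_of_nonneg hma, norm_smul_of_nonneg hmb] at hrest
    linarith

theorem angDAF_eq_pi_iff {X : Type*} [NormedAddCommGroup X] [NormedSpace ℝ X]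
    {x y : X} (hx : x ≠ 0) (hy : y ≠ 0) :
    angDAF x y = Real.pi ↔ ‖‖x‖⁻¹ • x - ‖y‖⁻¹ • y‖ = 2 := by
  have hle := norm_sub_le (‖x‖⁻¹ • x) (‖y‖⁻¹ • y)
  rw [norm_inv_norm_smul hx, norm_inv_norm_smul hy] at hle
  rw [angDAF, Real.arccos_eq_pi]
  constructor
  · intro h
    nlinarith [norm_nonneg (‖x‖⁻¹ • x - ‖y‖⁻¹ • y)]
  · intro h
    rw [h]
    norm_num

theorem angDAF_smul_of_neg {X : Type*} [NormedAddCommGroup X] [NormedSpace ℝ X]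
    {x : X} (hx : x ≠ 0) {α : ℝ} (hα : α < 0) : angDAF x (α • x) = Real.pi := by
  have hxn : ‖x‖ ≠ 0 := norm_ne_zero_iff.2 hx
  rw [angDAF_eq_pi_iff hx (smul_ne_zero hα.ne hx), norm_smul, Real.norm_of_nonpos hα.le, smul_smul,
    ← sub_smul, norm_smul]
  have hcoef : ‖x‖⁻¹ - (-α * ‖x‖)⁻¹ * α = 2 * ‖x‖⁻¹ := by
    have := hα.ne
    field_simp
    norm_num
  rw [hcoef, Real.norm_of_nonneg (by positivity)]
  field_simp

theorem angDAF_neg_eq_pi_of_norm_add_eq {X : Type*} [NormedAddCommGroup X] [NormedSpace ℝ X]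
    {x y : X} (hx : x ≠ 0) (hy : y ≠ 0) (h : ‖x + y‖ = ‖x‖ + ‖y‖) :
    angDAF x (-y) = Real.pi := by
  rw [angDAF_eq_pi_iff hx (neg_ne_zero.2 hy), norm_neg, smul_neg, sub_neg_eq_add,
    norm_smul_add_smul_of_norm_add_eq h (by positivity) (by positivity),
    inv_mul_cancel₀ (norm_ne_zero_iff.2 hx), inv_mul_cancel₀ (norm_ne_zero_iff.2 hy)]
  norm_num

theorem angDAF_parallelism_iff_strictly_convex
    {X : Type*} [NormedAddCommGroup X] [NormedSpace ℝ X] :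
    (∀ x y : X, x ≠ 0 → y ≠ 0 → (angDAF x y = Real.pi ↔ ∃ α : ℝ, α < 0 ∧ y = α • x)) ↔
    (∀ x y : X, x ≠ 0 → y ≠ 0 → ‖x + y‖ = ‖x‖ + ‖y‖ → ∃ α : ℝ, 0 < α ∧ y = α • x) := by
  constructor
  · intro hpar x y hx hy h
    obtain ⟨α, hα, hyα⟩ :=
      (hpar x (-y) hx (neg_ne_zero.2 hy)).1 (angDAF_neg_eq_pi_of_norm_add_eq hx hy h)
    exact ⟨-α, neg_pos.2 hα, by rw [neg_smul, ← hyα, neg_neg]⟩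
  · intro hconv x y hx hy
    constructor
    · intro h
      rw [angDAF_eq_pi_iff hx hy, sub_eq_add_neg] at h
      have hyn : 0 < ‖y‖ := norm_pos_iff.2 hy
      have hxn : 0 < ‖x‖ := norm_pos_iff.2 hx
      obtain ⟨α, hα, hyα⟩ := hconv (‖x‖⁻¹ • x) (-(‖y‖⁻¹ • y))
        (smul_ne_zero (inv_pos.2 hxn).ne' hx)
        (neg_ne_zero.2 (smul_ne_zero (inv_pos.2 hyn).ne' hy))
        (by rw [h, norm_neg, norm_inv_norm_smul hx, norm_inv_norm_smul hy]; norm_num)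
      refine ⟨-(‖y‖ * (α * ‖x‖⁻¹)), neg_neg_of_pos (by positivity), ?_⟩
      rw [neg_smul, mul_smul, mul_smul, ← hyα, smul_neg, neg_neg, smul_inv_smul₀ hyn.ne']
    · rintro ⟨α, hα, rfl⟩
      exact angDAF_smul_of_neg hx hα
end
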